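/- Let n ≥ 1 and p ≥ 1 be integers and a ≥ 1 a real constant with 2p < n+2a, and let α = (n+2a+2p)/(n+2a−2p). If u ∈ C^{2p}(closure of ℝ^{n+1}_+) is nonnegative, not identically zero, and satisfies (−A)^p u = u^α in ℝ^{n+1}_+ = ℝ^n × (0,∞), then there exist x₀ ∈ ℝ^n and t > 0 such that u(x,y) = c₀ ( t / (t² + 4y + |x−x₀|²) )^{(n+2a−2p)/2}, where c₀ > 0 is a constant depending only on n, a and p. -/

import Mathlib

open MeasureTheory Metric Filter Function Topology

/-- Directional derivative of a function on `ℝⁿ × ℝ` along the vector `v`. -/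
noncomputable def pdirP (n : ℕ) (v : EuclideanSpace ℝ (Fin n) × ℝ)
    (f : EuclideanSpace ℝ (Fin n) × ℝ → ℝ) (z : EuclideanSpace ℝ (Fin n) × ℝ) : ℝ :=
  fderiv ℝ f z v

/-- The degenerate elliptic operator `A u = y ∂²u/∂y² + Δ_x u + a ∂u/∂y` acting on functions
of `(x, y) ∈ ℝⁿ × ℝ`. -/
noncomputable def opA (n : ℕ) (a : ℝ) (f : EuclideanSpace ℝ (Fin n) × ℝ → ℝ)
    (z : EuclideanSpace ℝ (Fin n) × ℝ) : ℝ :=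
  z.2 * pdirP n (0, 1) (pdirP n (0, 1) f) z +
    (∑ i : Fin n,
      pdirP n (EuclideanSpace.single i 1, 0) (pdirP n (EuclideanSpace.single i 1, 0) f) z) +
    a * pdirP n (0, 1) f z

/-- `(−A)^p`. -/
noncomputable def negAIter (n : ℕ) (a : ℝ) (p : ℕ)
    (f : EuclideanSpace ℝ (Fin n) × ℝ → ℝ) : EuclideanSpace ℝ (Fin n) × ℝ → ℝ :=
  (fun g z => -opA n a g z)^[p] f

/-- The inversion in the sphere of center `c` and radius `l`. -/
noncomputable def kinv {V : Type*} [NormedAddCommGroup V] [InnerProductSpace ℝ V]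
    (c : V) (l : ℝ) (z : V) : V := c + (l / ‖z - c‖) ^ 2 • (z - c)

section Calc
variable {V : Type*} [NormedAddCommGroup V] [InnerProductSpace ℝ V]

noncomputable def kR (f : V → ℝ) (γ : ℝ) (e z₀ : V) (l t : ℝ) : ℝ :=
  l ^ γ * ((‖e - t • z₀‖ ^ 2) ^ (-γ / 2) *
    f (z₀ + (l ^ 2 * t / ‖e - t • z₀‖ ^ 2) • (e - t • z₀)))

lemma kR_eq (f : V → ℝ) (γ : ℝ) (e z₀ : V) (l t : ℝ) (hl : 0 < l) (ht : 0 < t)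
    (hne : e - t • z₀ ≠ 0)
    (hK : ∀ z, z ≠ z₀ → f z = (l / ‖z - z₀‖) ^ γ * f (kinv z₀ l z)) :
    kR f γ e z₀ l t = t ^ (-γ) * f (t⁻¹ • e) := by
  have h1 : t⁻¹ • e - z₀ = t⁻¹ • (e - t • z₀) := by
    rw [smul_sub, smul_smul, inv_mul_cancel₀ ht.ne', one_smul]
  have hr : 0 < ‖e - t • z₀‖ := norm_pos_iff.2 hne
  have h2 : ‖t⁻¹ • e - z₀‖ = t⁻¹ * ‖e - t • z₀‖ := by
    rw [h1, norm_smul, Real.norm_of_nonneg (by positivity)]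
  have h3 : t⁻¹ • e ≠ z₀ := by
    intro h
    rw [h, sub_self, norm_zero] at h2
    have : 0 < t⁻¹ * ‖e - t • z₀‖ := by positivity
    linarith
  rw [hK _ h3, kinv, h2, h1, kR]
  have h4 : (l / (t⁻¹ * ‖e - t • z₀‖)) ^ 2 • t⁻¹ • (e - t • z₀)
      = (l ^ 2 * t / ‖e - t • z₀‖ ^ 2) • (e - t • z₀) := by
    rw [smul_smul]; congr 1; field_simp
  rw [h4]
  have h5 : (l / (t⁻¹ * ‖e - t • z₀‖)) = l * t * ‖e - t • z₀‖⁻¹ := by field_simp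
  rw [h5, Real.mul_rpow (by positivity) (by positivity), Real.mul_rpow hl.le ht.le,
    Real.inv_rpow hr.le, ← Real.rpow_natCast (‖e - t • z₀‖) 2, ← Real.rpow_mul hr.le,
    ← Real.rpow_neg hr.le]
  have h6 : t ^ (-γ) * t ^ γ = 1 := by rw [← Real.rpow_add ht]; simp
  have h7 : ((2 : ℕ) : ℝ) * (-γ / 2) = -γ := by push_cast; ring
  rw [h7]
  linear_combination (-(l ^ γ * ‖e - t • z₀‖ ^ (-γ) *
    f (z₀ + (l ^ 2 * t / ‖e - t • z₀‖ ^ ((2 : ℕ) : ℝ)) • (e - t • z₀)))) * h6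

lemma kR_hasDerivAt (f : V → ℝ) (γ : ℝ) (e z₀ : V) (l : ℝ) (he : ‖e‖ = 1)
    (hf : Differentiable ℝ f) :
    HasDerivAt (kR f γ e z₀ l)
      (l ^ γ * (γ * inner ℝ e z₀ * f z₀ + l ^ 2 * fderiv ℝ f z₀ e)) 0 := by
  have hp : HasDerivAt (fun t : ℝ => e - t • z₀) (-z₀) 0 := by
    simpa using ((hasDerivAt_id (0 : ℝ)).smul_const z₀).const_sub e
  have hn : HasDerivAt (fun t : ℝ => ‖e - t • z₀‖ ^ 2) (-2 * inner ℝ e z₀) 0 := by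
    have := hp.norm_sq
    simpa [inner_neg_right] using this
  have hr : HasDerivAt (fun t : ℝ => (‖e - t • z₀‖ ^ 2) ^ (-γ / 2)) (γ * inner ℝ e z₀) 0 := by
    have := hn.rpow_const (p := -γ / 2) (Or.inl (by simp [he]))
    refine this.congr_deriv ?_
    simp [he]; ring
  have hq : HasDerivAt (fun t : ℝ => l ^ 2 * t / ‖e - t • z₀‖ ^ 2) (l ^ 2) 0 := by
    have := ((hasDerivAt_id (0 : ℝ)).const_mul (l ^ 2)).div hn (by simp [he])
    refine this.congr_deriv ?_
    simp [he]
  have hc : HasDerivAt (fun t : ℝ => z₀ + (l ^ 2 * t / ‖e - t • z₀‖ ^ 2) • (e - t • z₀))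
      (l ^ 2 • e) 0 := by
    have := (hq.smul hp).const_add z₀
    refine this.congr_deriv ?_
    simp
  have hfc : HasDerivAt (fun t : ℝ => f (z₀ + (l ^ 2 * t / ‖e - t • z₀‖ ^ 2) • (e - t • z₀)))
      (l ^ 2 * fderiv ℝ f z₀ e) 0 := by
    have h0 : HasFDerivAt f (fderiv ℝ f z₀)
        (z₀ + (l ^ 2 * 0 / ‖e - (0:ℝ) • z₀‖ ^ 2) • (e - (0:ℝ) • z₀)) := by
      simpa using (hf z₀).hasFDerivAt
    have := h0.comp_hasDerivAt (0 : ℝ) hc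
    simpa [Function.comp_def] using this
  have := (hr.mul hfc).const_mul (l ^ γ)
  refine this.congr_deriv ?_
  simp [he]

/-- Two such expansions at infinity agree. -/
lemma kR_compare (f : V → ℝ) (γ : ℝ) (e z₀ z₁ : V) (l₀ l₁ : ℝ) (he : ‖e‖ = 1)
    (hl₀ : 0 < l₀) (hl₁ : 0 < l₁)
    (hf : Differentiable ℝ f)
    (hK₀ : ∀ z, z ≠ z₀ → f z = (l₀ / ‖z - z₀‖) ^ γ * f (kinv z₀ l₀ z))
    (hK₁ : ∀ z, z ≠ z₁ → f z = (l₁ / ‖z - z₁‖) ^ γ * f (kinv z₁ l₁ z)) :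
    l₀ ^ γ * f z₀ = l₁ ^ γ * f z₁ ∧
    l₀ ^ γ * (γ * inner ℝ e z₀ * f z₀ + l₀ ^ 2 * fderiv ℝ f z₀ e) =
    l₁ ^ γ * (γ * inner ℝ e z₁ * f z₁ + l₁ ^ 2 * fderiv ℝ f z₁ e) := by
  have hd₀ := kR_hasDerivAt f γ e z₀ l₀ he hf
  have hd₁ := kR_hasDerivAt f γ e z₁ l₁ he hf
  have hne : ∀ w : V, ∀ᶠ t : ℝ in 𝓝[>] 0, e - t • w ≠ 0 := by
    intro w
    have hcont : ContinuousAt (fun t : ℝ => e - t • w) 0 := by fun_prop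
    have : ∀ᶠ t : ℝ in 𝓝 0, e - t • w ≠ 0 := by
      apply hcont.eventually_ne
      simp only [zero_smul, sub_zero]
      rintro rfl
      simp at he
    exact this.filter_mono nhdsWithin_le_nhds
  have heq : kR f γ e z₀ l₀ =ᶠ[𝓝[>] 0] kR f γ e z₁ l₁ := by
    filter_upwards [hne z₀, hne z₁, self_mem_nhdsWithin] with t h0 h1 ht
    rw [kR_eq f γ e z₀ l₀ t hl₀ ht h0 hK₀, kR_eq f γ e z₁ l₁ t hl₁ ht h1 hK₁]
  have h00 : kR f γ e z₀ l₀ 0 = kR f γ e z₁ l₁ 0 := by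
    have a0 : Tendsto (kR f γ e z₀ l₀) (𝓝[>] 0) (𝓝 (kR f γ e z₀ l₀ 0)) :=
      hd₀.continuousAt.tendsto.mono_left nhdsWithin_le_nhds
    have a1 : Tendsto (kR f γ e z₁ l₁) (𝓝[>] 0) (𝓝 (kR f γ e z₁ l₁ 0)) :=
      hd₁.continuousAt.tendsto.mono_left nhdsWithin_le_nhds
    exact tendsto_nhds_unique a0 (a1.congr' heq.symm)
  constructor
  · simpa [kR, he] using h00
  · have a0 := hd₀.hasDerivWithinAt (s := Set.Ioi 0)
    have a1 := hd₁.hasDerivWithinAt (s := Set.Ioi 0)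
    have a2 := a1.congr_of_eventuallyEq heq h00
    exact (uniqueDiffWithinAt_Ioi (0:ℝ)).eq_deriv _ a0 a2

lemma bubble_of_kelvin [CompleteSpace V] [Nontrivial V] (f : V → ℝ) (γ : ℝ) (hγ : 0 < γ)
    (hf : Differentiable ℝ f) (hpos : ∀ z, 0 < f z)
    (hK : ∀ z₀, ∃ l > 0, ∀ z, z ≠ z₀ → f z = (l / ‖z - z₀‖) ^ γ * f (kinv z₀ l z)) :
    ∃ (x : V) (d A : ℝ), 0 < d ∧ 0 < A ∧ ∀ z, f z = A * (d + ‖z - x‖ ^ 2) ^ (-γ / 2) := by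
  choose l hl hK using hK
  set A := l 0 ^ γ * f 0 with hA
  have hApos : 0 < A := mul_pos (Real.rpow_pos_of_pos (hl 0) _) (hpos 0)
  obtain ⟨e₀, he₀⟩ := exists_norm_eq V (zero_le_one (α := ℝ))
  have hAz : ∀ z, l z ^ γ * f z = A := fun z =>
    (kR_compare f γ e₀ z 0 (l z) (l 0) he₀ (hl z) (hl 0) hf (hK z) (hK 0)).1
  have hl2 : ∀ z, l z ^ 2 = A ^ (2 / γ) * f z ^ (-2 / γ) := by
    intro z
    have h1 : l z ^ γ = A * (f z)⁻¹ := by rw [← hAz z]; field_simp [(hpos z).ne']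
    have h2 : l z ^ 2 = (l z ^ γ) ^ (2 / γ) := by
      rw [← Real.rpow_mul (hl z).le, mul_div_cancel₀ _ hγ.ne']; norm_cast
    rw [h2, h1, Real.mul_rpow hApos.le (inv_nonneg.2 (hpos z).le), Real.inv_rpow (hpos z).le,
      ← Real.rpow_neg (hpos z).le, neg_div]
  have hD1 : ∀ z e, ‖e‖ = 1 → γ * inner ℝ e z + l z ^ 2 * (fderiv ℝ f z e / f z)
      = l 0 ^ 2 * (fderiv ℝ f 0 e / f 0) := by
    intro z e he
    have h := (kR_compare f γ e z 0 (l z) (l 0) he (hl z) (hl 0) hf (hK z) (hK 0)).2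
    rw [inner_zero_right, mul_zero, zero_mul, zero_add] at h
    have e1 : l z ^ γ * (γ * inner ℝ e z * f z + l z ^ 2 * fderiv ℝ f z e)
        = A * (γ * inner ℝ e z + l z ^ 2 * (fderiv ℝ f z e / f z)) := by
      rw [← hAz z]; field_simp [(hpos z).ne']
    have e2 : l 0 ^ γ * (l 0 ^ 2 * fderiv ℝ f 0 e) = A * (l 0 ^ 2 * (fderiv ℝ f 0 e / f 0)) := by
      rw [← hAz 0]; field_simp [(hpos 0).ne']
    rw [e1, e2] at h
    exact mul_left_cancel₀ hApos.ne' h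
  have hD : ∀ z e, γ * inner ℝ e z + l z ^ 2 * (fderiv ℝ f z e / f z)
      = l 0 ^ 2 * (fderiv ℝ f 0 e / f 0) := by
    intro z e
    by_cases h0 : e = 0
    · simp [h0]
    have hn : 0 < ‖e‖ := norm_pos_iff.2 h0
    have h := hD1 z (‖e‖⁻¹ • e) (by rw [norm_smul, norm_inv, norm_norm, inv_mul_cancel₀ hn.ne'])
    rw [map_smul, map_smul, real_inner_smul_left, smul_eq_mul, smul_eq_mul] at h
    field_simp at h
    field_simp
    linarith
  -- the function `k = f ^ (-2/γ)`
  set B := A ^ (-2 / γ) with hB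
  have hBpos : 0 < B := Real.rpow_pos_of_pos hApos _
  have hAB : A ^ (2 / γ) * B = 1 := by
    rw [hB, ← Real.rpow_add hApos, neg_div, add_neg_cancel, Real.rpow_zero]
  set ℓ : V →L[ℝ] ℝ := (l 0 ^ 2 / f 0) • fderiv ℝ f 0 with hℓ
  set x : V := (1 / γ) • (InnerProductSpace.toDual ℝ V).symm ℓ with hx
  have hxi : ∀ e, γ * inner ℝ e x = ℓ e := by
    intro e
    rw [hx, real_inner_smul_right, real_inner_comm, InnerProductSpace.toDual_symm_apply]
    field_simp
  set h : V → ℝ := fun z => f z ^ (-2 / γ) - B * ‖z - x‖ ^ 2 with hh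
  have hder : ∀ z, HasFDerivAt h (0 : V →L[ℝ] ℝ) z := by
    intro z
    have a1 : HasFDerivAt (fun z => f z ^ (-2 / γ))
        (((-2 / γ) * f z ^ (-2 / γ - 1)) • fderiv ℝ f z) z :=
      (hf z).hasFDerivAt.rpow_const (Or.inl (hpos z).ne')
    have a2 : HasFDerivAt (fun z => B * ‖z - x‖ ^ 2) (B • (2 • (innerSL ℝ (z - x)))) z := by
      have := ((hasFDerivAt_id (𝕜 := ℝ) z).sub_const x).norm_sq
      have := this.const_mul B
      simpa using this
    have a3 := a1.sub a2
    refine a3.congr_fderiv ?_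
    ext e
    simp only [zero_apply, sub_apply,
      smul_apply, smul_eq_mul, innerSL_apply_apply, nsmul_eq_mul]
    have b1 := hD z e
    have b2 := hxi e
    rw [hℓ] at b2
    simp only [smul_apply, smul_eq_mul] at b2
    have b3 : f z ^ (-2 / γ - 1) = f z ^ (-2 / γ) / f z := by
      rw [Real.rpow_sub (hpos z), Real.rpow_one]
    rw [hl2 z] at b1
    have b4 : inner ℝ (z - x) e = inner ℝ e z - inner ℝ e x := by
      rw [real_inner_comm, inner_sub_right]
    rw [b3, b4]
    have b5 : B * (γ * inner ℝ e z + A ^ (2 / γ) * f z ^ (-2 / γ) * (fderiv ℝ f z e / f z))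
        = B * (γ * inner ℝ e x) := by rw [b1, b2]; ring
    have b6 : f z ^ (-2 / γ) / f z * fderiv ℝ f z e = B * (γ * inner ℝ e x) - B * (γ * inner ℝ e z) := by
      linear_combination b5 - (f z ^ (-2 / γ) / f z * fderiv ℝ f z e) * hAB
    have b7 : (-2 / γ) * (f z ^ (-2 / γ) / f z) * fderiv ℝ f z e = (-2 / γ) * (B * (γ * inner ℝ e x) - B * (γ * inner ℝ e z)) := by
      rw [← b6]; ring
    rw [b7]
    push_cast
    field_simp
    ring
  have hconst : ∀ z, h z = h x := by
    intro z
    exact is_const_of_fderiv_eq_zero (fun z => (hder z).differentiableAt)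
      (fun z => (hder z).fderiv) z x
  have hhx : h x = f x ^ (-2 / γ) := by simp [hh]
  have hhx0 : 0 < h x := by rw [hhx]; exact Real.rpow_pos_of_pos (hpos x) _
  refine ⟨x, h x / B, A, by positivity, hApos, fun z => ?_⟩
  have c1 : f z ^ (-2 / γ) = B * (h x / B + ‖z - x‖ ^ 2) := by
    have := hconst z
    rw [mul_add, mul_div_cancel₀ _ hBpos.ne', ← this]; simp [hh]
  have c2 : f z = (f z ^ (-2 / γ)) ^ (-γ / 2) := by
    rw [← Real.rpow_mul (hpos z).le]
    have : -2 / γ * (-γ / 2) = 1 := by field_simp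
    rw [this, Real.rpow_one]
  have c3 : A = B ^ (-γ / 2) := by
    rw [hB, ← Real.rpow_mul hApos.le]
    have : -2 / γ * (-γ / 2) = 1 := by field_simp
    rw [this, Real.rpow_one]
  rw [c2, c1, Real.mul_rpow hBpos.le (by positivity), ← c3]

end Calc

/-- Kelvin transform. -/
noncomputable def kelv {Z : Type*} [NormedAddCommGroup Z] [InnerProductSpace ℝ Z]
    (γ : ℝ) (v : Z → ℝ) (c : Z) (l : ℝ) (z : Z) : ℝ :=
  (l / ‖z - c‖) ^ γ * v (kinv c l z)

/-- Hypotheses for the method of moving spheres with fixed centre. -/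
structure MS {Z W : Type*} [NormedAddCommGroup Z] [InnerProductSpace ℝ Z] [MeasurableSpace Z]
    [MeasurableSpace W] (μ : Measure W) (Q : Z → W → ℝ) (pr : W → Z) (v : Z → ℝ)
    (N γ α c : ℝ) (z₀ : Z) (J : ℝ → W → W) : Prop where
  hv : Continuous v
  vpos : ∀ z, 0 < v z
  cpos : 0 < c
  hγ : 0 < γ
  hα : 1 < α
  hN : 2 * N - γ * α = γ
  mpr : Measurable pr
  mQ : ∀ z, Measurable (Q z)
  Q0 : ∀ z w, 0 ≤ Q z w
  cQ : ∀ w, Continuous (fun z => Q z w)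
  Qnull : ∀ z, ∀ᵐ w ∂μ, Q z w ≠ 0
  rep : ∀ z, ENNReal.ofReal (c * v z)
      = ∫⁻ w, ENNReal.ofReal (Q z w ^ (-γ / 2) * v (pr w) ^ α) ∂μ
  mJ : ∀ l, Measurable (J l)
  prJ : ∀ l, 0 < l → ∀ w, pr w ≠ z₀ → pr (J l w) = kinv z₀ l (pr w)
  JJ : ∀ l, 0 < l → ∀ w, pr w ≠ z₀ → J l (J l w) = w
  h1 : ∀ l, 0 < l → ∀ z w, z ≠ z₀ → pr w ≠ z₀ →
    ‖z - z₀‖ ^ 2 * Q (kinv z₀ l z) w = ‖pr w - z₀‖ ^ 2 * Q z (J l w)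
  h2 : ∀ l, 0 < l → ∀ z w, pr w ≠ z₀ →
    ‖pr w - z₀‖ ^ 2 * Q z (J l w)
      = l ^ 2 * Q z w + (‖z - z₀‖ ^ 2 - l ^ 2) * (‖pr w - z₀‖ ^ 2 - l ^ 2)
  jac : ∀ l, 0 < l → ∀ h : W → ENNReal, Measurable h →
    ∫⁻ w, h w ∂μ = ∫⁻ w, h (J l w) * ENNReal.ofReal ((l / ‖pr w - z₀‖) ^ (2 * N)) ∂μ
  sph : ∀ l : ℝ, ∀ᵐ w ∂μ, ‖pr w - z₀‖ ≠ l
  hopen : ∀ O : Set Z, IsOpen O → (∃ w, pr w ∈ O) → μ (pr ⁻¹' O) ≠ 0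

section kinvlemmas
variable {Z : Type*} [NormedAddCommGroup Z] [InnerProductSpace ℝ Z]

lemma kinv_sub_norm (c : Z) (l : ℝ) (hl : 0 < l) (z : Z) (hz : z ≠ c) :
    ‖kinv c l z - c‖ = l ^ 2 / ‖z - c‖ := by
  have : 0 < ‖z - c‖ := norm_pos_iff.2 (sub_ne_zero.2 hz)
  rw [kinv, add_sub_cancel_left, norm_smul, Real.norm_of_nonneg (by positivity)]
  field_simp

lemma kinv_ne (c : Z) (l : ℝ) (hl : 0 < l) (z : Z) (hz : z ≠ c) : kinv c l z ≠ c := by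
  have : 0 < ‖z - c‖ := norm_pos_iff.2 (sub_ne_zero.2 hz)
  have h := kinv_sub_norm c l hl z hz
  intro h'
  rw [h', sub_self, norm_zero] at h
  have : 0 < l ^ 2 / ‖z - c‖ := by positivity
  linarith

lemma kinv_kinv (c : Z) (l : ℝ) (hl : 0 < l) (z : Z) (hz : z ≠ c) :
    kinv c l (kinv c l z) = z := by
  have h0 : 0 < ‖z - c‖ := norm_pos_iff.2 (sub_ne_zero.2 hz)
  have h := kinv_sub_norm c l hl z hz
  have h2 : kinv c l z - c = (l / ‖z - c‖) ^ 2 • (z - c) := by simp [kinv]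
  rw [kinv, h, h2, smul_smul]
  have : (l / (l ^ 2 / ‖z - c‖)) ^ 2 * (l / ‖z - c‖) ^ 2 = 1 := by field_simp
  rw [this, one_smul]; abel

lemma kelv_cont (γ : ℝ) (v : Z → ℝ) (hv : Continuous v) (hγ : 0 < γ) (c : Z) (l : ℝ) (z : Z)
    (hz : z ≠ c) : ContinuousAt (fun q : ℝ × Z => kelv γ v c q.1 q.2) (l, z) := by
  have h0 : ‖z - c‖ ≠ 0 := norm_ne_zero_iff.2 (sub_ne_zero.2 hz)
  unfold kelv kinv
  have h1 : ContinuousAt (fun q : ℝ × Z => q.1 / ‖q.2 - c‖) (l, z) :=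
    ContinuousAt.div (by fun_prop) (by fun_prop) h0
  refine ContinuousAt.mul ?_ ?_
  · exact h1.rpow_const (Or.inr hγ.le)
  · refine hv.continuousAt.comp ?_
    refine continuousAt_const.add (ContinuousAt.smul (h1.pow 2) (by fun_prop))

lemma kelv_pos (γ : ℝ) (v : Z → ℝ) (hv : ∀ z, 0 < v z) (c : Z) (l : ℝ) (hl : 0 < l) (z : Z)
    (hz : z ≠ c) : 0 < kelv γ v c l z := by
  have h0 : 0 < ‖z - c‖ := norm_pos_iff.2 (sub_ne_zero.2 hz)
  exact mul_pos (Real.rpow_pos_of_pos (by positivity) _) (hv _)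

lemma kelv_kelv (γ : ℝ) (v : Z → ℝ) (c : Z) (l : ℝ) (hl : 0 < l) (z : Z) (hz : z ≠ c) :
    (l / ‖z - c‖) ^ γ * kelv γ v c l (kinv c l z) = v z := by
  have h0 : 0 < ‖z - c‖ := norm_pos_iff.2 (sub_ne_zero.2 hz)
  rw [kelv, kinv_kinv c l hl z hz, kinv_sub_norm c l hl z hz, ← mul_assoc,
    ← Real.mul_rpow (by positivity) (by positivity)]
  have : l / ‖z - c‖ * (l / (l ^ 2 / ‖z - c‖)) = 1 := by field_simp
  rw [this, Real.one_rpow, one_mul]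

end kinvlemmas

namespace MS
variable {Z W : Type*} [NormedAddCommGroup Z] [InnerProductSpace ℝ Z] [MeasurableSpace Z]
    [BorelSpace Z] [FiniteDimensional ℝ Z]
    [MeasurableSpace W] {μ : Measure W} {Q : Z → W → ℝ} {pr : W → Z} {v : Z → ℝ}
    {N γ α c : ℝ} {z₀ : Z} {J : ℝ → W → W}

/-- the reflected kernel -/
noncomputable def kt (Q : Z → W → ℝ) (pr : W → Z) (γ : ℝ) (z₀ : Z) (J : ℝ → W → W) (l : ℝ)
    (z : Z) (w : W) : ℝ := (l / ‖pr w - z₀‖) ^ γ * Q z (J l w) ^ (-γ / 2)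

lemma kelv_meas (H : MS μ Q pr v N γ α c z₀ J) (l : ℝ) :
    Measurable (fun w => kelv γ v z₀ l (pr w)) := by
  have := H.mpr
  have hv := H.hv.measurable
  unfold kelv kinv
  refine Measurable.mul ?_ (hv.comp ?_) <;> fun_prop

lemma kt_meas (H : MS μ Q pr v N γ α c z₀ J) (l : ℝ) (z : Z) :
    Measurable (kt Q pr γ z₀ J l z) := by
  have := H.mpr
  have h2 := (H.mQ z).comp (H.mJ l)
  unfold kt
  refine Measurable.mul (by fun_prop) (Measurable.pow_const h2 _)

/-- splitting a lintegral over the inside of the ball -/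
lemma split (H : MS μ Q pr v N γ α c z₀ J) (l : ℝ) (hl : 0 < l) (h : W → ENNReal)
    (hh : Measurable h) :
    ∫⁻ w, h w ∂μ = ∫⁻ w in {w | ‖pr w - z₀‖ < l},
      (h w + h (J l w) * ENNReal.ofReal ((l / ‖pr w - z₀‖) ^ (2 * N))) ∂μ := by
  have mpr := H.mpr
  have mB : MeasurableSet {w | ‖pr w - z₀‖ < l} := measurableSet_lt (by fun_prop) (by fun_prop)
  rw [lintegral_add_left hh, ← lintegral_add_compl h mB]
  congr 1
  rw [← lintegral_indicator mB.compl, H.jac l hl _ (hh.indicator mB.compl), ← lintegral_indicator mB]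
  refine lintegral_congr_ae ?_
  filter_upwards [H.sph 0, H.sph l] with w h0 h1
  have hw : pr w ≠ z₀ := fun h => h0 (by simp [h])
  have h0' : 0 < ‖pr w - z₀‖ := lt_of_le_of_ne (norm_nonneg _) (Ne.symm h0)
  by_cases hlt : ‖pr w - z₀‖ < l
  · have h3 : J l w ∈ {w | ‖pr w - z₀‖ < l}ᶜ := by
      simp only [Set.mem_compl_iff, Set.mem_setOf_eq, not_lt, H.prJ l hl w hw,
        kinv_sub_norm z₀ l hl _ hw]
      rw [le_div_iff₀ h0']; nlinarith
    rw [Set.indicator_of_mem h3, Set.indicator_of_mem (by exact hlt)]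
  · have h3 : J l w ∉ {w | ‖pr w - z₀‖ < l}ᶜ := by
      have : l < ‖pr w - z₀‖ := lt_of_le_of_ne (not_lt.1 hlt) (Ne.symm h1)
      simp only [Set.mem_compl_iff, Set.mem_setOf_eq, not_lt, H.prJ l hl w hw,
        kinv_sub_norm z₀ l hl _ hw, not_le]
      rw [div_lt_iff₀ h0']; nlinarith
    rw [Set.indicator_of_notMem h3, Set.indicator_of_notMem (by exact hlt), zero_mul]

lemma alg1 {x γ α N A : ℝ} (hx : 0 < x) (hN : 2 * N - γ * α = γ) (hA : 0 ≤ A) :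
    A ^ α * x ^ (2 * N) = x ^ γ * (x ^ γ * A) ^ α := by
  rw [Real.mul_rpow (by positivity) hA, ← Real.rpow_mul hx.le, ← mul_assoc, ← Real.rpow_add hx,
    mul_comm]
  congr 2; linarith

lemma id1 (H : MS μ Q pr v N γ α c z₀ J) (l : ℝ) (hl : 0 < l) (z : Z) :
    ENNReal.ofReal (c * v z) = ∫⁻ w in {w | ‖pr w - z₀‖ < l},
      ENNReal.ofReal (Q z w ^ (-γ / 2) * v (pr w) ^ α
        + kt Q pr γ z₀ J l z w * kelv γ v z₀ l (pr w) ^ α) ∂μ := by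
  have mpr := H.mpr
  have mQ := H.mQ z
  have hv := H.hv.measurable
  rw [H.rep z, H.split l hl _ (by fun_prop)]
  refine lintegral_congr_ae (ae_restrict_of_ae ?_)
  filter_upwards [H.sph 0] with w h0
  have hw : pr w ≠ z₀ := fun h => h0 (by simp [h])
  have h0' : 0 < ‖pr w - z₀‖ := lt_of_le_of_ne (norm_nonneg _) (Ne.symm h0)
  have hx : 0 < l / ‖pr w - z₀‖ := by positivity
  have q1 := H.Q0 z w
  have q2 := H.Q0 z (J l w)
  have q3 := (H.vpos (pr w)).le
  have q5 := (H.vpos (kinv z₀ l (pr w))).le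
  have q4 := (kelv_pos γ v H.vpos z₀ l hl (pr w) hw).le
  rw [← ENNReal.ofReal_mul (by have := (H.vpos (pr (J l w))).le; positivity), ENNReal.ofReal_add
    (by positivity) (by unfold kt; positivity)]
  congr 2
  rw [H.prJ l hl w hw, mul_assoc, alg1 hx H.hN q5, kt, kelv]
  ring

lemma id2 (H : MS μ Q pr v N γ α c z₀ J) (l : ℝ) (hl : 0 < l) (z : Z) (hz : z ≠ z₀) :
    ENNReal.ofReal (c * kelv γ v z₀ l z) = ∫⁻ w in {w | ‖pr w - z₀‖ < l},
      ENNReal.ofReal (kt Q pr γ z₀ J l z w * v (pr w) ^ α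
        + Q z w ^ (-γ / 2) * kelv γ v z₀ l (pr w) ^ α) ∂μ := by
  have mpr := H.mpr
  have mQ := H.mQ z
  have hv := H.hv.measurable
  have mk := H.kt_meas l z
  have hz0 : 0 < ‖z - z₀‖ := norm_pos_iff.2 (sub_ne_zero.2 hz)
  have e1 : ENNReal.ofReal (c * kelv γ v z₀ l z)
      = ∫⁻ w, ENNReal.ofReal (kt Q pr γ z₀ J l z w * v (pr w) ^ α) ∂μ := by
    have : c * kelv γ v z₀ l z = (l / ‖z - z₀‖) ^ γ * (c * v (kinv z₀ l z)) := by
      rw [kelv]; ring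
    rw [this, ENNReal.ofReal_mul (by positivity), H.rep,
      ← lintegral_const_mul _ (by have := H.mQ (kinv z₀ l z); fun_prop)]
    refine lintegral_congr_ae ?_
    filter_upwards [H.sph 0] with w h0
    have hw : pr w ≠ z₀ := fun h => h0 (by simp [h])
    have h0' : 0 < ‖pr w - z₀‖ := lt_of_le_of_ne (norm_nonneg _) (Ne.symm h0)
    rw [← ENNReal.ofReal_mul (by positivity)]
    congr 1
    rw [← mul_assoc, kt]
    congr 1
    have h1 := H.h1 l hl z w hz hw
    have q1 := H.Q0 (kinv z₀ l z) w
    have q2 := H.Q0 z (J l w)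
    have h1' := congrArg (fun t : ℝ => t ^ (-γ / 2)) h1
    rw [Real.mul_rpow (by positivity) q1, Real.mul_rpow (by positivity) q2] at h1'
    have key : ∀ r : ℝ, 0 < r → (l / r) ^ γ = l ^ γ * (r ^ 2) ^ (-γ / 2) := by
      intro r hr
      rw [Real.div_rpow hl.le hr.le, ← Real.rpow_natCast r 2, ← Real.rpow_mul hr.le]
      have : ((2 : ℕ) : ℝ) * (-γ / 2) = -γ := by push_cast; ring
      rw [this, Real.rpow_neg hr.le]; rfl
    rw [key _ hz0, key _ h0', mul_assoc, mul_assoc, h1']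
  rw [e1, H.split l hl _ (by fun_prop)]
  refine lintegral_congr_ae (ae_restrict_of_ae ?_)
  filter_upwards [H.sph 0] with w h0
  have hw : pr w ≠ z₀ := fun h => h0 (by simp [h])
  have h0' : 0 < ‖pr w - z₀‖ := lt_of_le_of_ne (norm_nonneg _) (Ne.symm h0)
  have hx : 0 < l / ‖pr w - z₀‖ := by positivity
  have q1 := H.Q0 z w
  have q2 := H.Q0 z (J l w)
  have q3 := (H.vpos (pr w)).le
  have q5 := (H.vpos (kinv z₀ l (pr w))).le
  have q4 := (kelv_pos γ v H.vpos z₀ l hl (pr w) hw).le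
  have k1 : kt Q pr γ z₀ J l z (J l w) = (l / ‖pr w - z₀‖) ^ (-γ) * Q z w ^ (-γ / 2) := by
    rw [kt, H.JJ l hl w hw, H.prJ l hl w hw, kinv_sub_norm z₀ l hl _ hw]
    congr 1
    rw [Real.rpow_neg hx.le, ← Real.inv_rpow hx.le]
    congr 1; field_simp
  rw [k1, ← ENNReal.ofReal_mul (by have := (H.vpos (pr (J l w))).le; positivity),
    ENNReal.ofReal_add (by unfold kt; positivity) (by positivity)]
  congr 2
  rw [H.prJ l hl w hw, mul_assoc, alg1 hx H.hN q5, kelv, Real.rpow_neg hx.le]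
  have : (l / ‖pr w - z₀‖) ^ γ ≠ 0 := by positivity
  field_simp

/-- kernel comparison -/
lemma kt_le (H : MS μ Q pr v N γ α c z₀ J) (l : ℝ) (hl : 0 < l) (z : Z) (w : W)
    (hz : ‖z - z₀‖ < l) (hw : pr w ≠ z₀) (hw2 : ‖pr w - z₀‖ < l) (hQ : Q z w ≠ 0) :
    kt Q pr γ z₀ J l z w < Q z w ^ (-γ / 2) := by
  have h0' : 0 < ‖pr w - z₀‖ := norm_pos_iff.2 (sub_ne_zero.2 hw)
  have hq : 0 < Q z w := lt_of_le_of_ne (H.Q0 z w) (Ne.symm hQ)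
  have h2 := H.h2 l hl z w hw
  have hγ := H.hγ
  have h3 : 0 < (‖z - z₀‖ ^ 2 - l ^ 2) * (‖pr w - z₀‖ ^ 2 - l ^ 2) := by
    apply mul_pos_of_neg_of_neg <;> nlinarith [norm_nonneg (z - z₀), norm_nonneg (pr w - z₀)]
  have h4 : Q z w < (‖pr w - z₀‖ / l) ^ 2 * Q z (J l w) := by
    rw [div_pow, div_mul_eq_mul_div, lt_div_iff₀ (by positivity)]
    nlinarith
  have h5 := Real.rpow_lt_rpow_of_neg hq h4 (show -γ / 2 < 0 by linarith)
  rw [Real.mul_rpow (by positivity) (H.Q0 _ _)] at h5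
  refine lt_of_eq_of_lt ?_ h5
  rw [kt]; congr 1
  rw [← Real.rpow_natCast, ← Real.rpow_mul (by positivity)]
  have : ((2 : ℕ) : ℝ) * (-γ / 2) = -γ := by push_cast; ring
  rw [this, Real.rpow_neg (by positivity), ← Real.inv_rpow (by positivity), inv_div]

/-- Good radii. -/
def Good (v : Z → ℝ) (γ : ℝ) (z₀ : Z) (l : ℝ) : Prop :=
  ∀ z, z ≠ z₀ → ‖z - z₀‖ < l → v z ≤ kelv γ v z₀ l z

/-- The bad set. -/
def Sg (v : Z → ℝ) (pr : W → Z) (γ : ℝ) (z₀ : Z) (l : ℝ) : Set W :=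
  {w | ‖pr w - z₀‖ < l ∧ pr w ≠ z₀ ∧ kelv γ v z₀ l (pr w) < v (pr w)}

lemma Sg_meas (H : MS μ Q pr v N γ α c z₀ J) (l : ℝ) : MeasurableSet (Sg v pr γ z₀ l) := by
  have mpr := H.mpr
  have hv := H.hv.measurable
  have mk := H.kelv_meas l
  have mB : MeasurableSet {w | ‖pr w - z₀‖ < l} := measurableSet_lt (by fun_prop) (by fun_prop)
  refine mB.inter (MeasurableSet.inter ?_ (measurableSet_lt mk (hv.comp mpr)))
  exact (mpr (measurableSet_singleton z₀)).compl

lemma rpow_tangent {x y α : ℝ} (hx : 0 < x) (hy : 0 < y) (hα : 1 ≤ α) :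
    x ^ α - y ^ α ≤ α * x ^ (α - 1) * (x - y) := by
  have h := one_add_mul_self_le_rpow_one_add (s := y / x - 1) (by
    have : 0 < y / x := by positivity
    linarith) hα
  have e : (1 : ℝ) + (y / x - 1) = y / x := by ring
  rw [e, Real.div_rpow hy.le hx.le, le_div_iff₀ (by positivity)] at h
  have e2 : x ^ α = x ^ (α - 1) * x := by
    rw [← Real.rpow_add_one hx.ne']; congr 1; ring
  have e3 : (1 + α * (y / x - 1)) * x ^ α = x ^ α + α * x ^ (α - 1) * (y - x) := by
    rw [add_mul, one_mul]
    congr 1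
    rw [e2]; field_simp
  rw [e3] at h
  nlinarith

lemma bad (H : MS μ Q pr v N γ α c z₀ J) (l : ℝ) (hl : 0 < l) (m M : ℝ) (hm : 0 < m)
    (hmv : ∀ z, ‖z - z₀‖ < l → m ≤ v z) (hMv : ∀ z, ‖z - z₀‖ < l → v z ≤ M)
    (hb : ¬ Good v γ z₀ l) :
    ∃ z, ‖z - z₀‖ < l ∧ ENNReal.ofReal (c * m / (2 * α)) ≤
      ∫⁻ w in Sg v pr γ z₀ l, ENNReal.ofReal (Q z w ^ (-γ / 2) * v (pr w) ^ α) ∂μ := by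
  have mpr := H.mpr
  have hv := H.hv.measurable
  have hα := H.hα
  have hc := H.cpos
  have mB : MeasurableSet {w | ‖pr w - z₀‖ < l} := measurableSet_lt (by fun_prop) (by fun_prop)
  simp only [Good, not_forall, not_le] at hb
  obtain ⟨z₁, hz₁, hz₁l, hz₁v⟩ := hb
  set T : Set ℝ := (fun z => v z - kelv γ v z₀ l z) '' {z | z ≠ z₀ ∧ ‖z - z₀‖ < l} with hT
  have hTb : BddAbove T := by
    refine ⟨M, ?_⟩
    rintro _ ⟨z, ⟨hz, hzl⟩, rfl⟩
    have := kelv_pos γ v H.vpos z₀ l hl z hz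
    have := hMv z hzl
    simp only; linarith
  have hT1 : v z₁ - kelv γ v z₀ l z₁ ∈ T := ⟨z₁, ⟨hz₁, hz₁l⟩, rfl⟩
  have hS : 0 < sSup T := lt_of_lt_of_le (by linarith) (le_csSup hTb hT1)
  obtain ⟨_, ⟨z, ⟨hz, hzl⟩, rfl⟩, hzS⟩ := exists_lt_of_lt_csSup ⟨_, hT1⟩ (half_lt_self hS)
  simp only at hzS
  refine ⟨z, hzl, ?_⟩
  have mQ := H.mQ z
  have mk := H.kt_meas l z
  have mke := H.kelv_meas l
  have mS := H.Sg_meas l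
  set I := ∫⁻ w in Sg v pr γ z₀ l, ENNReal.ofReal (Q z w ^ (-γ / 2) * v (pr w) ^ α) ∂μ with hI
  set S := sSup T with hSdef
  have main : ENNReal.ofReal (c * v z) ≤ ENNReal.ofReal (c * kelv γ v z₀ l z)
      + ENNReal.ofReal (α * S / m) * I := by
    rw [H.id1 l hl z, H.id2 l hl z hz, hI, ← lintegral_const_mul _ (by fun_prop),
      ← lintegral_indicator mB, ← lintegral_indicator mB, ← lintegral_indicator mS,
      ← lintegral_add_left (Measurable.indicator (by fun_prop) mB)]
    refine lintegral_mono_ae ?_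
    filter_upwards [H.sph 0, H.Qnull z] with w h0 hQ
    have hw : pr w ≠ z₀ := fun h => h0 (by simp [h])
    by_cases hwl : ‖pr w - z₀‖ < l
    swap
    · rw [Set.indicator_of_notMem (by exact hwl)]; exact zero_le
    rw [Set.indicator_of_mem (by exact hwl), Set.indicator_of_mem (by exact hwl)]
    have hk := H.kt_le l hl z w hzl hw hwl hQ
    have q1 := H.Q0 z w
    have q2 := H.Q0 z (J l w)
    have q3 := H.vpos (pr w)
    have q4 := kelv_pos γ v H.vpos z₀ l hl (pr w) hw
    have hk0 : 0 ≤ kt Q pr γ z₀ J l z w := by unfold kt; positivity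
    by_cases hwS : kelv γ v z₀ l (pr w) < v (pr w)
    · have hmem : w ∈ Sg v pr γ z₀ l := ⟨hwl, hw, hwS⟩
      rw [Set.indicator_of_mem hmem, ← ENNReal.ofReal_mul (by positivity),
        ← ENNReal.ofReal_add (by positivity) (by positivity)]
      apply ENNReal.ofReal_le_ofReal
      have t1 := rpow_tangent q3 q4 hα.le
      have t2 : v (pr w) - kelv γ v z₀ l (pr w) ≤ S :=
        le_csSup hTb ⟨pr w, ⟨hw, hwl⟩, rfl⟩
      have t3 : v (pr w) ^ (α - 1) ≤ v (pr w) ^ α / m := by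
        rw [le_div_iff₀ hm]
        have e2 : v (pr w) ^ α = v (pr w) ^ (α - 1) * v (pr w) := by
          rw [← Real.rpow_add_one q3.ne']; congr 1; ring
        rw [e2]
        exact mul_le_mul_of_nonneg_left (hmv _ hwl) (by positivity)
      have t4 : v (pr w) ^ α - kelv γ v z₀ l (pr w) ^ α ≤ α * (v (pr w) ^ α / m) * S :=
        t1.trans (mul_le_mul (mul_le_mul_of_nonneg_left t3 (by linarith)) t2 (by linarith)
          (by positivity))
      have t5 : 0 ≤ v (pr w) ^ α - kelv γ v z₀ l (pr w) ^ α :=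
        sub_nonneg.2 (Real.rpow_le_rpow q4.le hwS.le (by linarith))
      have t6 : (Q z w ^ (-γ / 2) - kt Q pr γ z₀ J l z w)
          * (v (pr w) ^ α - kelv γ v z₀ l (pr w) ^ α)
          ≤ Q z w ^ (-γ / 2) * (α * (v (pr w) ^ α / m) * S) :=
        mul_le_mul (by linarith) t4 t5 (by positivity)
      have e : α * S / m * (Q z w ^ (-γ / 2) * v (pr w) ^ α)
        = Q z w ^ (-γ / 2) * (α * (v (pr w) ^ α / m) * S) := by ring
      rw [e]
      nlinarith
    · have hmem : w ∉ Sg v pr γ z₀ l := fun h => hwS h.2.2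
      rw [Set.indicator_of_notMem hmem, add_zero]
      apply ENNReal.ofReal_le_ofReal
      have t5 : v (pr w) ^ α ≤ kelv γ v z₀ l (pr w) ^ α :=
        (Real.rpow_le_rpow q3.le (not_lt.1 hwS) (by linarith))
      nlinarith
  have kp := kelv_pos γ v H.vpos z₀ l hl z hz
  by_cases hItop : I = ⊤
  · rw [hItop]; exact le_top
  · lift I to NNReal using hItop with i hi
    rw [← ENNReal.ofReal_coe_nnreal, ← ENNReal.ofReal_mul (by positivity),
      ← ENNReal.ofReal_add (by positivity) (by positivity), ENNReal.ofReal_le_ofReal_iff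
      (by positivity)] at main
    rw [← ENNReal.ofReal_coe_nnreal]
    apply ENNReal.ofReal_le_ofReal
    have g1 : c * (S / 2) ≤ α * S / m * i := by nlinarith
    have g2 : c * (S / 2) * m ≤ α * S * i := by
      have := mul_le_mul_of_nonneg_right g1 hm.le
      have e : α * S / m * i * m = α * S * i := by field_simp
      linarith
    rw [div_le_iff₀ (by positivity)]
    have : S * (c * m) ≤ S * (i * (2 * α)) := by nlinarith
    exact le_of_mul_le_mul_left this hS

/-- Fatou argument. -/
lemma fatou (H : MS μ Q pr v N γ α c z₀ J) (zs : ℕ → Z) (z : Z) (hz : Tendsto zs atTop (𝓝 z))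
    (E : ℕ → Set W) (hE : ∀ j, MeasurableSet (E j))
    (hev : ∀ᵐ w ∂μ, ∀ᶠ j in atTop, w ∉ E j) (ε : ℝ) (hε : 0 < ε)
    (hb : ∀ j, ENNReal.ofReal ε ≤
      ∫⁻ w in E j, ENNReal.ofReal (Q (zs j) w ^ (-γ / 2) * v (pr w) ^ α) ∂μ) : False := by
  have mpr := H.mpr
  have hv := H.hv.measurable
  have hc := H.cpos
  have mQ := H.mQ
  have hm : ∀ j, Measurable (fun w => ENNReal.ofReal (Q (zs j) w ^ (-γ / 2) * v (pr w) ^ α)) := by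
    intro j; have := mQ (zs j); fun_prop
  have h1 : ENNReal.ofReal (c * v z) ≤ ∫⁻ w, liminf (fun j => (E j)ᶜ.indicator
      (fun w => ENNReal.ofReal (Q (zs j) w ^ (-γ / 2) * v (pr w) ^ α)) w) atTop ∂μ := by
    rw [H.rep z]
    refine lintegral_mono_ae ?_
    filter_upwards [hev, H.Qnull z] with w hw hQ
    have hq : 0 < Q z w := lt_of_le_of_ne (H.Q0 z w) (Ne.symm hQ)
    have ht : Tendsto (fun j => ENNReal.ofReal (Q (zs j) w ^ (-γ / 2) * v (pr w) ^ α)) atTop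
        (𝓝 (ENNReal.ofReal (Q z w ^ (-γ / 2) * v (pr w) ^ α))) := by
      refine ENNReal.tendsto_ofReal (Tendsto.mul_const _ ?_)
      have : Tendsto (fun j => Q (zs j) w) atTop (𝓝 (Q z w)) := ((H.cQ w).tendsto z).comp hz
      exact this.rpow_const (Or.inl hq.ne')
    have ht2 : Tendsto (fun j => (E j)ᶜ.indicator
      (fun w => ENNReal.ofReal (Q (zs j) w ^ (-γ / 2) * v (pr w) ^ α)) w) atTop
        (𝓝 (ENNReal.ofReal (Q z w ^ (-γ / 2) * v (pr w) ^ α))) := by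
      refine ht.congr' ?_
      filter_upwards [hw] with j hj
      rw [Set.indicator_of_mem (by exact hj)]
    rw [ht2.liminf_eq]
  have h2 := h1.trans (lintegral_liminf_le (fun j => (hm j).indicator (hE j).compl))
  have h3 : ∀ j, ∫⁻ w, (E j)ᶜ.indicator
      (fun w => ENNReal.ofReal (Q (zs j) w ^ (-γ / 2) * v (pr w) ^ α)) w ∂μ
      ≤ ENNReal.ofReal (c * v (zs j) - ε) := by
    intro j
    rw [lintegral_indicator (hE j).compl, ENNReal.ofReal_sub _ hε.le, H.rep (zs j),
      ← lintegral_add_compl (μ := μ) _ (hE j)]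
    refine ENNReal.le_sub_of_add_le_left ENNReal.ofReal_ne_top ?_
    exact add_le_add (hb j) le_rfl
  have h4 : Tendsto (fun j => ENNReal.ofReal (c * v (zs j) - ε)) atTop
      (𝓝 (ENNReal.ofReal (c * v z - ε))) := by
    refine ENNReal.tendsto_ofReal (Tendsto.sub_const ?_ _)
    exact ((H.hv.tendsto z).comp hz).const_mul c
  have h5 := h2.trans ((liminf_le_liminf (Eventually.of_forall h3)).trans h4.liminf_eq.le)
  have h6 : 0 < c * v z := mul_pos hc (H.vpos z)
  have h7 := (ENNReal.ofReal_lt_ofReal_iff h6).2 (show c * v z - ε < c * v z by linarith)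
  exact absurd h5 (not_le.2 h7)

/-- No sequence of bad radii if the bad sets disappear in the limit. -/
lemma noseq (H : MS μ Q pr v N γ α c z₀ J) (l : ℕ → ℝ) (hl : ∀ j, 0 < l j) (L : ℝ)
    (hL : ∀ j, l j ≤ L) (hbad : ∀ j, ¬ Good v γ z₀ (l j))
    (hev : ∀ᵐ w ∂μ, ∀ᶠ j in atTop, w ∉ Sg v pr γ z₀ (l j)) : False := by
  have hcomp : IsCompact (closedBall z₀ L) := isCompact_closedBall z₀ L
  have hne : (closedBall z₀ L).Nonempty := ⟨z₀, by simp [((hl 0).le.trans (hL 0))]⟩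
  obtain ⟨zm, -, hzm⟩ := hcomp.exists_isMinOn hne H.hv.continuousOn
  obtain ⟨zM, -, hzM⟩ := hcomp.exists_isMaxOn hne H.hv.continuousOn
  have hmem : ∀ j z, ‖z - z₀‖ < l j → z ∈ closedBall z₀ L := by
    intro j z h
    rw [mem_closedBall, dist_eq_norm]; exact h.le.trans (hL j)
  have hb := fun j => H.bad (l j) (hl j) (v zm) (v zM) (H.vpos zm)
    (fun z h => hzm (hmem j z h)) (fun z h => hzM (hmem j z h)) (hbad j)
  choose zs hzs1 hzs2 using hb
  obtain ⟨z, -, φ, hφ, hlim⟩ := hcomp.tendsto_subseq (fun j => hmem j (zs j) (hzs1 j))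
  refine H.fatou (zs ∘ φ) z hlim (fun j => Sg v pr γ z₀ (l (φ j))) (fun j => H.Sg_meas _) ?_
    (c * v zm / (2 * α)) ?_ (fun j => hzs2 (φ j))
  · filter_upwards [hev] with w hw
    exact hφ.tendsto_atTop.eventually hw
  · have := H.cpos; have := H.vpos zm; have := H.hα
    positivity

lemma strict (H : MS μ Q pr v N γ α c z₀ J) (l : ℝ) (hl : 0 < l) (hg : Good v γ z₀ l)
    (hne : ∃ w, pr w ≠ z₀ ∧ v (pr w) ≠ kelv γ v z₀ l (pr w)) (z : Z) (hz : z ≠ z₀)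
    (hzl : ‖z - z₀‖ < l) : v z < kelv γ v z₀ l z := by
  have mpr := H.mpr
  have hv := H.hv.measurable
  have hα := H.hα
  have hc := H.cpos
  have mB : MeasurableSet {w | ‖pr w - z₀‖ < l} := measurableSet_lt (by fun_prop) (by fun_prop)
  have mQ := H.mQ z
  have mk := H.kt_meas l z
  have mke := H.kelv_meas l
  have hin : ∃ w, pr w ∈ {y : Z | y ≠ z₀ ∧ ‖y - z₀‖ < l ∧ v y < kelv γ v z₀ l y} := by
    obtain ⟨w, hw, hwv⟩ := hne
    have h0' : 0 < ‖pr w - z₀‖ := norm_pos_iff.2 (sub_ne_zero.2 hw)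
    rcases lt_trichotomy ‖pr w - z₀‖ l with h | h | h
    · exact ⟨w, hw, h, lt_of_le_of_ne (hg _ hw h) hwv⟩
    · exfalso; apply hwv
      have e : l / l = 1 := div_self hl.ne'
      rw [kelv, kinv, h, e]; simp
    · refine ⟨J l w, ?_⟩
      have hk := kinv_ne z₀ l hl _ hw
      have hn : ‖kinv z₀ l (pr w) - z₀‖ < l := by
        rw [kinv_sub_norm z₀ l hl _ hw, div_lt_iff₀ h0']; nlinarith
      rw [H.prJ l hl w hw]
      refine ⟨hk, hn, lt_of_le_of_ne (hg _ hk hn) ?_⟩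
      intro h'
      apply hwv
      rw [← kelv_kelv γ v z₀ l hl _ hw, ← h', kelv]
  have hO : IsOpen {y : Z | y ≠ z₀ ∧ ‖y - z₀‖ < l ∧ v y < kelv γ v z₀ l y} := by
    rw [isOpen_iff_mem_nhds]
    rintro y ⟨h1, h2, h3⟩
    have c1 : ContinuousAt (fun y => kelv γ v z₀ l y) y :=
      (kelv_cont γ v H.hv H.hγ z₀ l y h1).comp (f := fun y => (l, y)) (by fun_prop)
    filter_upwards [isOpen_ne.mem_nhds h1,
      (isOpen_lt (f := fun y : Z => ‖y - z₀‖) (g := fun _ => l) (by fun_prop)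
        (by fun_prop)).mem_nhds h2,
      H.hv.continuousAt.eventually_lt c1 h3] with x hx1 hx2 hx3
    exact ⟨hx1, hx2, hx3⟩
  have hpos := H.hopen _ hO hin
  refine lt_of_le_of_ne (hg z hz hzl) fun heq => ?_
  have h1 := H.id1 l hl z
  have h2 := H.id2 l hl z hz
  rw [← heq, h1] at h2
  have hae : ∀ᵐ w ∂(μ.restrict {w | ‖pr w - z₀‖ < l}),
      (Q z w ^ (-γ / 2) * v (pr w) ^ α
        + kt Q pr γ z₀ J l z w * kelv γ v z₀ l (pr w) ^ α) =
      (kt Q pr γ z₀ J l z w * v (pr w) ^ α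
        + Q z w ^ (-γ / 2) * kelv γ v z₀ l (pr w) ^ α) := by
    have hle : (fun w => ENNReal.ofReal (Q z w ^ (-γ / 2) * v (pr w) ^ α
        + kt Q pr γ z₀ J l z w * kelv γ v z₀ l (pr w) ^ α)) ≤ᵐ[μ.restrict {w | ‖pr w - z₀‖ < l}]
        (fun w => ENNReal.ofReal (kt Q pr γ z₀ J l z w * v (pr w) ^ α
        + Q z w ^ (-γ / 2) * kelv γ v z₀ l (pr w) ^ α)) := by
      filter_upwards [ae_restrict_of_ae (H.sph 0), ae_restrict_of_ae (H.Qnull z),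
        ae_restrict_mem mB] with w h0 hQ hwl
      have hw : pr w ≠ z₀ := fun h => h0 (by simp [h])
      have hk := H.kt_le l hl z w hzl hw hwl hQ
      apply ENNReal.ofReal_le_ofReal
      have t5 : v (pr w) ^ α ≤ kelv γ v z₀ l (pr w) ^ α :=
        (Real.rpow_le_rpow (H.vpos _).le (hg _ hw hwl) (by linarith))
      nlinarith
    have := ae_eq_of_ae_le_of_lintegral_le hle (by rw [← h1]; exact ENNReal.ofReal_ne_top)
      (by fun_prop) h2.symm.le
    filter_upwards [this, ae_restrict_of_ae (H.sph 0)] with w hw h0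
    have hw' : pr w ≠ z₀ := fun h => h0 (by simp [h])
    have q1 := H.Q0 z w
    have q2 := H.Q0 z (J l w)
    have q3 := H.vpos (pr w)
    have q4 := kelv_pos γ v H.vpos z₀ l hl (pr w) hw'
    have hk0 : 0 ≤ kt Q pr γ z₀ J l z w := by unfold kt; positivity
    rwa [ENNReal.ofReal_eq_ofReal_iff (by positivity) (by positivity)] at hw
  rw [ae_restrict_iff' mB] at hae
  apply hpos
  rw [← nonpos_iff_eq_zero]
  have hz' : ∀ᵐ w ∂μ, ¬ (w ∈ pr ⁻¹' {y : Z | y ≠ z₀ ∧ ‖y - z₀‖ < l ∧ v y < kelv γ v z₀ l y}) := by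
    filter_upwards [hae, H.Qnull z] with w hw hQ hmem
    obtain ⟨m1, m2, m3⟩ := hmem
    have e := hw m2
    have hk := H.kt_le l hl z w hzl m1 m2 hQ
    have t5 : v (pr w) ^ α < kelv γ v z₀ l (pr w) ^ α :=
      (Real.rpow_lt_rpow (H.vpos _).le m3 (by linarith))
    nlinarith
  simpa [ae_iff] using (hz')






/-- Conclusion of the moving spheres method. -/
theorem main (H : MS μ Q pr v N γ α c z₀ J) :
    (∃ l > 0, ∀ w, pr w ≠ z₀ → v (pr w) = kelv γ v z₀ l (pr w)) ∨
      ∀ l > 0, Good v γ z₀ l := by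
  by_contra hcon
  push Not at hcon
  obtain ⟨hne, l₁, hl₁, hbad₁⟩ := hcon
  set B : Set ℝ := {l | 0 < l ∧ ¬ Good v γ z₀ l} with hB
  have hBne : B.Nonempty := ⟨l₁, hl₁, hbad₁⟩
  have hBb : BddBelow B := ⟨0, fun l hl => hl.1.le⟩
  obtain ⟨l, -, hlim, hlB⟩ := exists_seq_tendsto_sInf hBne hBb
  set β := sInf B with hβ
  obtain ⟨L, hL⟩ := hlim.bddAbove_range
  have hL' : ∀ j, l j ≤ L := fun j => hL ⟨j, rfl⟩
  have hβ0 : 0 ≤ β := le_csInf hBne fun l hl => hl.1.le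
  rcases hβ0.eq_or_lt with h0 | hβpos
  · refine H.noseq l (fun j => (hlB j).1) L hL' (fun j => (hlB j).2) ?_
    refine Eventually.of_forall fun w => ?_
    by_cases hw : pr w = z₀
    · exact Eventually.of_forall fun j hj => hj.2.1 hw
    · have h0' : 0 < ‖pr w - z₀‖ := norm_pos_iff.2 (sub_ne_zero.2 hw)
      rw [← h0] at hlim
      filter_upwards [hlim.eventually_lt_const h0'] with j hj hj2
      exact absurd hj2.1 (not_lt.2 hj.le)
  · have hlow : ∀ l, 0 < l → l < β → Good v γ z₀ l := by
      intro l hl hlβ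
      by_contra h
      exact absurd (csInf_le hBb (show l ∈ B from ⟨hl, h⟩)) (not_le.2 hlβ)
    have hgβ : Good v γ z₀ β := by
      intro z hz hzl
      have c1 : ContinuousAt (fun l => kelv γ v z₀ l z) β :=
        (kelv_cont γ v H.hv H.hγ z₀ β z hz).comp (f := fun l => (l, z)) (by fun_prop)
      have c2 : Tendsto (fun l => kelv γ v z₀ l z) (𝓝[<] β) (𝓝 (kelv γ v z₀ β z)) :=
        c1.tendsto.mono_left nhdsWithin_le_nhds
      refine ge_of_tendsto c2 ?_
      have : Set.Ioo (‖z - z₀‖) β ∈ 𝓝[<] β := Ioo_mem_nhdsLT hzl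
      filter_upwards [this] with l hl
      exact hlow l (lt_of_le_of_lt (norm_nonneg _) hl.1) hl.2 z hz hl.1
    refine H.noseq l (fun j => (hlB j).1) L hL' (fun j => (hlB j).2) ?_
    filter_upwards [H.sph β] with w hwβ
    by_cases hw : pr w = z₀
    · exact Eventually.of_forall fun j hj => hj.2.1 hw
    rcases lt_or_gt_of_ne hwβ with h | h
    · have hst := H.strict β hβpos hgβ (hne β hβpos) (pr w) hw h
      have c1 : ContinuousAt (fun l => kelv γ v z₀ l (pr w)) β :=
        (kelv_cont γ v H.hv H.hγ z₀ β (pr w) hw).comp (f := fun l => (l, pr w)) (by fun_prop)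
      filter_upwards [(c1.tendsto.comp hlim).eventually_const_lt hst] with j hj hj2
      exact absurd hj2.2.2 (not_lt.2 hj.le)
    · filter_upwards [hlim.eventually_lt_const h] with j hj hj2
      exact absurd hj2.1 (not_lt.2 hj.le)

end MS

/-- The radial operator in the variable `q = |z|^2`. -/
noncomputable def Dop (N : ℝ) (h : ℝ → ℝ) (q : ℝ) : ℝ :=
  -(4 * q * deriv (deriv h) q + 2 * N * deriv h q)

/-- Smooth functions on the line. -/
abbrev Smo (h : ℝ → ℝ) : Prop := ContDiff ℝ ((⊤ : ℕ∞) : WithTop ℕ∞) h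

lemma Smo.deriv {h : ℝ → ℝ} (hh : Smo h) : Smo (deriv h) :=
  (contDiff_infty_iff_deriv.1 hh).2

lemma Smo.hasDeriv {h : ℝ → ℝ} (hh : Smo h) (q : ℝ) : HasDerivAt h (_root_.deriv h q) q :=
  ((contDiff_infty_iff_deriv.1 hh).1 q).hasDerivAt

lemma Smo.Dop {h : ℝ → ℝ} (hh : Smo h) (N : ℝ) : Smo (Dop N h) := by
  have h1 := hh.deriv
  have h2 := h1.deriv
  unfold _root_.Dop
  exact ((((contDiff_const.mul contDiff_id).mul h2).add (contDiff_const.mul h1))).neg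

lemma Smo.iter {h : ℝ → ℝ} (hh : Smo h) (N : ℝ) (p : ℕ) : Smo ((_root_.Dop N)^[p] h) := by
  induction p with
  | zero => exact hh
  | succ k ih => rw [iterate_succ_apply']; exact ih.Dop N

lemma Dop_eq_of_hasDeriv {N : ℝ} {h h' : ℝ → ℝ} {h'' q : ℝ} (h1 : ∀ᶠ x in 𝓝 q, HasDerivAt h (h' x) x)
    (h2 : HasDerivAt h' h'' q) : Dop N h q = -(4 * q * h'' + 2 * N * h' q) := by
  have e : deriv h =ᶠ[𝓝 q] h' := h1.mono fun x hx => hx.deriv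
  rw [Dop, e.deriv_eq, h2.deriv, e.eq_of_nhds]

lemma Dop_congr {N : ℝ} {h k : ℝ → ℝ} {q : ℝ} (e : h =ᶠ[𝓝 q] k) : Dop N h =ᶠ[𝓝 q] Dop N k := by
  filter_upwards [e.eventuallyEq_nhds] with x hx
  rw [Dop, Dop, hx.deriv.deriv_eq, hx.deriv_eq]

lemma iter_congr {N : ℝ} {h k : ℝ → ℝ} {q : ℝ} (p : ℕ) (e : h =ᶠ[𝓝 q] k) :
    (Dop N)^[p] h =ᶠ[𝓝 q] (Dop N)^[p] k := by
  induction p with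
  | zero => exact e
  | succ k ih => rw [iterate_succ_apply', iterate_succ_apply']; exact Dop_congr ih

lemma iter_zero (N : ℝ) (p : ℕ) : (Dop N)^[p] (fun _ => 0) = fun _ => 0 := by
  induction p with
  | zero => rfl
  | succ k ih => rw [iterate_succ_apply', ih]; funext q; simp [Dop]

lemma Dop_sub {N : ℝ} {h k : ℝ → ℝ} (hh : Smo h) (hk : Smo k) :
    Dop N (fun q => h q - k q) = fun q => Dop N h q - Dop N k q := by
  funext q
  rw [Dop_eq_of_hasDeriv (h := fun q => h q - k q) (h' := fun x => deriv h x - deriv k x)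
    (Eventually.of_forall fun x => (hh.hasDeriv x).sub (hk.hasDeriv x))
    ((hh.deriv.hasDeriv q).sub (hk.deriv.hasDeriv q)), Dop, Dop]
  ring

lemma iter_sub {N : ℝ} {h k : ℝ → ℝ} (hh : Smo h) (hk : Smo k) (p : ℕ) :
    (Dop N)^[p] (fun q => h q - k q) = fun q => (Dop N)^[p] h q - (Dop N)^[p] k q := by
  induction p with
  | zero => rfl
  | succ j ih =>
    rw [iterate_succ_apply', ih, Dop_sub (hh.iter N j) (hk.iter N j), iterate_succ_apply',
      iterate_succ_apply']

lemma Dop_scale {N c s : ℝ} {h : ℝ → ℝ} (hh : Smo h) :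
    Dop N (fun q => c * h (s * q)) = fun q => (c * s) * Dop N h (s * q) := by
  funext q
  have a1 : ∀ (k : ℝ → ℝ), Smo k → ∀ (c x : ℝ),
      HasDerivAt (fun q => c * k (s * q)) ((c * s) * deriv k (s * x)) x := by
    intro k hk c x
    have h1 : HasDerivAt (fun q => s * q) s x := by simpa using (hasDerivAt_id x).const_mul s
    have h2 := ((hk.hasDeriv (s * x)).comp x h1).const_mul c
    refine h2.congr_deriv ?_
    ring
  rw [Dop_eq_of_hasDeriv (Eventually.of_forall fun x => a1 h hh c x) (a1 _ hh.deriv _ q), Dop]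
  ring

lemma smo_scale {h : ℝ → ℝ} (hh : Smo h) (c s : ℝ) : Smo (fun q => c * h (s * q)) :=
  contDiff_const.mul (hh.comp (contDiff_const.mul contDiff_id))

lemma iter_scale {N c s : ℝ} {h : ℝ → ℝ} (hh : Smo h) (p : ℕ) :
    (Dop N)^[p] (fun q => c * h (s * q)) = fun q => (c * s ^ p) * (Dop N)^[p] h (s * q) := by
  induction p with
  | zero => simp
  | succ j ih =>
    rw [iterate_succ_apply', ih, Dop_scale (hh.iter N j), iterate_succ_apply']
    funext q; ring

lemma Dop_rpow {N C β q : ℝ} (hq : 0 < q) :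
    Dop N (fun x => C * x ^ β) q = C * (-2 * β * (2 * (β - 1) + N)) * q ^ (β - 1) := by
  have h1 : ∀ᶠ x in 𝓝 q, HasDerivAt (fun x : ℝ => C * x ^ β) (C * (β * x ^ (β - 1))) x := by
    filter_upwards [lt_mem_nhds hq] with x hx
    exact (Real.hasDerivAt_rpow_const (Or.inl hx.ne')).const_mul C
  have h2 : HasDerivAt (fun x : ℝ => C * (β * x ^ (β - 1)))
      (C * (β * ((β - 1) * q ^ (β - 1 - 1)))) q :=
    ((Real.hasDerivAt_rpow_const (Or.inl hq.ne')).const_mul β).const_mul C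
  rw [Dop_eq_of_hasDeriv h1 h2]
  have : q ^ (β - 1) = q ^ (β - 1 - 1) * q := by
    rw [← Real.rpow_add_one hq.ne']; congr 1; ring
  rw [this]; ring

/-- iterating on powers, the constant vanishing at the `p`-th step -/
lemma iter_rpow {N γ : ℝ} {p : ℕ} (hp : 1 ≤ p) (hN : γ = N - 2 * p) {q : ℝ} (hq : 0 < q) :
    (Dop N)^[p] (fun x => x ^ (-γ / 2)) q = 0 := by
  have key : ∀ j : ℕ, ∃ C : ℝ, (p ≤ j → C = 0) ∧ ∀ q > 0, (Dop N)^[j] (fun x => x ^ (-γ / 2)) q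
      = C * q ^ (-γ / 2 - j) := by
    intro j
    induction j with
    | zero => exact ⟨1, fun h => by omega, fun q _ => by simp⟩
    | succ j ih =>
      obtain ⟨C, hC, hq⟩ := ih
      refine ⟨C * (-2 * (-γ / 2 - j) * (2 * ((-γ / 2 - j) - 1) + N)), ?_, ?_⟩
      · intro h
        rcases Nat.lt_or_ge j p with h' | h'
        · have : p = j + 1 := by omega
          subst this
          have : 2 * ((-γ / 2 - j) - 1) + N = 0 := by rw [hN]; push_cast; ring
          rw [this]; ring
        · rw [hC h']; ring
      · intro q hq0
        rw [iterate_succ_apply']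
        have e : (Dop N)^[j] (fun x => x ^ (-γ / 2)) =ᶠ[𝓝 q] fun x => C * x ^ (-γ / 2 - j) := by
          filter_upwards [lt_mem_nhds hq0] with x hx using hq x hx
        rw [(Dop_congr e).eq_of_nhds, Dop_rpow hq0]
        push_cast
        congr 2; ring
  obtain ⟨C, hC, h⟩ := key p
  rw [h q hq, hC le_rfl, zero_mul]

/-- Regularised fundamental solution. -/
noncomputable def Hf (γ : ℝ) (q : ℝ) : ℝ := q ^ (-γ / 2) * Real.smoothTransition (q - 1)

lemma Hf_zero {γ q : ℝ} (hq : q ≤ 1) : Hf γ q = 0 := by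
  rw [Hf, Real.smoothTransition.zero_of_nonpos (by linarith), mul_zero]

lemma Hf_pow {γ q : ℝ} (hq : 2 ≤ q) : Hf γ q = q ^ (-γ / 2) := by
  rw [Hf, Real.smoothTransition.one_of_one_le (by linarith), mul_one]

lemma Hf_smo (γ : ℝ) : Smo (Hf γ) := by
  unfold Smo
  rw [contDiff_iff_contDiffAt]
  intro q
  rcases lt_or_ge q 1 with h | h
  · have : Hf γ =ᶠ[𝓝 q] fun _ => 0 := by
      filter_upwards [gt_mem_nhds h] with x hx using Hf_zero hx.le
    exact contDiffAt_const.congr_of_eventuallyEq this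
  · unfold Hf
    refine ContDiffAt.mul (Real.contDiffAt_rpow_const_of_ne (by linarith)) ?_
    exact (Real.smoothTransition.contDiff.comp (contDiff_id.sub contDiff_const)).contDiffAt

/-- `D^p` of the regularised fundamental solution. -/
noncomputable def gf (N γ : ℝ) (p : ℕ) : ℝ → ℝ := (Dop N)^[p] (Hf γ)

lemma gf_smo (N γ : ℝ) (p : ℕ) : Smo (gf N γ p) := (Hf_smo γ).iter N p

lemma gf_zero_left {N γ : ℝ} {p : ℕ} {q : ℝ} (hq : q < 1) : gf N γ p q = 0 := by
  have : Hf γ =ᶠ[𝓝 q] fun _ => 0 := by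
    filter_upwards [gt_mem_nhds hq] with x hx using Hf_zero hx.le
  have := (iter_congr (N := N) p this).eq_of_nhds
  rw [iter_zero] at this
  exact this

lemma gf_zero_right {N γ : ℝ} {p : ℕ} (hp : 1 ≤ p) (hN : γ = N - 2 * p) {q : ℝ} (hq : 2 < q) :
    gf N γ p q = 0 := by
  have : Hf γ =ᶠ[𝓝 q] fun x => x ^ (-γ / 2) := by
    filter_upwards [lt_mem_nhds hq] with x hx using Hf_pow hx.le
  have := (iter_congr (N := N) p this).eq_of_nhds
  rw [iter_rpow hp hN (by linarith)] at this
  exact this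

lemma gf_bdd {N γ : ℝ} {p : ℕ} : ∃ B : ℝ, 0 < B ∧ ∀ q ∈ Set.Icc (1:ℝ) 2, |gf N γ p q| ≤ B := by
  obtain ⟨C, hC⟩ := isCompact_Icc.exists_bound_of_continuousOn
    ((gf_smo N γ p).continuous.continuousOn (s := Set.Icc (1:ℝ) 2))
  exact ⟨max C 1, by positivity, fun q hq => (hC q hq).trans (le_max_left _ _)⟩

/-- Truncated fundamental solution. -/
noncomputable def Ff (γ s S : ℝ) (q : ℝ) : ℝ :=
  s ^ (-γ) * Hf γ ((s ^ 2)⁻¹ * q) - S ^ (-γ) * Hf γ ((S ^ 2)⁻¹ * q)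

lemma Ff_smo (γ s S : ℝ) : Smo (Ff γ s S) :=
  (smo_scale (Hf_smo γ) _ _).sub (smo_scale (Hf_smo γ) _ _)

lemma sHf {γ s q : ℝ} (hs : 0 < s) (hq : 0 ≤ q) : s ^ (-γ) * Hf γ ((s ^ 2)⁻¹ * q)
    = q ^ (-γ / 2) * Real.smoothTransition ((s ^ 2)⁻¹ * q - 1) := by
  rw [Hf, Real.mul_rpow (by positivity) hq, Real.inv_rpow (by positivity),
    ← Real.rpow_natCast s 2, ← Real.rpow_mul hs.le]
  have : ((2 : ℕ) : ℝ) * (-γ / 2) = -γ := by push_cast; ring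
  rw [this]
  have : s ^ (-γ) ≠ 0 := by positivity
  field_simp

lemma Ff_eq {γ s S q : ℝ} (hs : 0 < s) (hS : 0 < S) (hq : 0 ≤ q) : Ff γ s S q =
    q ^ (-γ / 2) * (Real.smoothTransition ((s ^ 2)⁻¹ * q - 1)
      - Real.smoothTransition ((S ^ 2)⁻¹ * q - 1)) := by
  rw [Ff, sHf hs hq, sHf hS hq]; ring

lemma Ff_supp {γ s S : ℝ} (hs : 0 < s) (hsS : s ≤ S) : HasCompactSupport (Ff γ s S) := by
  have hS : 0 < S := by linarith
  have hss : s ^ 2 ≤ S ^ 2 := by gcongr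
  refine HasCompactSupport.of_support_subset_isCompact (K := Set.Icc 0 (2 * S ^ 2)) isCompact_Icc ?_
  intro q hq
  by_contra h
  apply hq
  rw [Set.mem_Icc, not_and_or, not_le, not_le] at h
  rcases h with h | h
  · have a1 : (s ^ 2)⁻¹ * q ≤ 1 := by
      have : (s ^ 2)⁻¹ * q ≤ 0 := mul_nonpos_of_nonneg_of_nonpos (by positivity) h.le
      linarith
    have a2 : (S ^ 2)⁻¹ * q ≤ 1 := by
      have : (S ^ 2)⁻¹ * q ≤ 0 := mul_nonpos_of_nonneg_of_nonpos (by positivity) h.le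
      linarith
    rw [Ff, Hf_zero a1, Hf_zero a2]; simp
  · have hq0 : 0 ≤ q := by nlinarith [sq_nonneg S]
    have a1 : 2 ≤ (s ^ 2)⁻¹ * q := by
      rw [inv_mul_eq_div, le_div_iff₀ (by positivity)]; linarith
    have a2 : 2 ≤ (S ^ 2)⁻¹ * q := by
      rw [inv_mul_eq_div, le_div_iff₀ (by positivity)]; linarith
    rw [Ff_eq hs hS hq0, Real.smoothTransition.one_of_one_le (by linarith),
      Real.smoothTransition.one_of_one_le (by linarith)]
    ring

lemma Ff_iter {N γ s S : ℝ} {p : ℕ} (hN : γ = N - 2 * p) (hs : 0 < s) (hS : 0 < S) :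
    (Dop N)^[p] (Ff γ s S) = fun q => s ^ (-N) * gf N γ p ((s ^ 2)⁻¹ * q)
      - S ^ (-N) * gf N γ p ((S ^ 2)⁻¹ * q) := by
  have e : ∀ s : ℝ, 0 < s → s ^ (-γ) * ((s ^ 2)⁻¹) ^ p = s ^ (-N) := by
    intro s hs
    rw [← Real.rpow_natCast s 2, ← Real.rpow_neg hs.le, ← Real.rpow_natCast, ← Real.rpow_mul hs.le,
      ← Real.rpow_add hs, hN]
    congr 1; push_cast; ring
  have h := iter_sub (N := N) (smo_scale (Hf_smo γ) (s ^ (-γ)) (s ^ 2)⁻¹)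
    (smo_scale (Hf_smo γ) (S ^ (-γ)) (S ^ 2)⁻¹) p
  rw [iter_scale (Hf_smo γ), iter_scale (Hf_smo γ), e s hs, e S hS] at h
  exact h

lemma Ff_nonneg {γ s S q : ℝ} (hs : 0 < s) (hsS : s ≤ S) (hq : 0 ≤ q) : 0 ≤ Ff γ s S q := by
  have hS : 0 < S := by linarith
  rw [Ff_eq hs hS hq]
  refine mul_nonneg (by positivity) (sub_nonneg.2 (Real.smoothTransition.monotone ?_))
  have : (S ^ 2)⁻¹ ≤ (s ^ 2)⁻¹ := by gcongr
  nlinarith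

lemma Ff_mono {γ s S s' S' q : ℝ} (hs : 0 < s) (hS : 0 < S) (hs' : 0 < s') (h1 : s' ≤ s)
    (h2 : S ≤ S') (hq : 0 ≤ q) : Ff γ s S q ≤ Ff γ s' S' q := by
  rw [Ff_eq hs hS hq, Ff_eq hs' (by linarith) hq]
  refine mul_le_mul_of_nonneg_left ?_ (by positivity)
  have a1 : (s ^ 2)⁻¹ ≤ (s' ^ 2)⁻¹ := by gcongr
  have a2 : (S' ^ 2)⁻¹ ≤ (S ^ 2)⁻¹ := by gcongr
  have b1 := Real.smoothTransition.monotone (show (s ^ 2)⁻¹ * q - 1 ≤ (s' ^ 2)⁻¹ * q - 1 by nlinarith)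
  have b2 := Real.smoothTransition.monotone (show (S' ^ 2)⁻¹ * q - 1 ≤ (S ^ 2)⁻¹ * q - 1 by nlinarith)
  linarith

/-- Pointwise limit of the truncations. -/
lemma Ff_lim {γ q : ℝ} (hq : 0 < q) :
    Tendsto (fun j : ℕ => Ff γ ((j : ℝ) + 1)⁻¹ ((j : ℝ) + 1) q) atTop (𝓝 (q ^ (-γ / 2))) := by
  refine tendsto_const_nhds.congr' ?_
  have t1 : Tendsto (fun j : ℕ => ((j : ℝ) + 1)) atTop atTop :=
    tendsto_atTop_add_const_right _ _ tendsto_natCast_atTop_atTop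
  filter_upwards [t1.eventually_ge_atTop (2 / q), t1.eventually_ge_atTop q] with j h1 h2
  have hj : (1:ℝ) ≤ (j : ℝ) + 1 := by have : (0:ℝ) ≤ j := Nat.cast_nonneg j; linarith
  have hj2 : ((j:ℝ) + 1) ≤ ((j:ℝ) + 1) ^ 2 := by nlinarith
  rw [Ff_eq (by positivity) (by positivity) hq.le, Real.smoothTransition.one_of_one_le,
    Real.smoothTransition.zero_of_nonpos]
  · ring
  · rw [sub_nonpos, inv_mul_le_iff₀ (by positivity)]; linarith
  · rw [inv_pow, inv_inv]
    rw [div_le_iff₀ hq] at h1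
    nlinarith

lemma Dop_pow_mul {N : ℝ} {χ ψ : ℝ → ℝ} (hχ : Smo χ) (hψ : Smo ψ) (m : ℕ) :
    ∃ φ, Smo φ ∧ Dop N (fun q => χ q ^ (m + 2) * ψ q) = fun q => χ q ^ m * φ q := by
  refine ⟨fun q => -(4 * q * ((m + 2) * (m + 1) * deriv χ q ^ 2 * ψ q
    + (m + 2) * χ q * deriv (deriv χ) q * ψ q + 2 * (m + 2) * χ q * deriv χ q * deriv ψ q
    + χ q ^ 2 * deriv (deriv ψ) q) + 2 * N * ((m + 2) * χ q * deriv χ q * ψ q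
    + χ q ^ 2 * deriv ψ q)), ?_, ?_⟩
  · have h1 := hχ.deriv
    have h2 := hχ.deriv.deriv
    have h3 := hψ.deriv
    have h4 := hψ.deriv.deriv
    unfold Smo at *
    fun_prop
  · funext q
    have h1 : ∀ x, HasDerivAt (fun q => χ q ^ (m + 2) * ψ q)
        ((m + 2) * χ x ^ (m + 1) * deriv χ x * ψ x + χ x ^ (m + 2) * deriv ψ x) x := by
      intro x
      refine (((hχ.hasDeriv x).pow (m + 2)).mul (hψ.hasDeriv x)).congr_deriv ?_
      simp
    have h2 : HasDerivAt (fun x => (m + 2) * χ x ^ (m + 1) * deriv χ x * ψ x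
        + χ x ^ (m + 2) * deriv ψ x) (χ q ^ m * ((m + 2) * (m + 1) * deriv χ q ^ 2 * ψ q
    + (m + 2) * χ q * deriv (deriv χ) q * ψ q + 2 * (m + 2) * χ q * deriv χ q * deriv ψ q
    + χ q ^ 2 * deriv (deriv ψ) q)) q := by
      refine ((((((hχ.hasDeriv q).pow (m + 1)).const_mul ((m : ℝ) + 2)).mul
        (hχ.deriv.hasDeriv q)).mul (hψ.hasDeriv q)).add
        (((hχ.hasDeriv q).pow (m + 2)).mul (hψ.deriv.hasDeriv q))).congr_deriv ?_
      simp
      ring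
    rw [Dop_eq_of_hasDeriv (Eventually.of_forall h1) h2]
    ring

lemma iter_pow {N : ℝ} {χ : ℝ → ℝ} (hχ : Smo χ) (p m : ℕ) :
    ∃ φ, Smo φ ∧ (Dop N)^[p] (fun q => χ q ^ (m + 2 * p)) = fun q => χ q ^ m * φ q := by
  have key : ∀ j : ℕ, j ≤ p → ∃ φ, Smo φ ∧ (Dop N)^[j] (fun q => χ q ^ (m + 2 * p))
      = fun q => χ q ^ (m + 2 * (p - j)) * φ q := by
    intro j
    induction j with
    | zero => intro _; exact ⟨fun _ => 1, contDiff_const, by simp⟩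
    | succ j ih =>
      intro hj
      obtain ⟨φ, hφ, e⟩ := ih (by omega)
      obtain ⟨φ', hφ', e'⟩ := Dop_pow_mul (N := N) hχ hφ (m + 2 * (p - (j + 1)))
      refine ⟨φ', hφ', ?_⟩
      rw [iterate_succ_apply', e, ← e']
      congr 1
      funext q
      congr 2; omega
  simpa using key p le_rfl

/-- a cut-off -/
noncomputable def chi (q : ℝ) : ℝ := Real.smoothTransition (3 - q) * Real.smoothTransition (q + 2)

lemma chi_smo : Smo chi :=
  (Real.smoothTransition.contDiff.comp (contDiff_const.sub contDiff_id)).mul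
    (Real.smoothTransition.contDiff.comp (contDiff_id.add contDiff_const))

lemma chi_nonneg (q : ℝ) : 0 ≤ chi q :=
  mul_nonneg (Real.smoothTransition.nonneg _) (Real.smoothTransition.nonneg _)

lemma chi_le_one (q : ℝ) : chi q ≤ 1 :=
  mul_le_one₀ (Real.smoothTransition.le_one _) (Real.smoothTransition.nonneg _)
    (Real.smoothTransition.le_one _)

lemma chi_one {q : ℝ} (h0 : 0 ≤ q) (h2 : q ≤ 2) : chi q = 1 := by
  rw [chi, Real.smoothTransition.one_of_one_le (by linarith),
    Real.smoothTransition.one_of_one_le (by linarith), one_mul]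

lemma chi_zero {q : ℝ} (h : 3 ≤ q) : chi q = 0 := by
  rw [chi, Real.smoothTransition.zero_of_nonpos (by linarith), zero_mul]

lemma chi_zero' {q : ℝ} (h : q ≤ -2) : chi q = 0 := by
  rw [chi, Real.smoothTransition.zero_of_nonpos (x := q + 2) (by linarith), mul_zero]

lemma chi_supp : HasCompactSupport chi := by
  refine HasCompactSupport.of_support_subset_isCompact (K := Set.Icc (-2) 3) isCompact_Icc ?_
  intro q hq
  by_contra h
  apply hq
  rw [Set.mem_Icc, not_and_or, not_le, not_le] at h
  rcases h with h | h
  · exact chi_zero' h.le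
  · exact chi_zero h.le

/-- Data for the representation formula at a fixed point. -/
structure RP {W : Type*} [MeasurableSpace W] (μ : Measure W) (ν : Measure ℝ) (q h : W → ℝ)
    (N γ α : ℝ) (p : ℕ) (v₀ : ℝ) : Prop where
  hα : 1 < α
  hγ : 0 < γ
  hp : 1 ≤ p
  hN : γ = N - 2 * p
  mq : Measurable q
  q0 : ∀ w, 0 ≤ q w
  mh : Measurable h
  h0 : ∀ w, 0 ≤ h w
  hb : ∀ R : ℝ, ∃ M, ∀ w, q w ≤ R → h w ≤ M
  map : Measure.map q μ = ν
  fin : ∀ R : ℝ, ν (Set.Iic R) ≠ ⊤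
  scal : ∀ R : ℝ, 0 < R → Measure.map (fun x => (R ^ 2)⁻¹ * x) ν = ENNReal.ofReal (R ^ N) • ν
  star : ∀ F : ℝ → ℝ, Smo F → HasCompactSupport F →
    ∫ w, h w ^ α * F (q w) ∂μ = ∫ w, h w * (Dop N)^[p] F (q w) ∂μ
  cont : ∀ ε > 0, ∃ δ > 0, ∀ w, q w < δ → |h w - v₀| < ε

lemma young {α δ t : ℝ} (hα : 1 < α) (hδ : 0 < δ) (ht : 0 ≤ t) : t ≤ δ + δ ^ (1 - α) * t ^ α := by
  rcases le_or_gt t δ with h | h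
  · have : 0 ≤ δ ^ (1 - α) * t ^ α := by positivity
    linarith
  · have ht' : 0 < t := by linarith
    have h1 : t ^ (1 - α) ≤ δ ^ (1 - α) := Real.rpow_le_rpow_of_nonpos hδ h.le (by linarith)
    have h2 : t = t ^ (1 - α) * t ^ α := by
      rw [← Real.rpow_add ht']; simp
    have h3 : t ^ (1 - α) * t ^ α ≤ δ ^ (1 - α) * t ^ α := by gcongr
    linarith

namespace RP
variable {W : Type*} [MeasurableSpace W] {μ : Measure W} {ν : Measure ℝ} {q h : W → ℝ}
    {N γ α : ℝ} {p : ℕ} {v₀ : ℝ}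

lemma finq (H : RP μ ν q h N γ α p v₀) (R : ℝ) : μ {w | q w ≤ R} < ⊤ := by
  have := H.fin R
  rw [← H.map, Measure.map_apply H.mq measurableSet_Iic] at this
  exact lt_top_iff_ne_top.2 this

lemma int_of_bdd (H : RP μ ν q h N γ α p v₀) (f : W → ℝ) (mf : Measurable f) (R M : ℝ)
    (hM : ∀ w, q w ≤ R → |f w| ≤ M) (hz : ∀ w, R < q w → f w = 0) : Integrable f μ := by
  have h1 : IntegrableOn f {w | q w ≤ R} μ := by
    refine Measure.integrableOn_of_bounded (M := M) (H.finq R).ne mf.aestronglyMeasurable ?_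
    refine (ae_restrict_iff' (measurableSet_le H.mq measurable_const)).2 ?_
    exact Eventually.of_forall fun w hw => hM w hw
  rwa [integrableOn_iff_integrable_of_support_subset] at h1
  intro w hw
  by_contra h'
  exact hw (hz w (not_le.1 h'))

lemma intF (H : RP μ ν q h N γ α p v₀) (F : ℝ → ℝ) (hF : Continuous F) (R : ℝ)
    (hz : ∀ x, R < x → F x = 0) (β : ℝ) (hβ : 0 ≤ β) :
    Integrable (fun w => h w ^ β * F (q w)) μ := by
  obtain ⟨M, hM⟩ := H.hb R
  obtain ⟨C, hC⟩ := isCompact_Icc.exists_bound_of_continuousOn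
    (hF.continuousOn (s := Set.Icc (0:ℝ) R))
  have mh := H.mh
  have mq := H.mq
  have mF := hF.measurable
  refine H.int_of_bdd _ (by fun_prop) R (M ^ β * C) ?_ ?_
  · intro w hw
    rw [abs_mul, abs_of_nonneg (Real.rpow_nonneg (H.h0 w) _)]
    have : 0 ≤ M := (H.h0 w).trans (hM w hw)
    exact mul_le_mul (Real.rpow_le_rpow (H.h0 w) (hM w hw) hβ) (hC _ ⟨H.q0 w, hw⟩) (abs_nonneg _)
      (by positivity)
  · intro w hw
    rw [hz _ hw, mul_zero]

lemma int_map (H : RP μ ν q h N γ α p v₀) (F : ℝ → ℝ) (hF : Continuous F) :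
    ∫ w, F (q w) ∂μ = ∫ x, F x ∂ν := by
  rw [← H.map, integral_map H.mq.aemeasurable hF.aestronglyMeasurable]

lemma int_scal (H : RP μ ν q h N γ α p v₀) (F : ℝ → ℝ) (hF : Continuous F) (R : ℝ) (hR : 0 < R) :
    ∫ w, F ((R ^ 2)⁻¹ * q w) ∂μ = R ^ N * ∫ x, F x ∂ν := by
  rw [H.int_map (fun x => F ((R ^ 2)⁻¹ * x)) (by fun_prop),
    ← integral_map (φ := fun x => (R ^ 2)⁻¹ * x) (by fun_prop) hF.aestronglyMeasurable, H.scal R hR,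
    integral_smul_measure, ENNReal.toReal_ofReal (by positivity), smul_eq_mul]

lemma vol (H : RP μ ν q h N γ α p v₀) (R : ℝ) (hR : 0 < R) :
    μ.real {w | q w ≤ 3 * R ^ 2} = R ^ N * ν.real (Set.Iic 3) := by
  have h1 : {w | q w ≤ 3 * R ^ 2} = q ⁻¹' ((fun x => (R ^ 2)⁻¹ * x) ⁻¹' Set.Iic 3) := by
    ext w
    simp only [Set.mem_setOf_eq, Set.mem_preimage, Set.mem_Iic]
    rw [inv_mul_le_iff₀ (by positivity), mul_comm]
  have h2 : MeasurableSet ((fun x : ℝ => (R ^ 2)⁻¹ * x) ⁻¹' Set.Iic 3) :=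
    (measurable_const_mul _) measurableSet_Iic
  rw [h1, measureReal_def, ← Measure.map_apply H.mq h2, H.map,
    ← Measure.map_apply (measurable_const_mul _) measurableSet_Iic, H.scal R hR,
    Measure.smul_apply, smul_eq_mul, ENNReal.toReal_mul, ENNReal.toReal_ofReal (by positivity),
    measureReal_def]

lemma decay (H : RP μ ν q h N γ α p v₀) : ∃ C κ : ℝ, 0 < κ ∧ ∀ R : ℝ, 0 < R →
    |R ^ (-N) * ∫ w, h w * gf N γ p ((R ^ 2)⁻¹ * q w) ∂μ| ≤ C * R ^ (-κ) := by
  have hα := H.hα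
  have hp := H.hp
  obtain ⟨B', hB', hgB⟩ := gf_bdd (N := N) (γ := γ) (p := p)
  obtain ⟨m, hm⟩ := exists_nat_ge (2 * p / (α - 1))
  have hmk : ((m + 2 * p : ℕ) : ℝ) ≤ m * α := by
    rw [div_le_iff₀ (by linarith)] at hm
    push_cast; linarith
  obtain ⟨φ, hφ, hit⟩ := iter_pow (N := N) chi_smo p m
  set k := m + 2 * p with hk
  obtain ⟨B₀, hB₀⟩ := isCompact_Icc.exists_bound_of_continuousOn
    (hφ.continuous.continuousOn (s := Set.Icc (0:ℝ) 3))
  set B := max B₀ 1 with hBdef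
  have hB : 0 < B := by positivity
  have hφB : ∀ x ∈ Set.Icc (0:ℝ) 3, |φ x| ≤ B := fun x hx => (hB₀ x hx).trans (le_max_left _ _)
  refine ⟨B' * (2 * ν.real (Set.Iic 3)) * (2 * B) ^ (1 / (α - 1)), 2 * p / (α - 1), ?_, ?_⟩
  · have : (1:ℝ) ≤ p := by exact_mod_cast hp
    exact div_pos (by linarith) (by linarith)
  intro R hR
  set δ : ℝ := (2 * B * R ^ (-(2 * (p:ℝ)))) ^ (1 / (α - 1)) with hδdef
  have hδ : 0 < δ := by positivity
  have hδα : δ ^ (α - 1) = 2 * B * R ^ (-(2 * (p:ℝ))) := by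
    rw [hδdef, ← Real.rpow_mul (by positivity), one_div, inv_mul_cancel₀ (by linarith),
      Real.rpow_one]
  have hδ' : δ ^ (1 - α) * δ ^ (α - 1) = 1 := by
    rw [← Real.rpow_add hδ]; simp
  have hR2 : 0 < R ^ 2 := by positivity
  have mq := H.mq
  have mh := H.mh
  set r : W → ℝ := fun w => (R ^ 2)⁻¹ * q w with hr
  have hr0 : ∀ w, 0 ≤ r w := fun w => mul_nonneg (by positivity) (H.q0 w)
  have hr3 : ∀ w, r w ≤ 3 ↔ q w ≤ 3 * R ^ 2 := by
    intro w; rw [hr]; simp only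
    rw [inv_mul_le_iff₀ (by positivity), mul_comm]
  -- the test function
  have F1 : Smo (fun x => 1 * (fun y => chi y ^ k) ((R ^ 2)⁻¹ * x)) := smo_scale (chi_smo.pow k) _ _
  have F2 : HasCompactSupport (fun x => 1 * (fun y => chi y ^ k) ((R ^ 2)⁻¹ * x)) := by
    refine HasCompactSupport.of_support_subset_isCompact
      (K := Set.Icc (-2 * R ^ 2) (3 * R ^ 2)) isCompact_Icc ?_
    intro x hx
    have hk0 : k ≠ 0 := by omega
    have hc : chi ((R ^ 2)⁻¹ * x) ≠ 0 := by
      intro h'; apply hx; simp [h', hk0]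
    constructor
    · by_contra h'
      apply hc; apply chi_zero'
      rw [inv_mul_le_iff₀ hR2]; linarith
    · by_contra h'
      apply hc; apply chi_zero
      rw [le_inv_mul_iff₀ hR2]; linarith
  have hs := H.star _ F1 F2
  rw [iter_scale (chi_smo.pow k), hit] at hs
  simp only [one_mul] at hs
  set I₁ := ∫ w, h w ^ α * chi (r w) ^ k ∂μ with hI₁
  set A₀ := μ.real {w | q w ≤ 3 * R ^ 2} with hA₀
  have i1 : Integrable (fun w => h w ^ α * chi (r w) ^ k) μ := by
    refine H.intF (fun x => chi ((R ^ 2)⁻¹ * x) ^ k) ?_ (3 * R ^ 2) ?_ α (by linarith)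
    · exact (chi_smo.continuous.comp (by fun_prop)).pow k
    · intro x hx
      have : chi ((R ^ 2)⁻¹ * x) = 0 := by
        apply chi_zero; rw [le_inv_mul_iff₀ hR2]; linarith
      simp only [this]
      exact zero_pow (by omega)
  have mS : MeasurableSet {w | q w ≤ 3 * R ^ 2} := measurableSet_le mq measurable_const
  have i2 : Integrable ({w | q w ≤ 3 * R ^ 2}.indicator (fun _ => (1:ℝ))) μ :=
    (integrable_indicator_iff mS).2 (integrableOn_const (H.finq _).ne)
  have i2v : ∫ w, {w | q w ≤ 3 * R ^ 2}.indicator (fun _ => (1:ℝ)) w ∂μ = A₀ := by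
    rw [integral_indicator_const _ mS, smul_eq_mul, mul_one]
  have hI0 : 0 ≤ I₁ := integral_nonneg fun w =>
    mul_nonneg (Real.rpow_nonneg (H.h0 w) _) (pow_nonneg (chi_nonneg _) _)
  have hA00 : 0 ≤ A₀ := measureReal_nonneg
  set Y : W → ℝ := fun w => δ * {w | q w ≤ 3 * R ^ 2}.indicator (fun _ => (1:ℝ)) w
    + δ ^ (1 - α) * (h w ^ α * chi (r w) ^ k) with hY
  have iY : Integrable Y μ := (i2.const_mul δ).add (i1.const_mul _)
  have iYv : ∫ w, Y w ∂μ = δ * A₀ + δ ^ (1 - α) * I₁ := by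
    rw [hY, integral_add (i2.const_mul δ) (i1.const_mul _), integral_const_mul,
      integral_const_mul, i2v]
  have hY0 : ∀ w, 0 ≤ Y w := by
    intro w
    have a1 : 0 ≤ {w | q w ≤ 3 * R ^ 2}.indicator (fun _ => (1:ℝ)) w :=
      Set.indicator_nonneg (fun _ _ => zero_le_one) _
    have a2 := H.h0 w
    have a3 := chi_nonneg (r w)
    simp only [hY]; positivity
  have hYt : ∀ w, r w ≤ 3 → h w * chi (r w) ^ m ≤ Y w := by
    intro w hw
    have a2 := H.h0 w
    have a3 := chi_nonneg (r w)
    have a4 := chi_le_one (r w)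
    have y := young hα hδ (t := h w * chi (r w) ^ m) (by positivity)
    refine y.trans ?_
    simp only [hY]
    rw [Set.indicator_of_mem (show w ∈ {w | q w ≤ 3 * R ^ 2} from (hr3 w).1 hw), mul_one]
    rw [Real.mul_rpow a2 (by positivity), ← Real.rpow_natCast (chi (r w)) m, ← Real.rpow_mul a3]
    have : chi (r w) ^ ((m:ℝ) * α) ≤ chi (r w) ^ k := by
      rw [← Real.rpow_natCast _ k]
      exact Real.rpow_le_rpow_of_exponent_ge' a3 a4 (by positivity) hmk
    gcongr
  have hRp : ((R ^ 2)⁻¹) ^ p = R ^ (-(2 * (p:ℝ))) := by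
    rw [← Real.rpow_natCast R 2, ← Real.rpow_neg hR.le, ← Real.rpow_natCast, ← Real.rpow_mul hR.le]
    congr 1; push_cast; ring
  have e1 : I₁ ≤ R ^ (-(2 * (p:ℝ))) * B * (δ * A₀ + δ ^ (1 - α) * I₁) := by
    rw [← iYv, ← integral_const_mul, hs]
    refine (le_abs_self _).trans ?_
    rw [← Real.norm_eq_abs]
    refine norm_integral_le_of_norm_le (iY.const_mul _) (Eventually.of_forall fun w => ?_)
    have a2 := H.h0 w
    have a3 := chi_nonneg (r w)
    rw [hRp]
    have a5 : ‖h w * (R ^ (-(2 * (p:ℝ))) * (chi ((R ^ 2)⁻¹ * q w) ^ m * φ ((R ^ 2)⁻¹ * q w)))‖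
        = R ^ (-(2 * (p:ℝ))) * ((h w * chi (r w) ^ m) * |φ (r w)|) := by
      rw [Real.norm_eq_abs, abs_mul, abs_mul, abs_mul, abs_of_nonneg a2,
        abs_of_nonneg (by positivity : 0 ≤ R ^ (-(2 * (p:ℝ)))), abs_of_nonneg (pow_nonneg a3 m)]
      ring
    rw [a5, mul_assoc _ B (Y w)]
    refine mul_le_mul_of_nonneg_left ?_ (Real.rpow_nonneg hR.le _)
    rcases le_or_gt (r w) 3 with h' | h'
    · rw [mul_comm (h w * chi (r w) ^ m)]
      exact mul_le_mul (hφB (r w) ⟨hr0 w, h'⟩) (hYt w h') (mul_nonneg a2 (pow_nonneg a3 m)) hB.le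
    · rcases Nat.eq_zero_or_pos m with hm0 | hm0
      · exfalso
        subst hm0
        have : (1:ℝ) ≤ p := by exact_mod_cast hp
        rw [hk] at hmk
        push_cast at hmk
        linarith
      · rw [chi_zero h'.le, zero_pow (by omega), mul_zero, zero_mul]
        exact mul_nonneg hB.le (hY0 w)
  have e2 : δ ^ (1 - α) * I₁ ≤ δ * A₀ := by
    have f1 : R ^ (-(2 * (p:ℝ))) * B = δ ^ (α - 1) / 2 := by rw [hδα]; ring
    rw [f1] at e1
    have f2 : δ ^ (α - 1) / 2 * (δ * A₀ + δ ^ (1 - α) * I₁)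
        = δ ^ (α - 1) / 2 * (δ * A₀) + I₁ / 2 := by
      rw [mul_add]; congr 1
      calc _ = (δ ^ (1 - α) * δ ^ (α - 1)) * I₁ / 2 := by ring
        _ = _ := by rw [hδ', one_mul]
    rw [f2] at e1
    have f3 : I₁ ≤ δ ^ (α - 1) * (δ * A₀) := by linarith
    calc δ ^ (1 - α) * I₁ ≤ δ ^ (1 - α) * (δ ^ (α - 1) * (δ * A₀)) := by gcongr
      _ = _ := by rw [← mul_assoc, hδ', one_mul]
  have e3 : |∫ w, h w * gf N γ p ((R ^ 2)⁻¹ * q w) ∂μ| ≤ B' * (2 * (δ * A₀)) := by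
    have : |∫ w, h w * gf N γ p ((R ^ 2)⁻¹ * q w) ∂μ| ≤ ∫ w, B' * Y w ∂μ := by
      rw [← Real.norm_eq_abs]
      refine norm_integral_le_of_norm_le (iY.const_mul B') (Eventually.of_forall fun w => ?_)
      rw [Real.norm_eq_abs, abs_mul, abs_of_nonneg (H.h0 w)]
      by_cases hin : r w ∈ Set.Icc (1:ℝ) 2
      · have a1 := hYt w (by linarith [hin.2])
        rw [chi_one (by linarith [hin.1]) hin.2, one_pow, mul_one] at a1
        rw [mul_comm]
        exact mul_le_mul (hgB _ hin) a1 (H.h0 w) hB'.le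
      · have : gf N γ p ((R ^ 2)⁻¹ * q w) = 0 := by
          rw [Set.mem_Icc, not_and_or, not_le, not_le] at hin
          rcases hin with h' | h'
          · exact gf_zero_left h'
          · exact gf_zero_right hp H.hN h'
        rw [this, abs_zero, mul_zero]
        exact mul_nonneg hB'.le (hY0 w)
    rw [integral_const_mul, iYv] at this
    refine this.trans (mul_le_mul_of_nonneg_left (by linarith) hB'.le)
  rw [abs_mul, abs_of_nonneg (by positivity : 0 ≤ R ^ (-N))]
  have e4 : R ^ (-N) * A₀ = ν.real (Set.Iic 3) := by
    rw [hA₀, H.vol R hR, ← mul_assoc, ← Real.rpow_add hR]; simp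
  have e5 : δ = (2 * B) ^ (1 / (α - 1)) * R ^ (-(2 * p / (α - 1))) := by
    rw [hδdef, Real.mul_rpow (by positivity) (by positivity), ← Real.rpow_mul hR.le]
    congr 2; ring
  calc _ ≤ R ^ (-N) * (B' * (2 * (δ * A₀))) := by gcongr
    _ = B' * (2 * (R ^ (-N) * A₀)) * δ := by ring
    _ = _ := by rw [e4, e5]; ring

lemma conc (H : RP μ ν q h N γ α p v₀) :
    Tendsto (fun j : ℕ => (((j : ℝ) + 1)⁻¹) ^ (-N) *
      ∫ w, h w * gf N γ p (((((j : ℝ) + 1)⁻¹) ^ 2)⁻¹ * q w) ∂μ) atTop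
      (𝓝 ((∫ x, gf N γ p x ∂ν) * v₀)) := by
  have gc := (gf_smo N γ p).continuous
  set D := ∫ x, |gf N γ p x| ∂ν with hD
  have hD0 : 0 ≤ D := integral_nonneg fun x => abs_nonneg _
  rw [Metric.tendsto_atTop]
  intro ε hε
  obtain ⟨δ, hδ, hcont⟩ := H.cont (ε / (D + 1)) (by positivity)
  have t1 : Tendsto (fun j : ℕ => ((j : ℝ) + 1)) atTop atTop :=
    tendsto_atTop_add_const_right _ _ tendsto_natCast_atTop_atTop
  obtain ⟨J, hJ⟩ := eventually_atTop.1 (t1.eventually_gt_atTop (2 / δ))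
  refine ⟨J, fun j hj => ?_⟩
  have hj1 := hJ j hj
  set s : ℝ := ((j : ℝ) + 1)⁻¹ with hs
  have hs0 : 0 < s := by positivity
  have hs1 : 2 * s ^ 2 < δ := by
    have a1 : s ≤ 1 := inv_le_one_of_one_le₀ (by have : (0:ℝ) ≤ j := Nat.cast_nonneg j; linarith)
    have a2 : 2 * s < δ := by
      rw [div_lt_iff₀ hδ] at hj1
      rw [hs, ← div_eq_mul_inv, div_lt_iff₀ (by positivity)]; linarith
    nlinarith
  have hs2 : 0 < s ^ 2 := by positivity
  have supp : ∀ w, 2 * s ^ 2 < q w → gf N γ p ((s ^ 2)⁻¹ * q w) = 0 := by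
    intro w hw
    apply gf_zero_right H.hp H.hN
    rw [lt_inv_mul_iff₀ hs2]; linarith
  have supp' : ∀ x, 2 * s ^ 2 < x → gf N γ p ((s ^ 2)⁻¹ * x) = 0 := by
    intro w hw
    apply gf_zero_right H.hp H.hN
    rw [lt_inv_mul_iff₀ hs2]; linarith
  have i1 := H.intF (fun x => gf N γ p ((s ^ 2)⁻¹ * x)) (by fun_prop) (2 * s ^ 2) supp' 1
    zero_le_one
  have i0 := H.intF (fun x => gf N γ p ((s ^ 2)⁻¹ * x)) (by fun_prop) (2 * s ^ 2) supp' 0 le_rfl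
  simp only [Real.rpow_one, Real.rpow_zero, one_mul] at i1 i0
  have e1 : (∫ x, gf N γ p x ∂ν) = s ^ (-N) * ∫ w, gf N γ p ((s ^ 2)⁻¹ * q w) ∂μ := by
    rw [H.int_scal _ gc s hs0, ← mul_assoc, ← Real.rpow_add hs0]; simp
  have e2 : D = s ^ (-N) * ∫ w, |gf N γ p ((s ^ 2)⁻¹ * q w)| ∂μ := by
    rw [H.int_scal (fun x => |gf N γ p x|) gc.abs s hs0, ← mul_assoc, ← Real.rpow_add hs0]; simp [hD]
  rw [dist_eq_norm, e1, mul_assoc, ← mul_sub, ← integral_mul_const, ← integral_sub i1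
    (i0.mul_const v₀), norm_mul, Real.norm_of_nonneg (by positivity : 0 ≤ s ^ (-N))]
  have e3 : ‖∫ w, (h w * gf N γ p ((s ^ 2)⁻¹ * q w) - gf N γ p ((s ^ 2)⁻¹ * q w) * v₀) ∂μ‖
      ≤ ∫ w, (ε / (D + 1)) * |gf N γ p ((s ^ 2)⁻¹ * q w)| ∂μ := by
    refine norm_integral_le_of_norm_le (i0.abs.const_mul _) (Eventually.of_forall fun w => ?_)
    have : h w * gf N γ p ((s ^ 2)⁻¹ * q w) - gf N γ p ((s ^ 2)⁻¹ * q w) * v₀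
      = (h w - v₀) * gf N γ p ((s ^ 2)⁻¹ * q w) := by ring
    rw [this, norm_mul, Real.norm_eq_abs, Real.norm_eq_abs]
    rcases le_or_gt (q w) (2 * s ^ 2) with h' | h'
    · gcongr
      exact (hcont w (by linarith)).le
    · rw [supp w h']; simp
  rw [integral_const_mul] at e3
  calc _ ≤ s ^ (-N) * (ε / (D + 1) * ∫ w, |gf N γ p ((s ^ 2)⁻¹ * q w)| ∂μ) := by gcongr
    _ = ε / (D + 1) * (s ^ (-N) * ∫ w, |gf N γ p ((s ^ 2)⁻¹ * q w)| ∂μ) := by ring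
    _ = ε * (D / (D + 1)) := by rw [← e2]; ring
    _ < ε * 1 := by
        gcongr
        rw [div_lt_one (by linarith)]; linarith
    _ = ε := mul_one ε

/-- The representation formula. -/
theorem repr (H : RP μ ν q h N γ α p v₀) :
    ∫⁻ w, ENNReal.ofReal (q w ^ (-γ / 2) * h w ^ α) ∂μ
      = ENNReal.ofReal ((∫ x, gf N γ p x ∂ν) * v₀) := by
  have hα := H.hα
  have mq := H.mq
  have mh := H.mh
  obtain ⟨C, κ, hκ, hdec⟩ := H.decay
  have t1 : Tendsto (fun j : ℕ => ((j : ℝ) + 1)) atTop atTop :=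
    tendsto_atTop_add_const_right _ _ tendsto_natCast_atTop_atTop
  have t2 : Tendsto (fun j : ℕ => ((j : ℝ) + 1) ^ (-N) *
      ∫ w, h w * gf N γ p ((((j : ℝ) + 1) ^ 2)⁻¹ * q w) ∂μ) atTop (𝓝 0) := by
    refine squeeze_zero_norm (fun j => hdec ((j:ℝ) + 1) (by positivity)) ?_
    have := ((tendsto_rpow_neg_atTop hκ).comp t1).const_mul C
    simpa using this
  have t3 := H.conc.sub t2
  rw [sub_zero] at t3
  have FS : ∀ j : ℕ, ((j:ℝ) + 1)⁻¹ ≤ (j:ℝ) + 1 := fun j => by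
    have h1 : (1:ℝ) ≤ (j:ℝ) + 1 := by have : (0:ℝ) ≤ j := Nat.cast_nonneg j; linarith
    exact (inv_le_one_of_one_le₀ h1).trans h1
  have star : ∀ j : ℕ, ∫⁻ w, ENNReal.ofReal (h w ^ α * Ff γ ((j:ℝ) + 1)⁻¹ ((j:ℝ) + 1) (q w)) ∂μ
      = ENNReal.ofReal ((((j : ℝ) + 1)⁻¹) ^ (-N) *
      ∫ w, h w * gf N γ p (((((j : ℝ) + 1)⁻¹) ^ 2)⁻¹ * q w) ∂μ - ((j : ℝ) + 1) ^ (-N) *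
      ∫ w, h w * gf N γ p ((((j : ℝ) + 1) ^ 2)⁻¹ * q w) ∂μ) := by
    intro j
    have hj : (0:ℝ) < (j:ℝ) + 1 := by positivity
    have hji : (0:ℝ) < ((j:ℝ) + 1)⁻¹ := by positivity
    have sm := Ff_smo γ ((j:ℝ) + 1)⁻¹ ((j:ℝ) + 1)
    have cs : HasCompactSupport (Ff γ ((j:ℝ) + 1)⁻¹ ((j:ℝ) + 1)) := Ff_supp hji (FS j)
    obtain ⟨R, hR⟩ := cs.isCompact.isBounded.bddAbove
    have hz : ∀ x, R < x → Ff γ ((j:ℝ) + 1)⁻¹ ((j:ℝ) + 1) x = 0 := fun x hx =>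
      image_eq_zero_of_notMem_tsupport fun h' => absurd (hR h') (not_le.2 hx)
    have i1 := H.intF _ sm.continuous R hz α (by linarith)
    rw [← ofReal_integral_eq_lintegral_ofReal i1 (Eventually.of_forall fun w =>
      mul_nonneg (Real.rpow_nonneg (H.h0 w) _) (Ff_nonneg hji (FS j) (H.q0 w))),
      H.star _ sm cs, Ff_iter H.hN hji hj]
    congr 1
    have gi : ∀ s : ℝ, 0 < s → Integrable (fun w => h w * gf N γ p ((s ^ 2)⁻¹ * q w)) μ := by
      intro s hs
      have hs2 : 0 < s ^ 2 := by positivity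
      have gc := (gf_smo N γ p).continuous
      have := H.intF (fun x => gf N γ p ((s ^ 2)⁻¹ * x)) (by fun_prop) (2 * s ^ 2) (by
        intro w hw
        apply gf_zero_right H.hp H.hN
        rw [lt_inv_mul_iff₀ hs2]; linarith) 1 zero_le_one
      simpa using this
    rw [← integral_const_mul, ← integral_const_mul, ← integral_sub ((gi _ hji).const_mul _)
      ((gi _ hj).const_mul _)]
    refine integral_congr_ae (Eventually.of_forall fun w => ?_)
    simp only; ring
  have t4 := ENNReal.tendsto_ofReal t3
  refine tendsto_nhds_unique ?_ (t4.congr fun j => (star j).symm)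
  refine lintegral_tendsto_of_tendsto_of_monotone ?_ ?_ ?_
  · intro j
    have := (Ff_smo γ ((j:ℝ) + 1)⁻¹ ((j:ℝ) + 1)).continuous.measurable
    exact Measurable.aemeasurable (by fun_prop)
  · refine Eventually.of_forall fun w i j hij => ?_
    apply ENNReal.ofReal_le_ofReal
    refine mul_le_mul_of_nonneg_left ?_ (Real.rpow_nonneg (H.h0 w) _)
    have : (i:ℝ) ≤ j := by exact_mod_cast hij
    exact Ff_mono (by positivity) (by positivity) (by positivity) (by gcongr) (by gcongr) (H.q0 w)
  · refine Eventually.of_forall fun w => ?_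
    refine ENNReal.tendsto_ofReal ?_
    rw [mul_comm]
    refine Tendsto.const_mul _ ?_
    rcases (H.q0 w).eq_or_lt with h' | h'
    · rw [← h', Real.zero_rpow (by have := H.hγ; linarith)]
      refine tendsto_const_nhds.congr fun j => ?_
      rw [Ff_eq (by positivity) (by positivity) le_rfl, Real.zero_rpow
        (by have := H.hγ; linarith), zero_mul]
    · exact Ff_lim h'

end RP

/-- Integration by parts in the additional radial variable. -/
def KIBP (κ : Measure ℝ) (b : ℝ) : Prop :=
  ∀ A A1 A2 B B1 B2 : ℝ → ℝ, Continuous A → Continuous A1 → Continuous A2 →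
    Continuous B → Continuous B1 → Continuous B2 →
    (∀ x, HasDerivAt A (x / 2 * A1 x) x) → (∀ x, HasDerivAt A1 (x / 2 * A2 x) x) →
    (∀ x, HasDerivAt B (2 * x * B1 x) x) → (∀ x, HasDerivAt B1 (2 * x * B2 x) x) →
    (∀ x, A |x| = A x) → (∀ x, A1 |x| = A1 x) → (∀ x, A2 |x| = A2 x) →
    (∀ x, B |x| = B x) → (∀ x, B1 |x| = B1 x) → (∀ x, B2 |x| = B2 x) →
    HasCompactSupport B → HasCompactSupport B1 → HasCompactSupport B2 →
    ∫ x, (b / 2 * A1 x + x ^ 2 / 4 * A2 x) * B x ∂κ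
      = ∫ x, A x * (2 * b * B1 x + 4 * x ^ 2 * B2 x) ∂κ

lemma KIBP_dirac : KIBP (Measure.dirac 0) 0 := by
  intro A A1 A2 B B1 B2
  intros
  rw [integral_dirac, integral_dirac]
  simp

/-- The weight measure. -/
noncomputable def kap (b : ℝ) : Measure ℝ :=
  if b = 0 then Measure.dirac 0 else volume.withDensity (fun x => ENNReal.ofReal (|x| ^ (b - 1)))

lemma kap_zero : kap 0 = Measure.dirac 0 := by simp [kap]
lemma kap_pos {b : ℝ} (hb : 0 < b) :
    kap b = volume.withDensity (fun x => ENNReal.ofReal (|x| ^ (b - 1))) := by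
  simp [kap, hb.ne']

lemma locInt {b : ℝ} (hb : 0 < b) : LocallyIntegrable (fun x : ℝ => |x| ^ (b - 1)) := by
  have h1 : ∀ R : ℝ, 0 < R → IntegrableOn (fun x : ℝ => |x| ^ (b - 1)) (Set.Icc (-R) R) := by
    intro R hR
    have h2 : IntegrableOn (fun x : ℝ => |x| ^ (b - 1)) (Set.Ioc 0 R) := by
      have := (intervalIntegral.intervalIntegrable_rpow' (a := 0) (b := R)
        (show -1 < b - 1 by linarith))
      rw [intervalIntegrable_iff_integrableOn_Ioc_of_le hR.le] at this
      refine this.congr_fun ?_ measurableSet_Ioc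
      intro x hx
      simp only [abs_of_pos hx.1]
    have h3 : IntegrableOn (fun x : ℝ => |x| ^ (b - 1)) (Set.Ico (-R) 0) := by
      have h4 := (Measure.measurePreserving_neg (volume : Measure ℝ)).integrableOn_comp_preimage
        (MeasurableEquiv.neg ℝ).measurableEmbedding (s := Set.Ioc 0 R)
        (f := fun x : ℝ => |x| ^ (b - 1))
      have h5 := h4.2 h2
      have h6 : (Neg.neg ⁻¹' Set.Ioc 0 R : Set ℝ) = Set.Ico (-R) 0 := by
        ext x; simp only [Set.mem_preimage, Set.mem_Ioc, Set.mem_Ico]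
        constructor <;> rintro ⟨h, h'⟩ <;> constructor <;> linarith
      rw [h6] at h5
      refine h5.congr_fun ?_ measurableSet_Ico
      intro x hx
      simp
    have h7 : IntegrableOn (fun x : ℝ => |x| ^ (b - 1)) {0} := by
      rw [integrableOn_singleton_iff]
      right; simp
    refine ((h2.union h3).union h7).mono_set ?_
    intro x hx
    rcases lt_trichotomy x 0 with h | h | h
    · left; right; exact ⟨hx.1, h⟩
    · right; exact h
    · left; left; exact ⟨h, hx.2⟩
  rw [locallyIntegrable_iff]
  intro k hk
  obtain ⟨R, hR⟩ := hk.isBounded.subset_closedBall 0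
  rw [Real.closedBall_eq_Icc] at hR
  refine (h1 (max R 1) (by positivity)).mono_set (hR.trans (Set.Icc_subset_Icc ?_ ?_))
  · have := le_max_left R 1; linarith
  · have := le_max_left R 1; linarith

lemma mdens (b : ℝ) : Measurable (fun x : ℝ => ENNReal.ofReal (|x| ^ (b - 1))) := by fun_prop

lemma kap_finK {b : ℝ} (hb : 0 ≤ b) : IsFiniteMeasureOnCompacts (kap b) := by
  rcases hb.eq_or_lt with rfl | hb
  · rw [kap_zero]; infer_instance
  · rw [kap_pos hb]
    refine ⟨fun K hK => ?_⟩
    rw [withDensity_apply _ hK.measurableSet]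
    have := ((locallyIntegrable_iff.1 (locInt hb)) K hK).2
    rw [hasFiniteIntegral_iff_ofReal] at this
    · exact this
    · exact Eventually.of_forall fun x => by positivity

lemma kap_sfin (b : ℝ) : SFinite (kap b) := by
  unfold kap; split_ifs <;> infer_instance

lemma kap_integral {b : ℝ} (hb : 0 < b) (G : ℝ → ℝ) :
    ∫ x, G x ∂(kap b) = ∫ x : ℝ, |x| ^ (b - 1) * G x := by
  rw [kap_pos hb, integral_withDensity_eq_integral_toReal_smul (mdens b)
    (Eventually.of_forall fun x => by simp)]
  refine integral_congr_ae (Eventually.of_forall fun x => ?_)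
  simp only [smul_eq_mul]
  rw [ENNReal.toReal_ofReal (by positivity)]

lemma kap_integrable {b : ℝ} (hb : 0 < b) (G : ℝ → ℝ) (hG : Continuous G)
    (hc : HasCompactSupport G) : Integrable (fun x : ℝ => |x| ^ (b - 1) * G x) := by
  have := kap_finK hb.le
  have h := hG.integrable_of_hasCompactSupport (μ := kap b) hc
  rw [kap_pos hb, integrable_withDensity_iff_integrable_smul' (mdens b)
    (Eventually.of_forall fun x => by simp)] at h
  refine h.congr (Eventually.of_forall fun x => ?_)
  simp only [smul_eq_mul]
  rw [ENNReal.toReal_ofReal (by positivity)]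

lemma KIBP_kap {b : ℝ} (hb : 0 ≤ b) : KIBP (kap b) b := by
  rcases hb.eq_or_lt with rfl | hb
  · rw [kap_zero]; exact KIBP_dirac
  intro A A1 A2 B B1 B2 cA cA1 cA2 cB cB1 cB2 dA dA1 dB dB1 eA eA1 eA2 eB eB1 eB2 sB sB1 sB2
  rw [kap_integral hb, kap_integral hb]
  have s1 : HasCompactSupport (fun x => (b / 2 * A1 x + x ^ 2 / 4 * A2 x) * B x) := sB.mul_left
  have s2 : HasCompactSupport (fun x => A x * (2 * b * B1 x + 4 * x ^ 2 * B2 x)) := by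
    refine HasCompactSupport.mul_left ?_
    exact HasCompactSupport.add (sB1.mul_left) (sB2.mul_left)
  have i1 := kap_integrable hb _ (by fun_prop) s1
  have i2 := kap_integrable hb _ (by fun_prop) s2
  rw [← sub_eq_zero, ← integral_sub i1 i2]
  set G : ℝ → ℝ := fun x => |x| ^ (b - 1) * ((b / 2 * A1 x + x ^ 2 / 4 * A2 x) * B x) -
    |x| ^ (b - 1) * (A x * (2 * b * B1 x + 4 * x ^ 2 * B2 x)) with hG
  have hGe : ∀ x, G |x| = G x := by
    intro x
    simp only [hG, eA, eA1, eA2, eB, eB1, eB2, abs_abs, sq_abs]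
  have hiG : Integrable G := i1.sub i2
  have h1 : ∫ x, G x = 2 * ∫ x in Set.Ioi 0, G x := by
    rw [← integral_comp_abs]
    simp only [hGe]
  rw [h1]
  have h2 : ∫ x in Set.Ioi 0, G x = 0 - 0 := by
    have sP : HasCompactSupport (fun x => 1 / 2 * A1 x * B x - 2 * A x * B1 x) :=
      HasCompactSupport.sub (sB.mul_left) (sB1.mul_left)
    have hz : (fun x => x ^ b * (1 / 2 * A1 x * B x - 2 * A x * B1 x)) 0 = 0 := by
      simp [Real.zero_rpow hb.ne']
    refine Eq.trans (b := 0 - (fun x => x ^ b * (1 / 2 * A1 x * B x - 2 * A x * B1 x)) 0) ?_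
      (by rw [hz])
    refine integral_Ioi_of_hasDerivAt_of_tendsto
      (f := fun x => x ^ b * (1 / 2 * A1 x * B x - 2 * A x * B1 x)) ?_ ?_ hiG.integrableOn ?_
    · apply Continuous.continuousWithinAt
      have : Continuous fun x : ℝ => x ^ b := Real.continuous_rpow_const hb.le
      fun_prop
    · intro x hx
      have hx : 0 < x := hx
      have e1 := Real.hasDerivAt_rpow_const (x := x) (p := b) (Or.inl hx.ne')
      have e2 := (((dA1 x).const_mul (1 / 2)).mul (dB x)).sub (((dA x).const_mul 2).mul (dB1 x))
      refine (e1.mul e2).congr_deriv ?_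
      simp only [hG, abs_of_pos hx, Pi.sub_apply, Pi.mul_apply]
      have : x ^ b = x ^ (b - 1) * x := by
        rw [← Real.rpow_add_one hx.ne']; simp
      rw [this]; ring
    · have sQ : HasCompactSupport (fun x => x ^ b * (1 / 2 * A1 x * B x - 2 * A x * B1 x)) :=
        sP.mul_left
      have := sQ.is_zero_at_infty
      rw [cocompact_eq_atBot_atTop] at this
      exact this.mono_left le_sup_right
  rw [h2]; ring

/-- The closed half space. -/
def SS (n : ℕ) : Set (EuclideanSpace ℝ (Fin n) × ℝ) := {z | 0 ≤ z.2}

lemma SS_uniq (n : ℕ) : UniqueDiffOn ℝ (SS n) := by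
  apply uniqueDiffOn_convex
  · intro x hx y hy s t hs ht _
    simp only [SS, Set.mem_setOf_eq] at *
    simp only [Prod.snd_add, Prod.smul_snd, smul_eq_mul]
    positivity
  · refine ⟨(0, 1), ?_⟩
    rw [mem_interior]
    refine ⟨{z | 0 < z.2}, fun z (hz : 0 < z.2) => le_of_lt hz, ?_, by simp⟩
    exact isOpen_lt continuous_const continuous_snd

/-- Directional derivative within the closed half space. -/
noncomputable def DW {n : ℕ} (v : EuclideanSpace ℝ (Fin n) × ℝ)
    (f : EuclideanSpace ℝ (Fin n) × ℝ → ℝ) (z : EuclideanSpace ℝ (Fin n) × ℝ) : ℝ :=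
  fderivWithin ℝ f (SS n) z v

lemma DW_cd {n : ℕ} (v : EuclideanSpace ℝ (Fin n) × ℝ)
    {f : EuclideanSpace ℝ (Fin n) × ℝ → ℝ} {k m : WithTop ℕ∞} (hf : ContDiffOn ℝ m f (SS n))
    (hk : k + 1 ≤ m) : ContDiffOn ℝ k (DW v f) (SS n) :=
  (hf.fderivWithin (SS_uniq n) hk).clm_apply contDiffOn_const

/-- The closed extension of `-A`. -/
noncomputable def nAt (n : ℕ) (a : ℝ) (f : EuclideanSpace ℝ (Fin n) × ℝ → ℝ)
    (z : EuclideanSpace ℝ (Fin n) × ℝ) : ℝ :=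
  -(z.2 * DW (0, 1) (DW (0, 1) f) z +
    (∑ i : Fin n, DW (EuclideanSpace.single i 1, 0) (DW (EuclideanSpace.single i 1, 0) f) z) +
    a * DW (0, 1) f z)

lemma nAt_cd {n : ℕ} (a : ℝ) {f : EuclideanSpace ℝ (Fin n) × ℝ → ℝ} {k : ℕ}
    (hf : ContDiffOn ℝ (k + 2 : ℕ) f (SS n)) : ContDiffOn ℝ k (nAt n a f) (SS n) := by
  have h1 : ∀ v, ContDiffOn ℝ (k + 1 : ℕ) (DW v f) (SS n) := fun v =>
    DW_cd v hf (by norm_cast)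
  have h2 : ∀ v, ContDiffOn ℝ k (DW v (DW v f)) (SS n) := fun v =>
    DW_cd v (h1 v) (by norm_cast)
  have h3 : ∀ v, ContDiffOn ℝ k (DW v f) (SS n) := fun v => (h1 v).of_le (by norm_cast; omega)
  refine ContDiffOn.neg ?_
  refine ContDiffOn.add (ContDiffOn.add ?_ ?_) ?_
  · exact contDiff_snd.contDiffOn.mul (h2 _)
  · exact ContDiffOn.sum fun i _ => h2 _
  · exact contDiffOn_const.mul (h3 _)

lemma pdir_eq {n : ℕ} (v : EuclideanSpace ℝ (Fin n) × ℝ)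
    {f g : EuclideanSpace ℝ (Fin n) × ℝ → ℝ} (h : ∀ z, 0 < z.2 → f z = g z) :
    ∀ z, 0 < z.2 → pdirP n v f z = DW v g z := by
  intro z hz
  have ho : IsOpen {z : EuclideanSpace ℝ (Fin n) × ℝ | 0 < z.2} :=
    isOpen_lt continuous_const continuous_snd
  have hn : {z : EuclideanSpace ℝ (Fin n) × ℝ | 0 < z.2} ∈ 𝓝 z := ho.mem_nhds hz
  have h1 : f =ᶠ[𝓝 z] g := by
    filter_upwards [hn] with y hy using h y hy
  have h2 : SS n ∈ 𝓝 z := by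
    filter_upwards [hn] with y hy using le_of_lt hy
  unfold pdirP DW
  rw [h1.fderiv_eq, fderivWithin_of_mem_nhds h2]

lemma nAt_eq {n : ℕ} (a : ℝ) {f g : EuclideanSpace ℝ (Fin n) × ℝ → ℝ}
    (h : ∀ z, 0 < z.2 → f z = g z) :
    ∀ z, 0 < z.2 → -opA n a f z = nAt n a g z := by
  intro z hz
  unfold opA nAt
  have h1 := fun v => pdir_eq v h
  have h2 := fun v => pdir_eq v (h1 v)
  rw [h2 _ z hz, h1 _ z hz]
  congr 3
  exact Finset.sum_congr rfl fun i _ => by rw [h2 _ z hz]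

lemma negAIter_eq {n : ℕ} (a : ℝ) (k : ℕ) (f : EuclideanSpace ℝ (Fin n) × ℝ → ℝ) :
    ∀ z, 0 < z.2 → negAIter n a k f z = (nAt n a)^[k] f z := by
  unfold negAIter
  induction k with
  | zero => intro z _; rfl
  | succ k ih =>
    intro z hz
    rw [iterate_succ_apply', iterate_succ_apply']
    exact nAt_eq a ih z hz

/-- The extended space of the horizontal variables. -/
abbrev Zn (n : ℕ) := EuclideanSpace ℝ (Fin n ⊕ Fin 2)

/-- The folding map. -/
noncomputable def Psi {n : ℕ} (w : Zn n × ℝ) : EuclideanSpace ℝ (Fin n) × ℝ :=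
  (WithLp.toLp 2 (fun i => w.1 (Sum.inl i)),
    ((w.1 (Sum.inr 0)) ^ 2 + (w.1 (Sum.inr 1)) ^ 2 + w.2 ^ 2) / 4)

lemma Psi_mem {n : ℕ} (w : Zn n × ℝ) : Psi w ∈ SS n := by
  simp only [Psi, SS, Set.mem_setOf_eq]; positivity

lemma Psi_cont {n : ℕ} : Continuous (Psi (n := n)) := by
  unfold Psi; fun_prop

lemma Psi_abs {n : ℕ} (z : Zn n) (x : ℝ) : Psi (z, |x|) = Psi (z, x) := by
  simp [Psi]

lemma comp_cont {n : ℕ} {f : EuclideanSpace ℝ (Fin n) × ℝ → ℝ} (hf : ContinuousOn f (SS n)) :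
    Continuous fun w : Zn n × ℝ => f (Psi w) :=
  hf.comp_continuous Psi_cont Psi_mem

lemma chain_curve {n : ℕ} {f : EuclideanSpace ℝ (Fin n) × ℝ → ℝ} (hf : ContDiffOn ℝ 1 f (SS n))
    (g : ℝ → Zn n × ℝ) (t : ℝ) (v : EuclideanSpace ℝ (Fin n) × ℝ)
    (hg : HasDerivAt (fun s => Psi (g s)) v t) :
    HasDerivAt (fun s => f (Psi (g s))) (DW v f (Psi (g t))) t := by
  have h := ((hf.differentiableOn (by norm_num)) (Psi (g t)) (Psi_mem _)).hasFDerivWithinAt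
  exact h.comp_hasDerivAt t hg (Eventually.of_forall fun s => Psi_mem _)

lemma DW_smul {n : ℕ} (c : ℝ) (v : EuclideanSpace ℝ (Fin n) × ℝ)
    (f : EuclideanSpace ℝ (Fin n) × ℝ → ℝ) (z) : DW (c • v) f z = c * DW v f z := by
  simp [DW]

lemma chain_eta {n : ℕ} {f : EuclideanSpace ℝ (Fin n) × ℝ → ℝ} (hf : ContDiffOn ℝ 1 f (SS n))
    (z : Zn n) (x : ℝ) :
    HasDerivAt (fun s => f (Psi (z, s))) (x / 2 * DW (0, 1) f (Psi (z, x))) x := by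
  rw [← DW_smul]
  refine chain_curve hf (fun s => (z, s)) x _ ?_
  unfold Psi
  refine HasDerivAt.prodMk ?_ ?_
  · simp only [smul_zero]; exact hasDerivAt_const _ _
  · simp only
    have := (((hasDerivAt_id x).pow 2).const_add ((z (Sum.inr 0)) ^ 2 + (z (Sum.inr 1)) ^ 2)).div_const 4
    refine this.congr_deriv ?_
    simp; ring

lemma chain_inr {n : ℕ} {f : EuclideanSpace ℝ (Fin n) × ℝ → ℝ} (hf : ContDiffOn ℝ 1 f (SS n))
    (z : Zn n) (x : ℝ) (k : Fin 2) :
    HasLineDerivAt ℝ (fun z : Zn n => f (Psi (z, x)))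
      (z (Sum.inr k) / 2 * DW (0, 1) f (Psi (z, x))) z (EuclideanSpace.single (Sum.inr k) 1) := by
  unfold HasLineDerivAt
  rw [← DW_smul]
  have := chain_curve hf (fun s => (z + s • EuclideanSpace.single (Sum.inr k) 1, x)) 0
    ((z (Sum.inr k) / 2) • (0, 1)) ?_
  · simpa using this
  unfold Psi
  refine HasDerivAt.prodMk ?_ ?_
  · simp [hasDerivAt_const]
  · have h1 : ∀ c d : ℝ, HasDerivAt (fun s : ℝ => ((c + s) ^ 2 + d) / 4) (c / 2) 0 := by
      intro c d
      have := ((((hasDerivAt_id (0 : ℝ)).const_add c).pow 2).add_const d).div_const 4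
      refine this.congr_deriv ?_
      simp; ring
    fin_cases k
    · have := h1 (z (Sum.inr 0)) (z (Sum.inr 1) ^ 2 + x ^ 2)
      simpa [add_assoc] using this
    · have := h1 (z (Sum.inr 1)) (z (Sum.inr 0) ^ 2 + x ^ 2)
      simpa [add_assoc, add_left_comm] using this

lemma chain_inl {n : ℕ} {f : EuclideanSpace ℝ (Fin n) × ℝ → ℝ} (hf : ContDiffOn ℝ 1 f (SS n))
    (z : Zn n) (x : ℝ) (i : Fin n) :
    HasLineDerivAt ℝ (fun z : Zn n => f (Psi (z, x)))
      (DW (EuclideanSpace.single i 1, 0) f (Psi (z, x))) z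
      (EuclideanSpace.single (Sum.inl i) 1) := by
  unfold HasLineDerivAt
  have := chain_curve hf (fun s => (z + s • EuclideanSpace.single (Sum.inl i) 1, x)) 0
    (EuclideanSpace.single i 1, 0) ?_
  · simpa using this
  unfold Psi
  refine HasDerivAt.prodMk ?_ ?_
  · have h1 : (fun s : ℝ => (WithLp.toLp 2 (fun j => (z + s • EuclideanSpace.single (Sum.inl i) (1 : ℝ) : Zn n) (Sum.inl j)) : EuclideanSpace ℝ (Fin n)))
      = fun s => (WithLp.toLp 2 (fun j => z (Sum.inl j)) : EuclideanSpace ℝ (Fin n)) + s • EuclideanSpace.single i 1 := by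
      funext s
      ext j
      simp [EuclideanSpace.single_apply]
    simp only
    rw [h1]
    have := (((hasDerivAt_id (0 : ℝ)).smul_const (EuclideanSpace.single i 1 : EuclideanSpace ℝ (Fin n))).const_add (WithLp.toLp 2 (fun j => z (Sum.inl j)) : EuclideanSpace ℝ (Fin n)))
    simpa using this
  · simp [hasDerivAt_const]

lemma lineIBP {E : Type*} [NormedAddCommGroup E] [InnerProductSpace ℝ E] [MeasurableSpace E]
    [BorelSpace E] [FiniteDimensional ℝ E] (e : E) (g g1 g2 h h1 h2 : E → ℝ)
    (cg : Continuous g) (cg1 : Continuous g1) (cg2 : Continuous g2)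
    (ch : Continuous h) (ch1 : Continuous h1) (ch2 : Continuous h2)
    (dg : ∀ x, HasLineDerivAt ℝ g (g1 x) x e) (dg1 : ∀ x, HasLineDerivAt ℝ g1 (g2 x) x e)
    (dh : ∀ x, HasLineDerivAt ℝ h (h1 x) x e) (dh1 : ∀ x, HasLineDerivAt ℝ h1 (h2 x) x e)
    (sh : HasCompactSupport h) (sh1 : HasCompactSupport h1) (sh2 : HasCompactSupport h2) :
    ∫ x, g2 x * h x = ∫ x, g x * h2 x := by
  have I : ∀ f k : E → ℝ, Continuous f → Continuous k → HasCompactSupport k →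
      Integrable (fun x => f x * k x) := fun f k cf ck sk =>
    (cf.mul ck).integrable_of_hasCompactSupport sk.mul_left
  have a1 := integral_bilinear_hasLineDerivAt_right_eq_neg_left_of_integrable
    (μ := (volume : Measure E)) (B := ContinuousLinearMap.mul ℝ ℝ) (f := g) (f' := g1) (g := h1) (g' := h2) (v := e)
    (I _ _ cg1 ch1 sh1) (I _ _ cg ch2 sh2) (I _ _ cg ch1 sh1) (fun x _ => dg x) (fun x _ => dh1 x)
  have a2 := integral_bilinear_hasLineDerivAt_right_eq_neg_left_of_integrable
    (μ := (volume : Measure E)) (B := ContinuousLinearMap.mul ℝ ℝ) (f := g1) (f' := g2) (g := h) (g' := h1) (v := e)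
    (I _ _ cg2 ch sh) (I _ _ cg1 ch1 sh1) (I _ _ cg1 ch sh) (fun x _ => dg1 x) (fun x _ => dh x)
  simp only [ContinuousLinearMap.mul_apply'] at a1 a2
  rw [a1, a2]; ring

/-- The squared distance in the extended space. -/
noncomputable def QQ {n : ℕ} (z : Zn n) (w : Zn n × ℝ) : ℝ := ‖z - w.1‖ ^ 2 + w.2 ^ 2

lemma QQ_cont {n : ℕ} (z : Zn n) : Continuous (QQ z) := by unfold QQ; fun_prop

lemma line_sq {n : ℕ} (z y : Zn n) (j : Fin n ⊕ Fin 2) (s : ℝ) :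
    ‖z - (y + s • EuclideanSpace.single j (1 : ℝ))‖ ^ 2
      = ‖z - y‖ ^ 2 + 2 * s * (y j - z j) + s ^ 2 := by
  rw [← sub_sub, norm_sub_sq_real, inner_smul_right, norm_smul, EuclideanSpace.norm_single,
    EuclideanSpace.inner_single_right]
  simp
  ring

lemma line_QQ {n : ℕ} (z y : Zn n) (x : ℝ) (j : Fin n ⊕ Fin 2) {G : ℝ → ℝ} (hG : Smo G) :
    HasLineDerivAt ℝ (fun y : Zn n => G (QQ z (y, x)))
      (2 * (y j - z j) * deriv G (QQ z (y, x))) y (EuclideanSpace.single j 1) := by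
  unfold HasLineDerivAt
  have h0 : HasDerivAt (fun s : ℝ => QQ z (y + s • EuclideanSpace.single j (1 : ℝ), x))
      (2 * (y j - z j)) 0 := by
    unfold QQ
    simp only [line_sq]
    have := ((((hasDerivAt_id (0 : ℝ)).const_mul 2).mul_const (y j - z j)).const_add
      (‖z - y‖ ^ 2)).add ((hasDerivAt_id (0 : ℝ)).pow 2) |>.add_const (x ^ 2)
    refine this.congr_deriv ?_
    simp
  have h1 := (hG.hasDeriv (QQ z (y + (0 : ℝ) • EuclideanSpace.single j (1 : ℝ), x))).comp (0 : ℝ) h0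
  refine h1.congr_deriv ?_
  simp; ring

lemma line_QQ2 {n : ℕ} (z y : Zn n) (x : ℝ) (j : Fin n ⊕ Fin 2) {G : ℝ → ℝ} (hG : Smo G) :
    HasLineDerivAt ℝ (fun y : Zn n => 2 * (y j - z j) * deriv G (QQ z (y, x)))
      (2 * deriv G (QQ z (y, x)) + 4 * (y j - z j) ^ 2 * deriv (deriv G) (QQ z (y, x))) y
      (EuclideanSpace.single j 1) := by
  have h1 := line_QQ z y x j hG.deriv
  unfold HasLineDerivAt at *
  have h0 : HasDerivAt (fun s : ℝ => 2 * ((y + s • EuclideanSpace.single j (1 : ℝ) : Zn n) j - z j))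
      2 0 := by
    have := (((hasDerivAt_id (0 : ℝ)).const_add (y j)).sub_const (z j)).const_mul 2
    simpa using this
  refine (h0.mul h1).congr_deriv ?_
  simp; ring

lemma eta_QQ {n : ℕ} (z y : Zn n) (x : ℝ) {G : ℝ → ℝ} (hG : Smo G) :
    HasDerivAt (fun x => G (QQ z (y, x))) (2 * x * deriv G (QQ z (y, x))) x := by
  have h0 : HasDerivAt (fun x : ℝ => QQ z (y, x)) (2 * x) x := by
    unfold QQ
    have := ((hasDerivAt_id x).pow 2).const_add (‖z - y‖ ^ 2)
    refine this.congr_deriv ?_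
    simp
  refine ((hG.hasDeriv (QQ z (y, x))).comp x h0).congr_deriv ?_
  ring

lemma csupp {F : ℝ → ℝ} (hF : HasCompactSupport F) : ∃ R > 0, ∀ x, R < x → F x = 0 := by
  obtain ⟨R, hR⟩ := hF.isBounded.subset_closedBall 0
  refine ⟨max R 1, by positivity, fun x hx => ?_⟩
  by_contra h
  have h1 := hR (subset_tsupport F h)
  rw [mem_closedBall_zero_iff, Real.norm_eq_abs] at h1
  have := le_abs_self x
  have := le_max_left R 1
  linarith

lemma QQ_supp {n : ℕ} (z : Zn n) {F : ℝ → ℝ} (hF : HasCompactSupport F) :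
    HasCompactSupport (fun w => F (QQ z w)) := by
  obtain ⟨R, hR, h⟩ := csupp hF
  refine HasCompactSupport.intro
    (K := closedBall z (R + 1) ×ˢ closedBall (0 : ℝ) (R + 1))
    ((isCompact_closedBall _ _).prod (isCompact_closedBall _ _)) ?_
  intro w hw
  apply h
  by_contra hc
  apply hw
  unfold QQ at hc
  rw [Set.mem_prod, mem_closedBall_zero_iff, mem_closedBall, dist_comm, dist_eq_norm,
    Real.norm_eq_abs]
  constructor
  · by_contra h3
    nlinarith [norm_nonneg (z - w.1), sq_nonneg w.2]
  · by_contra h3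
    nlinarith [norm_nonneg (z - w.1), sq_nonneg ‖z - w.1‖, abs_nonneg w.2, sq_abs w.2]

lemma supp_left {n : ℕ} {f : Zn n × ℝ → ℝ} (hf : HasCompactSupport f) (x : ℝ) :
    HasCompactSupport (fun y => f (y, x)) := by
  refine HasCompactSupport.intro (K := Prod.fst '' tsupport f) (hf.image continuous_fst) ?_
  intro y hy
  by_contra h
  exact hy ⟨(y, x), subset_tsupport f h, rfl⟩

lemma supp_right {n : ℕ} {f : Zn n × ℝ → ℝ} (hf : HasCompactSupport f) (y : Zn n) :
    HasCompactSupport (fun x => f (y, x)) := by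
  refine HasCompactSupport.intro (K := Prod.snd '' tsupport f) (hf.image continuous_snd) ?_
  intro x hx
  by_contra h
  exact hx ⟨(y, x), subset_tsupport f h, rfl⟩

lemma QQ_norm {n : ℕ} (z : Zn n) (w : Zn n × ℝ) :
    QQ z w = ∑ j, (w.1 j - z j) ^ 2 + w.2 ^ 2 := by
  unfold QQ
  rw [norm_sub_rev, EuclideanSpace.norm_sq_eq]
  simp

section onestep
variable {n : ℕ} {κ : Measure ℝ} [SFinite κ] [IsFiniteMeasureOnCompacts κ]

lemma int_cs (g k : Zn n × ℝ → ℝ) (cg : Continuous g) (ck : Continuous k)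
    (sk : HasCompactSupport k) :
    Integrable (fun w => g w * k w) ((volume : Measure (Zn n)).prod κ) :=
  (cg.mul ck).integrable_of_hasCompactSupport sk.mul_left

/-- the second order term attached to a horizontal coordinate -/
noncomputable def Lterm (f : EuclideanSpace ℝ (Fin n) × ℝ → ℝ) (j : Fin n ⊕ Fin 2)
    (w : Zn n × ℝ) : ℝ :=
  match j with
  | Sum.inl i => DW (EuclideanSpace.single i 1, 0) (DW (EuclideanSpace.single i 1, 0) f) (Psi w)
  | Sum.inr k => 1 / 2 * DW (0, 1) f (Psi w)
      + (w.1 (Sum.inr k)) ^ 2 / 4 * DW (0, 1) (DW (0, 1) f) (Psi w)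

lemma Lterm_cont {f : EuclideanSpace ℝ (Fin n) × ℝ → ℝ} (hf : ContDiffOn ℝ 2 f (SS n))
    (j : Fin n ⊕ Fin 2) : Continuous (Lterm f j) := by
  have h1 : ∀ v, ContDiffOn ℝ 1 (DW v f) (SS n) := fun v => DW_cd v hf (by norm_num)
  have h2 : ∀ v, ContDiffOn ℝ 0 (DW v (DW v f)) (SS n) := fun v => DW_cd v (h1 v) (by norm_num)
  have c1 := fun v => comp_cont (h1 v).continuousOn
  have c2 := fun v => comp_cont (h2 v).continuousOn
  cases j with
  | inl i => exact c2 _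
  | inr k =>
    unfold Lterm
    have := c1 (0, 1)
    have := c2 (0, 1)
    fun_prop

lemma Lterm_ibp {f : EuclideanSpace ℝ (Fin n) × ℝ → ℝ} (hf : ContDiffOn ℝ 2 f (SS n))
    {F : ℝ → ℝ} (hF : Smo F) (sF : HasCompactSupport F) (z : Zn n) (x : ℝ) (j : Fin n ⊕ Fin 2) :
    ∫ y, Lterm f j (y, x) * F (QQ z (y, x)) =
      ∫ y, f (Psi (y, x)) * (2 * deriv F (QQ z (y, x))
        + 4 * (y j - z j) ^ 2 * deriv (deriv F) (QQ z (y, x))) := by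
  have h0 : ContDiffOn ℝ 1 f (SS n) := hf.of_le (by norm_num)
  have h1 : ∀ v, ContDiffOn ℝ 1 (DW v f) (SS n) := fun v => DW_cd v hf (by norm_num)
  have h2 : ∀ v, ContDiffOn ℝ 0 (DW v (DW v f)) (SS n) := fun v => DW_cd v (h1 v) (by norm_num)
  have c0 := comp_cont hf.continuousOn
  have c1 := fun v => comp_cont (h1 v).continuousOn
  have c2 := fun v => comp_cont (h2 v).continuousOn
  have cx : Continuous fun y : Zn n => (y, x) := by fun_prop
  have d0 := hF.continuous
  have d1 := hF.deriv.continuous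
  have d2 := hF.deriv.deriv.continuous
  have cQ : Continuous fun y : Zn n => QQ z (y, x) := (QQ_cont z).comp cx
  have t0 := supp_left (QQ_supp z sF) x
  have t1 := supp_left (QQ_supp z sF.deriv) x
  have t2 := supp_left (QQ_supp z sF.deriv.deriv) x
  have cL := (Lterm_cont hf j).comp cx
  have key : ∃ g1 : Zn n → ℝ, Continuous g1 ∧
      (∀ y, HasLineDerivAt ℝ (fun y => f (Psi (y, x))) (g1 y) y (EuclideanSpace.single j 1)) ∧
      (∀ y, HasLineDerivAt ℝ g1 (Lterm f j (y, x)) y (EuclideanSpace.single j 1)) := by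
    cases j with
    | inl i =>
      exact ⟨fun y => DW (EuclideanSpace.single i 1, 0) f (Psi (y, x)), (c1 _).comp cx,
        fun y => chain_inl h0 y x i, fun y => chain_inl (h1 _) y x i⟩
    | inr k =>
      refine ⟨fun y => y (Sum.inr k) / 2 * DW (0, 1) f (Psi (y, x)), ?_,
        fun y => chain_inr h0 y x k, fun y => ?_⟩
      · have := (c1 (0, 1)).comp cx
        simp only [Function.comp_def] at this
        fun_prop
      · have e1 := chain_inr (h1 (0, 1)) y x k
        unfold HasLineDerivAt at *
        have e0 : HasDerivAt (fun s : ℝ =>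
            (y + s • EuclideanSpace.single (Sum.inr k) (1 : ℝ) : Zn n) (Sum.inr k) / 2) (1 / 2) 0 := by
          have := ((hasDerivAt_id (0 : ℝ)).const_add (y (Sum.inr k))).div_const 2
          simpa using this
        refine (e0.mul e1).congr_deriv ?_
        simp [Lterm]; ring
  obtain ⟨g1, cg1, dg, dg1⟩ := key
  refine lineIBP (EuclideanSpace.single j 1) (fun y => f (Psi (y, x))) g1 _
    (fun y => F (QQ z (y, x))) (fun y => 2 * (y j - z j) * deriv F (QQ z (y, x))) _
    (c0.comp cx) cg1 cL (by fun_prop) (by fun_prop) (by fun_prop) dg dg1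
    (fun y => line_QQ z y x j hF) (fun y => line_QQ2 z y x j hF) t0 t1.mul_left ?_
  exact HasCompactSupport.add t1.mul_left t2.mul_left

lemma one_step (a : ℝ) (hκ : KIBP κ (2 * a - 2)) {f : EuclideanSpace ℝ (Fin n) × ℝ → ℝ}
    (hf : ContDiffOn ℝ 2 f (SS n)) {F : ℝ → ℝ} (hF : Smo F) (sF : HasCompactSupport F)
    (z : Zn n) :
    ∫ w, nAt n a f (Psi w) * F (QQ z w) ∂((volume : Measure (Zn n)).prod κ)
      = ∫ w, f (Psi w) * Dop (n + 2 * a) F (QQ z w) ∂((volume : Measure (Zn n)).prod κ) := by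
  have h0 : ContDiffOn ℝ 1 f (SS n) := hf.of_le (by norm_num)
  have h1 : ∀ v, ContDiffOn ℝ 1 (DW v f) (SS n) := fun v => DW_cd v hf (by norm_num)
  have h2 : ∀ v, ContDiffOn ℝ 0 (DW v (DW v f)) (SS n) := fun v => DW_cd v (h1 v) (by norm_num)
  have c0 := comp_cont hf.continuousOn
  have c1 := comp_cont (h1 (0, 1)).continuousOn
  have c2 := comp_cont (h2 (0, 1)).continuousOn
  have d0 := hF.continuous
  have d1 := hF.deriv.continuous
  have d2 := hF.deriv.deriv.continuous
  have cQ := QQ_cont z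
  have t0 := QQ_supp z sF
  have t1 := QQ_supp z sF.deriv
  have t2 := QQ_supp z sF.deriv.deriv
  set K : Zn n × ℝ → ℝ := fun w => (2 * a - 2) / 2 * DW (0, 1) f (Psi w)
    + w.2 ^ 2 / 4 * DW (0, 1) (DW (0, 1) f) (Psi w) with hK
  have cK : Continuous K := by fun_prop
  have e1 : ∀ w, nAt n a f (Psi w) * F (QQ z w)
      = -(∑ j, Lterm f j w * F (QQ z w) + K w * F (QQ z w)) := by
    intro w
    rw [← Finset.sum_mul, ← add_mul, ← neg_mul]
    congr 1
    rw [Fintype.sum_sum_type, Fin.sum_univ_two]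
    simp only [nAt, Lterm, hK]
    simp only [Psi]
    ring
  have e2 : ∀ w : Zn n × ℝ, f (Psi w) * Dop (n + 2 * a) F (QQ z w)
      = -(∑ j, f (Psi w) * (2 * deriv F (QQ z w)
        + 4 * (w.1 j - z j) ^ 2 * deriv (deriv F) (QQ z w))
        + f (Psi w) * (2 * (2 * a - 2) * deriv F (QQ z w)
          + 4 * w.2 ^ 2 * deriv (deriv F) (QQ z w))) := by
    intro w
    rw [← Finset.mul_sum, ← mul_add, Finset.sum_add_distrib, ← mul_neg]
    congr 1
    have hq : ∑ j, (w.1 j - z j) ^ 2 = QQ z w - w.2 ^ 2 := by rw [QQ_norm]; ring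
    have hq2 : ∑ j, 4 * (w.1 j - z j) ^ 2 * deriv (deriv F) (QQ z w)
        = 4 * (QQ z w - w.2 ^ 2) * deriv (deriv F) (QQ z w) := by
      rw [← hq, Finset.mul_sum, Finset.sum_mul]
    rw [hq2]
    simp only [Dop, Finset.sum_const, Finset.card_univ, Fintype.card_sum, Fintype.card_fin,
      nsmul_eq_mul]
    push_cast
    ring
  simp only [e1, e2]
  rw [integral_neg, integral_neg]
  congr 1
  have i1 : ∀ j, Integrable (fun w => Lterm f j w * F (QQ z w)) ((volume : Measure (Zn n)).prod κ) :=
    fun j => int_cs _ _ (Lterm_cont hf j) (by fun_prop) t0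
  have i2 : Integrable (fun w => K w * F (QQ z w)) ((volume : Measure (Zn n)).prod κ) :=
    int_cs _ _ cK (by fun_prop) t0
  have i3 : ∀ j, Integrable (fun w : Zn n × ℝ => f (Psi w) * (2 * deriv F (QQ z w)
        + 4 * (w.1 j - z j) ^ 2 * deriv (deriv F) (QQ z w))) ((volume : Measure (Zn n)).prod κ) :=
    fun j => int_cs _ _ c0 (by fun_prop) (HasCompactSupport.add t1.mul_left t2.mul_left)
  have i4 : Integrable (fun w : Zn n × ℝ => f (Psi w) * (2 * (2 * a - 2) * deriv F (QQ z w)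
          + 4 * w.2 ^ 2 * deriv (deriv F) (QQ z w))) ((volume : Measure (Zn n)).prod κ) :=
    int_cs _ _ c0 (by fun_prop) (HasCompactSupport.add t1.mul_left t2.mul_left)
  rw [integral_add (integrable_finsetSum _ fun j _ => i1 j) i2,
    integral_add (integrable_finsetSum _ fun j _ => i3 j) i4,
    integral_finsetSum _ (fun j _ => i1 j), integral_finsetSum _ (fun j _ => i3 j)]
  congr 1
  · refine Finset.sum_congr rfl fun j _ => ?_
    rw [integral_prod_symm _ (i1 j), integral_prod_symm _ (i3 j)]
    refine integral_congr_ae (Eventually.of_forall fun x => ?_)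
    exact Lterm_ibp hf hF sF z x j
  · rw [integral_prod _ i2, integral_prod _ i4]
    refine integral_congr_ae (Eventually.of_forall fun y => ?_)
    have cy : Continuous fun x : ℝ => (y, x) := by fun_prop
    have aQ : ∀ x : ℝ, QQ z (y, |x|) = QQ z (y, x) := fun x => by simp [QQ]
    refine hκ (fun x => f (Psi (y, x))) (fun x => DW (0, 1) f (Psi (y, x)))
      (fun x => DW (0, 1) (DW (0, 1) f) (Psi (y, x))) (fun x => F (QQ z (y, x)))
      (fun x => deriv F (QQ z (y, x))) (fun x => deriv (deriv F) (QQ z (y, x)))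
      (c0.comp cy) (c1.comp cy) (c2.comp cy) (d0.comp (cQ.comp cy)) (d1.comp (cQ.comp cy))
      (d2.comp (cQ.comp cy)) (fun x => chain_eta h0 y x) (fun x => chain_eta (h1 _) y x)
      (fun x => eta_QQ z y x hF) (fun x => eta_QQ z y x hF.deriv) ?_ ?_ ?_ ?_ ?_ ?_
      (supp_right t0 y) (supp_right t1 y) (supp_right t2 y)
    all_goals intro x; simp only [Psi_abs, aQ]

lemma Dop_supp {N : ℝ} {F : ℝ → ℝ} (sF : HasCompactSupport F) : HasCompactSupport (Dop N F) := by
  have h := HasCompactSupport.neg (HasCompactSupport.add (f := fun q => 4 * q * deriv (deriv F) q)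
    (f' := fun q => 2 * N * deriv F q) sF.deriv.deriv.mul_left sF.deriv.mul_left)
  exact h

lemma Dop_iter_supp {N : ℝ} {F : ℝ → ℝ} (sF : HasCompactSupport F) (k : ℕ) :
    HasCompactSupport ((Dop N)^[k] F) := by
  induction k with
  | zero => exact sF
  | succ k ih => rw [iterate_succ_apply']; exact Dop_supp ih

lemma iter_step (a : ℝ) (hκ : KIBP κ (2 * a - 2)) (k : ℕ) :
    ∀ f : EuclideanSpace ℝ (Fin n) × ℝ → ℝ, ContDiffOn ℝ (2 * k : ℕ) f (SS n) →
    ∀ F : ℝ → ℝ, Smo F → HasCompactSupport F → ∀ z : Zn n,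
    ∫ w, (nAt n a)^[k] f (Psi w) * F (QQ z w) ∂((volume : Measure (Zn n)).prod κ)
      = ∫ w, f (Psi w) * (Dop (n + 2 * a))^[k] F (QQ z w) ∂((volume : Measure (Zn n)).prod κ) := by
  induction k with
  | zero => intro f _ F _ _ z; rfl
  | succ k ih =>
    intro f hf F hF sF z
    rw [iterate_succ_apply]
    have h1 : ContDiffOn ℝ (2 * k + 2 : ℕ) f (SS n) := hf.of_le (by norm_cast)
    rw [ih (nAt n a f) (nAt_cd a h1) F hF sF z, iterate_succ_apply']
    exact one_step a hκ (h1.of_le (by norm_cast; omega)) (hF.iter _ k) (Dop_iter_supp sF k) z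

lemma ae_Psi_pos : ∀ᵐ w ∂((volume : Measure (Zn n)).prod κ), 0 < (Psi w).2 := by
  have h1 : ∀ᵐ y ∂(volume : Measure (Zn n)), y (Sum.inr 0) ≠ 0 := by
    have h2 : (LinearMap.ker (EuclideanSpace.proj (Sum.inr 0) : Zn n →L[ℝ] ℝ).toLinearMap) ≠ ⊤ := by
      intro h
      have := h.ge (show EuclideanSpace.single (Sum.inr 0) (1 : ℝ) ∈ ⊤ from trivial)
      simp at this
    have h3 := Measure.addHaar_submodule (volume : Measure (Zn n)) _ h2
    rw [ae_iff]
    convert h3 using 2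
    ext y
    simp
  have h4 := Measure.quasiMeasurePreserving_fst (μ := (volume : Measure (Zn n))) (ν := κ) |>.ae h1
  filter_upwards [h4] with w hw
  have : 0 < (w.1 (Sum.inr 0)) ^ 2 := by positivity
  simp only [Psi]
  positivity

lemma star_id (a : ℝ) (hκ : KIBP κ (2 * a - 2)) (p : ℕ) (α : ℝ)
    (u : EuclideanSpace ℝ (Fin n) × ℝ → ℝ) (hu : ContDiffOn ℝ (2 * p) u (SS n))
    (heq : ∀ z, 0 < z.2 → negAIter n a p u z = u z ^ α)
    (F : ℝ → ℝ) (hF : Smo F) (sF : HasCompactSupport F) (z : Zn n) :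
    ∫ w, u (Psi w) ^ α * F (QQ z w) ∂((volume : Measure (Zn n)).prod κ)
      = ∫ w, u (Psi w) * (Dop (n + 2 * a))^[p] F (QQ z w) ∂((volume : Measure (Zn n)).prod κ) := by
  rw [← iter_step a hκ p u (by exact_mod_cast hu) F hF sF z]
  refine integral_congr_ae ?_
  filter_upwards [ae_Psi_pos (n := n) (κ := κ)] with w hw
  rw [← heq _ hw, negAIter_eq a p u _ hw]

end onestep

/-- The measure on the extended space. -/
noncomputable def mu (n : ℕ) (b : ℝ) : Measure (Zn n × ℝ) :=
  (volume : Measure (Zn n)).prod (kap b)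

/-- The distribution of the squared distance. -/
noncomputable def nu (n : ℕ) (b : ℝ) : Measure ℝ := Measure.map (QQ (0 : Zn n)) (mu n b)

lemma QQ_nonneg {n : ℕ} (z : Zn n) (w : Zn n × ℝ) : 0 ≤ QQ z w := by unfold QQ; positivity

lemma QQ_meas {n : ℕ} (z : Zn n) : Measurable (QQ z) := (QQ_cont z).measurable

lemma map_QQ {n : ℕ} {b : ℝ} (z : Zn n) : Measure.map (QQ z) (mu n b) = nu n b := by
  have := kap_sfin b
  have h1 : MeasurePreserving (fun w : Zn n × ℝ => (w.1 - z, w.2)) (mu n b) (mu n b) :=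
    (measurePreserving_sub_right (volume : Measure (Zn n)) z).prod (MeasurePreserving.id (kap b))
  have h2 : QQ z = QQ (0 : Zn n) ∘ (fun w : Zn n × ℝ => (w.1 - z, w.2)) := by
    funext w
    simp [QQ, norm_sub_rev]
  rw [h2, ← Measure.map_map (QQ_meas 0) h1.measurable, h1.map_eq, nu]

lemma QQ_compact {n : ℕ} (z : Zn n) (R : ℝ) : IsCompact {w | QQ z w ≤ R} := by
  have hc : IsClosed {w | QQ z w ≤ R} := isClosed_le (QQ_cont z) continuous_const
  refine ((isCompact_closedBall z (|R| + 1)).prod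
    (isCompact_closedBall (0 : ℝ) (|R| + 1))).of_isClosed_subset hc ?_
  intro w hw
  simp only [Set.mem_setOf_eq, QQ] at hw
  rw [Set.mem_prod, mem_closedBall_zero_iff, mem_closedBall, dist_comm, dist_eq_norm,
    Real.norm_eq_abs]
  have := le_abs_self R
  have := abs_nonneg R
  constructor
  · by_contra h3
    nlinarith [norm_nonneg (z - w.1), sq_nonneg w.2]
  · by_contra h3
    nlinarith [norm_nonneg (z - w.1), sq_nonneg ‖z - w.1‖, abs_nonneg w.2, sq_abs w.2]

lemma nu_fin {n : ℕ} {b : ℝ} (hb : 0 ≤ b) (R : ℝ) : nu n b (Set.Iic R) ≠ ⊤ := by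
  have := kap_sfin b
  have := kap_finK hb
  rw [nu, Measure.map_apply (QQ_meas 0) measurableSet_Iic]
  have : IsFiniteMeasureOnCompacts (mu n b) := by unfold mu; infer_instance
  exact (QQ_compact (0 : Zn n) R).measure_lt_top.ne

lemma kap_scal {b : ℝ} (hb : 0 ≤ b) (R : ℝ) (hR : 0 < R) :
    Measure.map (fun x => R⁻¹ * x) (kap b) = ENNReal.ofReal (R ^ b) • kap b := by
  rcases hb.eq_or_lt with rfl | hb
  · rw [kap_zero, Measure.map_dirac' (show Measurable fun x : ℝ => R⁻¹ * x by fun_prop)]; simp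
  · rw [kap_pos hb]
    have mT : Measurable fun x : ℝ => R⁻¹ * x := by fun_prop
    ext s hs
    rw [Measure.map_apply mT hs, withDensity_apply _ (mT hs), Measure.smul_apply,
      withDensity_apply _ hs, smul_eq_mul]
    have e : ∀ x : ℝ, ENNReal.ofReal (|x| ^ (b - 1))
        = ENNReal.ofReal (R ^ (b - 1)) * ENNReal.ofReal (|R⁻¹ * x| ^ (b - 1)) := by
      intro x
      rw [← ENNReal.ofReal_mul (by positivity), ← Real.mul_rpow hR.le (abs_nonneg _), abs_mul,
        abs_of_pos (inv_pos.2 hR), mul_inv_cancel_left₀ hR.ne']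
    rw [lintegral_congr e, lintegral_const_mul _ (by fun_prop)]
    have h1 := setLIntegral_map (μ := volume) hs (mdens b) mT
    rw [← h1, Real.map_volume_mul_left (inv_pos.2 hR).ne', inv_inv, abs_of_pos hR,
      Measure.restrict_smul, lintegral_smul_measure, smul_eq_mul, ← mul_assoc,
      ← ENNReal.ofReal_mul (by positivity), ← Real.rpow_add_one hR.ne']
    simp

lemma mu_scal {n : ℕ} {b : ℝ} (hb : 0 ≤ b) (R : ℝ) (hR : 0 < R) :
    Measure.map (fun w : Zn n × ℝ => (R⁻¹ • w.1, R⁻¹ * w.2)) (mu n b)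
      = ENNReal.ofReal (R ^ (n + 2 + b)) • mu n b := by
  have := kap_sfin b
  have h := Measure.map_prod_map (volume : Measure (Zn n)) (kap b)
    (f := fun z : Zn n => R⁻¹ • z) (g := fun x => R⁻¹ * x) (by fun_prop) (by fun_prop)
  have e : (fun w : Zn n × ℝ => (R⁻¹ • w.1, R⁻¹ * w.2))
    = Prod.map (fun z : Zn n => R⁻¹ • z) (fun x => R⁻¹ * x) := rfl
  rw [e, mu, ← h, kap_scal hb R hR, Measure.map_addHaar_smul _ (inv_pos.2 hR).ne',
    Measure.prod_smul_left, Measure.prod_smul_right, smul_smul, ← ENNReal.ofReal_mul (by positivity)]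
  congr 2
  simp only [finrank_euclideanSpace, Fintype.card_sum, Fintype.card_fin]
  rw [inv_pow, inv_inv, abs_of_pos (by positivity), Real.rpow_add hR]
  congr 1
  exact_mod_cast (Real.rpow_natCast R (n + 2)).symm

lemma nu_scal {n : ℕ} {b : ℝ} (hb : 0 ≤ b) (R : ℝ) (hR : 0 < R) :
    Measure.map (fun x => (R ^ 2)⁻¹ * x) (nu n b) = ENNReal.ofReal (R ^ (n + 2 + b)) • nu n b := by
  rw [nu, Measure.map_map (by fun_prop) (QQ_meas 0)]
  have : (fun x => (R ^ 2)⁻¹ * x) ∘ QQ (0 : Zn n)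
      = QQ (0 : Zn n) ∘ (fun w : Zn n × ℝ => (R⁻¹ • w.1, R⁻¹ * w.2)) := by
    funext w
    simp only [QQ, comp_apply, zero_sub, norm_neg, norm_smul, Real.norm_eq_abs, abs_of_pos (inv_pos.2 hR)]
    ring
  rw [this, ← Measure.map_map (QQ_meas 0) (by fun_prop), mu_scal hb R hR, Measure.map_smul]

lemma QQ_self {n : ℕ} (z : Zn n) : QQ z (z, 0) = 0 := by simp [QQ]

/-- Representation data. -/
lemma mkRP {n p : ℕ} {a α : ℝ} (hp : 1 ≤ p) (ha : 1 ≤ a) (hγ : 0 < (n : ℝ) + 2 * a - 2 * p)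
    (hα : 1 < α) (u : EuclideanSpace ℝ (Fin n) × ℝ → ℝ) (hu : ContDiffOn ℝ (2 * p) u (SS n))
    (u0 : ∀ z : EuclideanSpace ℝ (Fin n) × ℝ, 0 ≤ z.2 → 0 ≤ u z)
    (heq : ∀ z : EuclideanSpace ℝ (Fin n) × ℝ, 0 < z.2 → negAIter n a p u z = u z ^ α) (z : Zn n) :
    RP (mu n (2 * a - 2)) (nu n (2 * a - 2)) (QQ z) (fun w => u (Psi w)) (n + 2 * a)
      (n + 2 * a - 2 * p) α p (u (Psi (z, 0))) := by
  have hb : 0 ≤ 2 * a - 2 := by linarith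
  have := kap_sfin (2 * a - 2)
  have := kap_finK hb
  have cu := comp_cont hu.continuousOn
  refine ⟨hα, hγ, hp, rfl, QQ_meas z, QQ_nonneg z, cu.measurable, fun w => u0 _ (Psi_mem w), ?_,
    map_QQ z, nu_fin hb, ?_, ?_, ?_⟩
  · intro R
    obtain ⟨M, hM⟩ := ((QQ_compact z R).image cu).bddAbove
    exact ⟨M, fun w hw => hM ⟨w, hw, rfl⟩⟩
  · intro R hR
    rw [nu_scal hb R hR]
    congr 3; ring
  · intro F hF sF
    exact star_id a (KIBP_kap hb) p α u hu heq F hF sF z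
  · intro ε hε
    obtain ⟨δ, hδ, h⟩ := Metric.continuous_iff.1 cu (z, 0) ε hε
    refine ⟨δ ^ 2, by positivity, fun w hw => ?_⟩
    have := h w ?_
    · rwa [Real.dist_eq] at this
    · unfold QQ at hw
      rw [Prod.dist_eq, max_lt_iff]
      constructor
      · rw [dist_comm, dist_eq_norm]
        simp only
        by_contra h3
        nlinarith [norm_nonneg (z - w.1), sq_nonneg w.2]
      · rw [Real.dist_eq, sub_zero]
        by_contra h3
        nlinarith [sq_nonneg ‖z - w.1‖, abs_nonneg w.2, sq_abs w.2]

/-- Change of variables for the inversion. -/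
lemma inv_jac {E : Type*} [NormedAddCommGroup E] [InnerProductSpace ℝ E] [MeasurableSpace E]
    [BorelSpace E] [FiniteDimensional ℝ E] [Nontrivial E] (c : E) (l : ℝ) (hl : 0 < l)
    (h : E → ENNReal) :
    ∫⁻ x, h x = ∫⁻ x, h (kinv c l x) * ENNReal.ofReal ((l / ‖x - c‖) ^ (2 * Module.finrank ℝ E)) := by
  have hae : ({c}ᶜ : Set E) =ᵐ[volume] Set.univ := by
    rw [ae_eq_univ]; simp
  have hR : ∀ k : E → ENNReal, ∫⁻ x in ({c}ᶜ : Set E), k x = ∫⁻ x, k x := by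
    intro k
    rw [setLIntegral_congr hae, setLIntegral_univ]
  have hk : kinv c l = EuclideanGeometry.inversion c l := by
    funext x
    simp only [kinv, EuclideanGeometry.inversion, dist_eq_norm, vsub_eq_sub, vadd_eq_add]
    rw [add_comm]
  have h1 := lintegral_image_eq_lintegral_abs_det_fderiv_mul (volume : Measure E)
    (s := ({c}ᶜ : Set E)) (f := kinv c l)
    (f' := fun x => (l / dist x c) ^ 2 • ((ℝ ∙ (x - c))ᗮ.reflection : E →L[ℝ] E))
    (measurableSet_singleton c).compl ?_ ?_ h
  · have him : kinv c l '' ({c}ᶜ : Set E) = {c}ᶜ := by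
      ext x
      constructor
      · rintro ⟨y, hy, rfl⟩
        exact kinv_ne c l hl y hy
      · intro hx
        exact ⟨kinv c l x, kinv_ne c l hl x hx, kinv_kinv c l hl x hx⟩
    rw [him, hR, hR] at h1
    rw [h1]
    refine lintegral_congr fun x => ?_
    rw [mul_comm]
    congr 2
    have hdet : |((ℝ ∙ (x - c))ᗮ.reflection : E →L[ℝ] E).det| = 1 := by
      have := (ℝ ∙ (x - c))ᗮ.det_reflection
      have h3 : ((ℝ ∙ (x - c))ᗮ.reflection : E →L[ℝ] E).det
        = LinearMap.det ((ℝ ∙ (x - c))ᗮ.reflection).toLinearMap := rfl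
      rw [h3, this, abs_pow]; simp
    have h4 : ((l / dist x c) ^ 2 • ((ℝ ∙ (x - c))ᗮ.reflection : E →L[ℝ] E)).det
      = ((l / dist x c) ^ 2) ^ Module.finrank ℝ E * ((ℝ ∙ (x - c))ᗮ.reflection : E →L[ℝ] E).det := by
      exact LinearMap.det_smul _ _
    rw [h4, abs_mul, hdet, mul_one, abs_of_nonneg (by positivity), ← pow_mul, dist_eq_norm]
  · intro x hx
    rw [hk]
    exact (EuclideanGeometry.hasFDerivAt_inversion hx).hasFDerivWithinAt
  · intro x hx y hy hxy
    rw [← kinv_kinv c l hl x hx, hxy, kinv_kinv c l hl y hy]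

/-- The projection of the extended space to the horizontal variables. -/
noncomputable def prW {n : ℕ} (w : Zn n × ℝ) : Zn n :=
  WithLp.toLp 2 (fun j => if j = Sum.inr 1 then √((w.1 (Sum.inr 1)) ^ 2 + w.2 ^ 2) else w.1 j)

/-- The inversion in the extended space. -/
noncomputable def JW {n : ℕ} (z₀ : Zn n) (l : ℝ) (w : Zn n × ℝ) : Zn n × ℝ :=
  (z₀ + (l ^ 2 / QQ z₀ w) • (w.1 - z₀), (l ^ 2 / QQ z₀ w) * w.2)

lemma prW_cont {n : ℕ} : Continuous (prW (n := n)) := by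
  unfold prW
  refine (PiLp.continuous_toLp 2 _).comp (continuous_pi fun j => ?_)
  by_cases h : j = Sum.inr 1
  · simp only [h, if_true]; fun_prop
  · simp only [h, if_false]; fun_prop

lemma prW_norm {n : ℕ} {z₀ : Zn n} (hz : z₀ (Sum.inr 1) = 0) (w : Zn n × ℝ) :
    ‖prW w - z₀‖ ^ 2 = QQ z₀ w := by
  rw [QQ_norm, EuclideanSpace.norm_sq_eq]
  simp only [Fintype.sum_sum_type, Fin.sum_univ_two]
  simp [prW, hz]
  rw [Real.sq_sqrt (by positivity)]; ring

lemma Psi_prW {n : ℕ} (w : Zn n × ℝ) : Psi (prW w, 0) = Psi w := by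
  simp [Psi, prW]
  rw [Real.sq_sqrt (by positivity)]; ring

lemma QQ_pos {n : ℕ} {z₀ : Zn n} (hz : z₀ (Sum.inr 1) = 0) {w : Zn n × ℝ} (hw : prW w ≠ z₀) :
    0 < QQ z₀ w := by
  rw [← prW_norm hz]
  have := norm_pos_iff.2 (sub_ne_zero.2 hw)
  positivity

lemma prW_JW {n : ℕ} {z₀ : Zn n} (hz : z₀ (Sum.inr 1) = 0) {l : ℝ} (hl : 0 < l) {w : Zn n × ℝ}
    (hw : prW w ≠ z₀) : prW (JW z₀ l w) = kinv z₀ l (prW w) := by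
  have h := QQ_pos hz hw
  have h1 : (l / ‖prW w - z₀‖) ^ 2 = l ^ 2 / QQ z₀ w := by rw [div_pow, prW_norm hz]
  unfold kinv
  rw [h1]
  have h2 : 0 < l ^ 2 / QQ z₀ w := by positivity
  ext j
  by_cases hj : j = Sum.inr 1
  · subst hj
    simp [prW, JW, hz]
    rw [mul_pow, mul_pow, ← mul_add, Real.sqrt_mul (by positivity), Real.sqrt_sq h2.le]
  · simp [prW, JW, hj]

lemma QQ_expand {n : ℕ} (z z₀ : Zn n) (w : Zn n × ℝ) :
    QQ z w = ‖z - z₀‖ ^ 2 - 2 * inner ℝ (z - z₀) (w.1 - z₀) + QQ z₀ w := by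
  unfold QQ
  have : z - w.1 = (z - z₀) - (w.1 - z₀) := by abel
  rw [this, norm_sub_sq_real, norm_sub_rev z₀ w.1]; ring

lemma QQ_JW {n : ℕ} (z z₀ : Zn n) (l : ℝ) (w : Zn n × ℝ) (h : QQ z₀ w ≠ 0) :
    QQ z₀ w * QQ z (JW z₀ l w)
      = QQ z₀ w * ‖z - z₀‖ ^ 2 - 2 * l ^ 2 * inner ℝ (z - z₀) (w.1 - z₀) + l ^ 4 := by
  rw [QQ_expand z z₀]
  have h1 : QQ z₀ (JW z₀ l w) = (l ^ 2 / QQ z₀ w) ^ 2 * QQ z₀ w := by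
    rw [QQ, JW]
    simp only
    rw [sub_add_cancel_left, norm_neg, norm_smul, mul_pow, norm_sub_rev, Real.norm_eq_abs, sq_abs]
    rw [mul_pow, ← mul_add]; rfl
  rw [h1]
  simp only [JW, add_sub_cancel_left, inner_smul_right]
  field_simp

lemma JW_JW {n : ℕ} (z₀ : Zn n) (l : ℝ) (hl : 0 < l) (w : Zn n × ℝ) (h : 0 < QQ z₀ w) :
    JW z₀ l (JW z₀ l w) = w := by
  have h1 : QQ z₀ (JW z₀ l w) = l ^ 4 / QQ z₀ w := by
    have := QQ_JW z₀ z₀ l w h.ne'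
    simp at this
    field_simp; linarith
  have h2 : l ^ 2 / QQ z₀ (JW z₀ l w) * (l ^ 2 / QQ z₀ w) = 1 := by
    rw [h1]; field_simp
  rw [JW]
  set d := l ^ 2 / QQ z₀ (JW z₀ l w)
  simp only [JW, add_sub_cancel_left, smul_smul, ← mul_assoc, h2]
  simp

lemma ae_QQ {n : ℕ} {b : ℝ} (z : Zn n) (m : ℝ) : ∀ᵐ w ∂(mu n b), QQ z w ≠ m := by
  have := kap_sfin b
  have hs : MeasurableSet {w | ¬ (QQ z w ≠ m)} := by
    simp only [not_not]
    exact (QQ_meas z) (measurableSet_singleton m)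
  rw [ae_iff, mu, Measure.prod_apply_symm hs, lintegral_eq_zero_iff (measurable_measure_prodMk_right hs)]
  refine Eventually.of_forall fun x => ?_
  simp only [Pi.zero_apply]
  refine measure_mono_null (t := sphere z (√(m - x ^ 2))) ?_ (Measure.addHaar_sphere _ _ _)
  intro y hy
  simp only [ne_eq, not_not, Set.mem_preimage, Set.mem_setOf_eq, QQ] at hy
  rw [mem_sphere, dist_comm, dist_eq_norm, ← hy, add_sub_cancel_right, Real.sqrt_sq (norm_nonneg _)]

lemma prW_self {n : ℕ} (w : Zn n × ℝ) : prW (prW w, 0) = prW w := by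
  ext j
  by_cases hj : j = Sum.inr 1
  · subst hj; simp [prW]
  · simp [prW, hj]

lemma mu_open {n : ℕ} {b : ℝ} (hb : 0 ≤ b) (O : Set (Zn n)) (hO : IsOpen O)
    (h : ∃ w : Zn n × ℝ, prW w ∈ O) : mu n b (prW ⁻¹' O) ≠ 0 := by
  have := kap_sfin b
  have hU : IsOpen (prW ⁻¹' O) := hO.preimage prW_cont
  obtain ⟨w, hw⟩ := h
  rcases hb.eq_or_lt with rfl | hb
  · rw [mu, kap_zero, Measure.prod_apply_symm hU.measurableSet, lintegral_dirac]
    refine (IsOpen.measure_pos _ (hU.preimage (by fun_prop)) ⟨prW w, ?_⟩).ne'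
    simp only [Set.mem_preimage, prW_self]; exact hw
  · have hop : Measure.IsOpenPosMeasure (kap b) := by
      refine ⟨fun U hU hn h0 => ?_⟩
      rw [kap_pos hb, withDensity_apply_eq_zero (mdens b)] at h0
      obtain ⟨x, hx⟩ := hn
      have h1 : IsOpen (U ∩ {0}ᶜ) := hU.inter isOpen_compl_singleton
      have h2 : (U ∩ {0}ᶜ).Nonempty := by
        have hd : Dense ({0}ᶜ : Set ℝ) := dense_compl_singleton 0
        exact hd.inter_open_nonempty U hU ⟨x, hx⟩
      have h3 := h1.measure_pos volume h2
      refine h3.ne' (measure_mono_null ?_ h0)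
      rintro y ⟨hy, hy0⟩
      refine ⟨?_, hy⟩
      have : 0 < |y| := abs_pos.2 hy0
      simp only [Set.mem_setOf_eq, ne_eq, ENNReal.ofReal_eq_zero, not_le]
      positivity
    have : Measure.IsOpenPosMeasure (mu n b) := by unfold mu; infer_instance
    exact (hU.measure_pos _ ⟨w, hw⟩).ne'

lemma JW_meas {n : ℕ} (z₀ : Zn n) (l : ℝ) : Measurable (JW z₀ l) := by
  have := QQ_meas z₀
  unfold JW
  fun_prop

lemma ae_ne_pt {E : Type*} [NormedAddCommGroup E] [InnerProductSpace ℝ E] [MeasurableSpace E]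
    [BorelSpace E] [FiniteDimensional ℝ E] [Nontrivial E] (c : E) : ∀ᵐ x : E, x ≠ c := by
  rw [ae_iff]; simp

set_option maxHeartbeats 1000000 in
lemma mu_jac {n : ℕ} {b : ℝ} (hb : 0 ≤ b) (z₀ : Zn n) (hz : z₀ (Sum.inr 1) = 0) (l : ℝ)
    (hl : 0 < l) (h : Zn n × ℝ → ENNReal) (mh : Measurable h) :
    ∫⁻ w, h w ∂(mu n b)
      = ∫⁻ w, h (JW z₀ l w) * ENNReal.ofReal ((l / ‖prW w - z₀‖) ^ (2 * (n + 2 + b))) ∂(mu n b) := by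
  have := kap_sfin b
  have mP : Measurable (prW (n := n)) := prW_cont.measurable
  have mJ := JW_meas z₀ l
  have mR : Measurable fun w => h (JW z₀ l w)
      * ENNReal.ofReal ((l / ‖prW w - z₀‖) ^ (2 * (n + 2 + b))) := by fun_prop
  have hnorm : ∀ w, ‖prW w - z₀‖ = √(QQ z₀ w) := by
    intro w
    rw [← prW_norm hz, Real.sqrt_sq (norm_nonneg _)]
  rcases hb.eq_or_lt with rfl | hb
  · rw [mu, kap_zero, lintegral_prod _ mh.aemeasurable, lintegral_prod _ mR.aemeasurable]
    simp only [lintegral_dirac]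
    rw [inv_jac z₀ l hl]
    refine lintegral_congr fun z => ?_
    have hq : QQ z₀ (z, 0) = ‖z - z₀‖ ^ 2 := by simp [QQ, norm_sub_rev]
    have h1 : JW z₀ l (z, 0) = (kinv z₀ l z, 0) := by
      simp only [JW, kinv, hq, div_pow, mul_zero]
    rw [h1, hnorm, hq, Real.sqrt_sq (norm_nonneg _)]
    congr 2
    rw [← Real.rpow_natCast]
    congr 1
    simp
  · have hmu : mu n b = (volume : Measure (Zn n × ℝ)).withDensity
        (fun w => ENNReal.ofReal (|w.2| ^ (b - 1))) := by
      rw [mu, kap_pos hb, prod_withDensity_right (mdens b)]; rfl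
    have md : Measurable (fun w : Zn n × ℝ => ENNReal.ofReal (|w.2| ^ (b - 1))) := by fun_prop
    rw [hmu, lintegral_withDensity_eq_lintegral_mul _ md mh,
      lintegral_withDensity_eq_lintegral_mul _ md mR]
    have hp := WithLp.volume_preserving_ofLp (Zn n) ℝ
    rw [← hp.lintegral_comp (md.mul mh), ← hp.lintegral_comp (md.mul mR)]
    rw [inv_jac (WithLp.toLp 2 (z₀, (0 : ℝ))) l hl]
    refine lintegral_congr_ae ?_
    have hne : ∀ᵐ x : WithLp 2 (Zn n × ℝ), x ≠ WithLp.toLp 2 (z₀, (0 : ℝ)) :=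
      ae_ne_pt _
    filter_upwards [hne] with x hx
    have hq : ‖x - WithLp.toLp 2 (z₀, (0 : ℝ))‖ ^ 2 = QQ z₀ x.ofLp := by
      rw [WithLp.prod_norm_sq_eq_of_L2]
      simp [QQ, norm_sub_rev]
    have hq1 : ‖x - WithLp.toLp 2 (z₀, (0 : ℝ))‖ = √(QQ z₀ x.ofLp) := by
      rw [← hq, Real.sqrt_sq (norm_nonneg _)]
    have hpos : 0 < ‖x - WithLp.toLp 2 (z₀, (0 : ℝ))‖ := norm_pos_iff.2 (sub_ne_zero.2 hx)
    have hk : (kinv (WithLp.toLp 2 (z₀, (0 : ℝ))) l x).ofLp = JW z₀ l x.ofLp := by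
      simp only [kinv, JW, div_pow, hq]
      ext <;> simp
    simp only [Pi.mul_apply, hk]
    rw [hnorm, ← hq1]
    have hJ2 : |(JW z₀ l x.ofLp).2| = (l / ‖x - WithLp.toLp 2 (z₀, (0 : ℝ))‖) ^ 2 * |x.ofLp.2| := by
      simp only [JW, ← hq, div_pow]
      rw [abs_mul, abs_of_pos (by positivity)]
    set d := l / ‖x - WithLp.toLp 2 (z₀, (0 : ℝ))‖ with hd
    have dpos : 0 < d := by positivity
    rw [hJ2]
    have e1 : d ^ (2 * Module.finrank ℝ (WithLp 2 (Zn n × ℝ))) = d ^ (2 * ((n : ℝ) + 3)) := by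
      rw [← Real.rpow_natCast]
      congr 1
      have : Module.finrank ℝ (WithLp 2 (Zn n × ℝ)) = n + 3 := by
        rw [LinearEquiv.finrank_eq (WithLp.linearEquiv 2 ℝ (Zn n × ℝ))]
        simp
      rw [this]; push_cast; ring
    have e2 : d ^ (2 * ((n : ℝ) + 2 + b)) = (d ^ 2) ^ (b - 1) * d ^ (2 * ((n : ℝ) + 3)) := by
      rw [← Real.rpow_natCast, ← Real.rpow_mul dpos.le, ← Real.rpow_add dpos]
      congr 1; push_cast; ring
    rw [e1, e2, Real.mul_rpow (by positivity) (abs_nonneg _), ENNReal.ofReal_mul (by positivity),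
      ENNReal.ofReal_mul (by positivity)]
    ring

/-- Moving sphere data. -/
lemma mkMS {n p : ℕ} {a α : ℝ} (hp : 1 ≤ p) (ha : 1 ≤ a) (hγ : 0 < (n : ℝ) + 2 * a - 2 * p)
    (hα : α = ((n : ℝ) + 2 * a + 2 * p) / ((n : ℝ) + 2 * a - 2 * p))
    (u : EuclideanSpace ℝ (Fin n) × ℝ → ℝ) (hu : ContinuousOn u (SS n))
    (upos : ∀ z : Zn n, 0 < u (Psi (z, 0))) (c : ℝ) (hc : 0 < c)
    (rep : ∀ z : Zn n, ENNReal.ofReal (c * u (Psi (z, 0))) =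
      ∫⁻ w, ENNReal.ofReal (QQ z w ^ (-((n : ℝ) + 2 * a - 2 * p) / 2) * u (Psi w) ^ α)
        ∂(mu n (2 * a - 2)))
    (z₀ : Zn n) (hz : z₀ (Sum.inr 1) = 0) :
    MS (mu n (2 * a - 2)) QQ prW (fun z => u (Psi (z, 0))) (n + 2 * a)
      (n + 2 * a - 2 * p) α c z₀ (JW z₀) := by
  have hb : 0 ≤ 2 * a - 2 := by linarith
  have hp' : (1 : ℝ) ≤ p := by exact_mod_cast hp
  have hN : (n : ℝ) + 2 * a = n + 2 + (2 * a - 2) := by ring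
  have cu := comp_cont hu
  constructor
  · exact cu.comp (by fun_prop : Continuous fun z : Zn n => (z, (0 : ℝ)))
  · exact upos
  · exact hc
  · exact hγ
  · rw [hα, one_lt_div hγ]; linarith
  · rw [hα, mul_div_cancel₀ _ hγ.ne']; ring
  · exact prW_cont.measurable
  · exact QQ_meas
  · exact QQ_nonneg
  · intro w; unfold QQ; fun_prop
  · intro z; exact ae_QQ z 0
  · intro z
    simp only [Psi_prW]
    exact rep z
  · exact JW_meas z₀
  · intro l hl w hw; exact prW_JW hz hl hw
  · intro l hl w hw; exact JW_JW z₀ l hl w (QQ_pos hz hw)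
  · intro l hl z w hzz hw
    have h := QQ_pos hz hw
    rw [prW_norm hz, QQ_JW z z₀ l w h.ne', QQ_expand (kinv z₀ l z) z₀ w]
    have h2 : 0 < ‖z - z₀‖ := norm_pos_iff.2 (sub_ne_zero.2 hzz)
    rw [kinv_sub_norm z₀ l hl z hzz]
    have h3 : kinv z₀ l z - z₀ = (l / ‖z - z₀‖) ^ 2 • (z - z₀) := by simp [kinv]
    rw [h3, real_inner_smul_left]
    field_simp
    ring
  · intro l hl z w hw
    have h := QQ_pos hz hw
    rw [prW_norm hz, QQ_JW z z₀ l w h.ne', QQ_expand z z₀ w]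
    ring
  · intro l hl h mh
    rw [hN]
    exact mu_jac hb z₀ hz l hl h mh
  · intro l
    filter_upwards [ae_QQ (b := 2 * a - 2) z₀ (l ^ 2)] with w hw h
    apply hw
    rw [← prW_norm hz, h]
  · exact mu_open hb

section LZ
variable {V : Type*} [NormedAddCommGroup V] [InnerProductSpace ℝ V]

lemma lz_const {f : V → ℝ} {γ : ℝ} (hγ : 0 < γ) (fpos : ∀ z, 0 < f z)
    (hG : ∀ z₀ : V, ∀ l > 0, ∀ z, z ≠ z₀ → ‖z - z₀‖ < l → f z ≤ kelv γ f z₀ l z) (z y : V) :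
    f z ≤ f y := by
  rcases eq_or_ne z y with rfl | hzy
  · exact le_rfl
  have hd : 0 < ‖y - z‖ := norm_pos_iff.2 (sub_ne_zero.2 hzy.symm)
  have key : ∀ T : ℝ, 0 < T → f z ≤ ((1 + T) / T) ^ (γ / 2) * f y := by
    intro T hT
    have h1 : z - (z - T • (y - z)) = T • (y - z) := by abel
    have h2 : ‖z - (z - T • (y - z))‖ = T * ‖y - z‖ := by
      rw [h1, norm_smul, Real.norm_of_nonneg hT.le]
    set l := √(T * (1 + T)) * ‖y - z‖ with hl
    have hl0 : 0 < l := by positivity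
    have hsq : √(T * (1 + T)) ^ 2 = T * (1 + T) := Real.sq_sqrt (by positivity)
    have hlt : T < √(T * (1 + T)) := by
      apply Real.lt_sqrt_of_sq_lt; nlinarith
    have h3 := hG (z - T • (y - z)) l hl0 z ?_ ?_
    · unfold kelv at h3
      have h4 : (l / ‖z - (z - T • (y - z))‖) ^ 2 = (1 + T) / T := by
        rw [h2, hl, div_pow, mul_pow, mul_pow, hsq]; field_simp
      have h5 : kinv (z - T • (y - z)) l z = y := by
        unfold kinv
        rw [h4, h1, smul_smul, div_mul_cancel₀ _ hT.ne', add_smul, one_smul]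
        abel
      rw [h5] at h3
      have h6 : (l / ‖z - (z - T • (y - z))‖) ^ γ = ((1 + T) / T) ^ (γ / 2) := by
        rw [← h4, ← Real.rpow_natCast, ← Real.rpow_mul (by positivity)]
        congr 1; push_cast; ring
      rwa [h6] at h3
    · intro h
      rw [← sub_eq_zero, ← norm_eq_zero, h2] at h
      have : 0 < T * ‖y - z‖ := by positivity
      linarith
    · rw [h2, hl]; gcongr
  have hlim : Tendsto (fun T : ℝ => ((1 + T) / T) ^ (γ / 2) * f y) atTop (𝓝 (1 ^ (γ / 2) * f y)) := by
    refine Tendsto.mul_const _ ?_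
    refine Tendsto.rpow_const ?_ (Or.inl one_ne_zero)
    have : Tendsto (fun T : ℝ => T⁻¹ + 1) atTop (𝓝 (0 + 1)) := tendsto_inv_atTop_zero.add_const 1
    rw [zero_add] at this
    refine this.congr' ?_
    filter_upwards [eventually_gt_atTop 0] with T hT
    field_simp
    try ring
  rw [Real.one_rpow, one_mul] at hlim
  refine ge_of_tendsto hlim ?_
  filter_upwards [eventually_gt_atTop 0] with T hT using key T hT

lemma ray_norm {e : V} (he : ‖e‖ = 1) (b : V) :
    Tendsto (fun T : ℝ => T / ‖b + T • e‖) atTop (𝓝 1) := by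
  have h1 : Tendsto (fun T : ℝ => ‖T⁻¹ • b + e‖) atTop (𝓝 1) := by
    have : Tendsto (fun T : ℝ => T⁻¹ • b + e) atTop (𝓝 ((0 : ℝ) • b + e)) :=
      (tendsto_inv_atTop_zero.smul_const b).add_const e
    have := this.norm
    simpa [he] using this
  have h2 := h1.inv₀ one_ne_zero
  rw [inv_one] at h2
  refine h2.congr' ?_
  filter_upwards [eventually_gt_atTop 0] with T hT
  have : b + T • e = T • (T⁻¹ • b + e) := by
    rw [smul_add, smul_smul, mul_inv_cancel₀ hT.ne', one_smul]
  rw [this, norm_smul, Real.norm_of_nonneg hT.le]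
  rw [div_mul_eq_div_div, div_self hT.ne', one_div]

lemma ray_kinv {f : V → ℝ} (hf : Continuous f) {e : V} (he : ‖e‖ = 1) (c b : V) (l : ℝ) :
    Tendsto (fun T : ℝ => f (kinv c l (b + T • e))) atTop (𝓝 (f c)) := by
  refine (hf.tendsto c).comp ?_
  have hr := ray_norm he (b - c)
  have h1 : Tendsto (fun T : ℝ => (l ^ 2 * T⁻¹) * (T / ‖b - c + T • e‖)) atTop (𝓝 ((l ^ 2 * 0) * 1)) :=
    (tendsto_inv_atTop_zero.const_mul _).mul hr
  rw [mul_zero, zero_mul] at h1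
  rw [tendsto_iff_norm_sub_tendsto_zero]
  have h1' := h1.abs
  rw [abs_zero] at h1'
  refine h1'.congr' ?_
  filter_upwards [eventually_gt_atTop 0, hr.eventually_ne one_ne_zero] with T hT hne
  have h0 : ‖b - c + T • e‖ ≠ 0 := by
    intro h; rw [h, div_zero] at hne; exact hne rfl
  have h2 : b + T • e - c = b - c + T • e := by abel
  rw [kinv, add_sub_cancel_left, norm_smul, h2, norm_pow, Real.norm_eq_abs, sq_abs, div_pow]
  rw [abs_of_nonneg (by positivity)]
  field_simp

lemma lz_all [Nontrivial V] {f : V → ℝ} {γ : ℝ} (hγ : 0 < γ) (hf : Continuous f)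
    (fpos : ∀ z, 0 < f z) (z₁ z₂ : V)
    (hE : ∃ l > 0, ∀ z, z ≠ z₁ → f z = kelv γ f z₁ l z)
    (hG : ∀ l > 0, ∀ z, z ≠ z₂ → ‖z - z₂‖ < l → f z ≤ kelv γ f z₂ l z) : False := by
  obtain ⟨l, hl, hE⟩ := hE
  obtain ⟨e, he⟩ := exists_norm_eq V (zero_le_one (α := ℝ))
  have hr1 := ray_norm he (z₂ - z₁)
  have hA : Tendsto (fun T : ℝ => T ^ γ * f (z₂ + T • e)) atTop (𝓝 (1 ^ γ * (l ^ γ * f z₁))) := by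
    have h1 := (hr1.rpow_const (p := γ) (Or.inl one_ne_zero)).mul
      ((ray_kinv hf he z₁ z₂ l).const_mul (l ^ γ))
    refine h1.congr' ?_
    filter_upwards [eventually_gt_atTop 0, hr1.eventually_ne one_ne_zero] with T hT hne
    have h0 : ‖z₂ - z₁ + T • e‖ ≠ 0 := by
      intro h; rw [h, div_zero] at hne; exact hne rfl
    have hpos : 0 < ‖z₂ - z₁ + T • e‖ := lt_of_le_of_ne (norm_nonneg _) h0.symm
    have h2 : z₂ + T • e - z₁ = z₂ - z₁ + T • e := by abel
    have h3 : z₂ + T • e ≠ z₁ := by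
      rw [← sub_ne_zero, h2]; exact norm_ne_zero_iff.1 h0
    rw [hE _ h3, kelv, h2, Real.div_rpow hT.le hpos.le, Real.div_rpow hl.le hpos.le]
    ring
  rw [Real.one_rpow, one_mul] at hA
  have key : ∀ m : ℝ, 0 < m → m ^ γ * f z₂ ≤ l ^ γ * f z₁ := by
    intro m hm
    refine le_of_tendsto_of_tendsto ((ray_kinv hf he z₂ z₂ m).const_mul (m ^ γ)) hA ?_
    filter_upwards [eventually_gt_atTop m] with T hT
    have hT0 : 0 < T := hm.trans hT
    have hn : ‖z₂ + T • e - z₂‖ = T := by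
      rw [add_sub_cancel_left, norm_smul, he, mul_one, Real.norm_of_nonneg hT0.le]
    have hy : z₂ + T • e ≠ z₂ := by
      rw [← sub_ne_zero, ← norm_ne_zero_iff, hn]; exact hT0.ne'
    have h4 := hG m hm (kinv z₂ m (z₂ + T • e)) (kinv_ne z₂ m hm _ hy) (by
      rw [kinv_sub_norm z₂ m hm _ hy, hn, div_lt_iff₀ hT0]; nlinarith)
    rw [kelv, kinv_kinv z₂ m hm _ hy, kinv_sub_norm z₂ m hm _ hy, hn] at h4
    have h5 : m / (m ^ 2 / T) = T / m := by field_simp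
    rw [h5, Real.div_rpow hT0.le hm.le] at h4
    have : 0 < m ^ γ := by positivity
    calc m ^ γ * f (kinv z₂ m (z₂ + T • e)) ≤ m ^ γ * (T ^ γ / m ^ γ * f (z₂ + T • e)) := by gcongr
      _ = _ := by field_simp
  have h6 : Tendsto (fun m : ℝ => m ^ γ * f z₂) atTop atTop :=
    (tendsto_rpow_atTop hγ).atTop_mul_const (fpos z₂)
  obtain ⟨m, hm, hm'⟩ := ((h6.eventually_gt_atTop (l ^ γ * f z₁)).and (eventually_gt_atTop 0)).exists
  exact absurd (key m hm') (not_le.2 hm)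

/-- Either all centres are critical, or the function is constant. -/
lemma lz_dich [Nontrivial V] {f : V → ℝ} {γ : ℝ} (hγ : 0 < γ) (hf : Continuous f)
    (fpos : ∀ z, 0 < f z)
    (h : ∀ z₀, (∃ l > 0, ∀ z, z ≠ z₀ → f z = kelv γ f z₀ l z) ∨
      (∀ l > 0, ∀ z, z ≠ z₀ → ‖z - z₀‖ < l → f z ≤ kelv γ f z₀ l z)) :
    (∀ z₀, ∃ l > 0, ∀ z, z ≠ z₀ → f z = kelv γ f z₀ l z) ∨ ∀ z y, f z = f y := by
  by_cases hc : ∃ z₁, ∃ l > 0, ∀ z, z ≠ z₁ → f z = kelv γ f z₁ l z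
  · left
    obtain ⟨z₁, hz₁⟩ := hc
    intro z₂
    rcases h z₂ with h' | h'
    · exact h'
    · exact (lz_all hγ hf fpos z₁ z₂ hz₁ h').elim
  · right
    have hG : ∀ z₀ : V, ∀ l > 0, ∀ z, z ≠ z₀ → ‖z - z₀‖ < l → f z ≤ kelv γ f z₀ l z := by
      intro z₀
      rcases h z₀ with h' | h'
      · exact (hc ⟨z₀, h'⟩).elim
      · exact h'
    intro z y
    exact le_antisymm (lz_const hγ fpos hG z y) (lz_const hγ fpos hG y z)
end LZ

/-- The horizontal hyperplane of centres. -/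
noncomputable def Vn (n : ℕ) : Submodule ℝ (Zn n) :=
  LinearMap.ker (EuclideanSpace.proj (Sum.inr 1) : Zn n →L[ℝ] ℝ).toLinearMap

lemma Vn_mem {n : ℕ} (z : Zn n) : z ∈ Vn n ↔ z (Sum.inr 1) = 0 := by
  simp [Vn]

/-- Points of the hyperplane. -/
noncomputable def embZ {n : ℕ} (x : EuclideanSpace ℝ (Fin n)) (s : ℝ) : Zn n :=
  WithLp.toLp 2 (Sum.elim (fun i => x i) ![s, 0])

lemma embZ_mem {n : ℕ} (x : EuclideanSpace ℝ (Fin n)) (s : ℝ) : embZ x s ∈ Vn n := by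
  rw [Vn_mem]; simp [embZ]

lemma Psi_embZ {n : ℕ} (x : EuclideanSpace ℝ (Fin n)) (s : ℝ) :
    Psi (embZ x s, 0) = (x, s ^ 2 / 4) := by
  ext <;> simp [Psi, embZ]

lemma Psi_surj {n : ℕ} (x : EuclideanSpace ℝ (Fin n)) (y : ℝ) (hy : 0 ≤ y) :
    Psi (embZ x (2 * √y), 0) = (x, y) := by
  rw [Psi_embZ, mul_pow, Real.sq_sqrt hy]; congr 1; ring

lemma Vn_eq_embZ {n : ℕ} (z : Zn n) (hz : z ∈ Vn n) :
    z = embZ (WithLp.toLp 2 (fun i => z (Sum.inl i))) (z (Sum.inr 0)) := by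
  rw [Vn_mem] at hz
  ext j
  rcases j with i | k
  · simp [embZ]
  · fin_cases k
    · simp [embZ]
    · simpa [embZ] using hz

lemma prW_Vn {n : ℕ} (z : Zn n) (hz : z ∈ Vn n) : prW (z, 0) = z := by
  rw [Vn_mem] at hz
  ext j
  by_cases hj : j = Sum.inr 1
  · subst hj; simp [prW, hz]
  · simp [prW, hj]

lemma Vn_nontriv (n : ℕ) : Nontrivial (Vn n) := by
  refine ⟨⟨⟨embZ 0 1, embZ_mem _ _⟩, 0, ?_⟩⟩
  intro h
  have h1 : embZ (n := n) 0 1 = 0 := congrArg Subtype.val h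
  have := congrArg (fun z : Zn n => z (Sum.inr 0)) h1
  simp [embZ] at this

lemma kinv_coe {n : ℕ} (c z : Vn n) (l : ℝ) :
    ((kinv c l z : Vn n) : Zn n) = kinv (c : Zn n) l (z : Zn n) := by
  simp [kinv]

lemma fV_diff {n : ℕ} {u : EuclideanSpace ℝ (Fin n) × ℝ → ℝ} (hu : DifferentiableOn ℝ u (SS n)) :
    Differentiable ℝ (fun z : Vn n => u (Psi ((z : Zn n), 0))) := by
  have h1 : Differentiable ℝ (fun z : Zn n => Psi (z, 0)) := by
    unfold Psi
    refine Differentiable.prodMk ?_ ?_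
    · rw [differentiable_euclidean]
      intro i
      simp only
      fun_prop
    · simp only; fun_prop
  have h2 : Differentiable ℝ (fun z : Vn n => Psi ((z : Zn n), 0)) :=
    h1.comp (Vn n).subtypeL.differentiable
  rw [← differentiableOn_univ] at h2 ⊢
  exact hu.comp h2 fun z _ => Psi_mem _

lemma DW_const {n : ℕ} (v : EuclideanSpace ℝ (Fin n) × ℝ) (c : ℝ) :
    DW v (fun _ => c) = fun _ => 0 := by
  funext z; simp [DW]

lemma nAt_const {n : ℕ} (a c : ℝ) : nAt n a (fun _ => c) = fun _ => 0 := by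
  funext z; simp [nAt, DW_const]

lemma nAt_iter_const {n : ℕ} (a c : ℝ) (k : ℕ) : (nAt n a)^[k + 1] (fun _ => c) = fun _ => 0 := by
  induction k with
  | zero => exact nAt_const a c
  | succ k ih => rw [iterate_succ_apply', ih, nAt_const]

lemma negAIter_const {n : ℕ} (a c : ℝ) (k : ℕ) {u : EuclideanSpace ℝ (Fin n) × ℝ → ℝ}
    (hu : ∀ z, 0 < z.2 → u z = c) : ∀ z, 0 < z.2 → negAIter n a (k + 1) u z = 0 := by
  have h : ∀ k : ℕ, ∀ z, 0 < z.2 → negAIter n a k u z = (nAt n a)^[k] (fun _ => c) z := by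
    intro k
    unfold negAIter
    induction k with
    | zero => intro z hz; exact hu z hz
    | succ k ih =>
      intro z hz
      rw [iterate_succ_apply', iterate_succ_apply']
      exact nAt_eq a ih z hz
  intro z hz
  rw [h (k + 1) z hz, nAt_iter_const]

lemma embZ_norm {n : ℕ} (x : EuclideanSpace ℝ (Fin n)) (s : ℝ) (x' : EuclideanSpace ℝ (Fin n))
    (s' : ℝ) : ‖embZ x s - embZ x' s'‖ ^ 2 = ‖x - x'‖ ^ 2 + (s - s') ^ 2 := by
  rw [EuclideanSpace.norm_sq_eq, EuclideanSpace.norm_sq_eq]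
  simp [embZ]

section assembly
variable {n p : ℕ} {a α : ℝ} {u : EuclideanSpace ℝ (Fin n) × ℝ → ℝ}

lemma pos_of_rep (ha : 1 ≤ a) (γ c : ℝ) (hu : ContinuousOn u (SS n))
    (u0 : ∀ z : EuclideanSpace ℝ (Fin n) × ℝ, 0 ≤ z.2 → 0 ≤ u z)
    (une : ∃ z : EuclideanSpace ℝ (Fin n) × ℝ, 0 ≤ z.2 ∧ u z ≠ 0)
    (rep : ∀ z : Zn n, ENNReal.ofReal (c * u (Psi (z, 0))) =
      ∫⁻ w, ENNReal.ofReal (QQ z w ^ (-γ / 2) * u (Psi w) ^ α) ∂(mu n (2 * a - 2))) :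
    0 < c ∧ ∀ z : Zn n, 0 < u (Psi (z, 0)) := by
  have hb : 0 ≤ 2 * a - 2 := by linarith
  have cu := comp_cont hu
  have cv : Continuous fun z : Zn n => u (Psi (z, 0)) :=
    cu.comp (by fun_prop : Continuous fun z : Zn n => (z, (0 : ℝ)))
  have key : ∀ z : Zn n, 0 < c * u (Psi (z, 0)) := by
    intro z
    rw [← ENNReal.ofReal_pos, rep z, pos_iff_ne_zero]
    intro h0
    have mq := QQ_meas z
    have mu' := cu.measurable
    have mm : Measurable fun w => ENNReal.ofReal (QQ z w ^ (-γ / 2) * u (Psi w) ^ α) :=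
      ((mq.pow_const _).mul (mu'.pow_const _)).ennreal_ofReal
    rw [lintegral_eq_zero_iff mm] at h0
    obtain ⟨⟨x, y⟩, hy, hne⟩ := une
    have h1 := mu_open (n := n) hb {z | 0 < u (Psi (z, 0))} (isOpen_lt continuous_const cv)
      ⟨(embZ x (2 * √y), 0), by
        rw [Set.mem_setOf_eq, Psi_prW, Psi_surj x y hy]
        exact lt_of_le_of_ne (u0 _ hy) hne.symm⟩
    apply h1
    have h2 : ∀ᵐ w ∂(mu n (2 * a - 2)), w ∉ prW ⁻¹' {z | 0 < u (Psi (z, 0))} := by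
      filter_upwards [h0, ae_QQ (b := 2 * a - 2) z 0] with w hw hq hmem
      simp only [Set.mem_preimage, Set.mem_setOf_eq, Psi_prW] at hmem
      have hq' : 0 < QQ z w := lt_of_le_of_ne (QQ_nonneg z w) hq.symm
      have : 0 < QQ z w ^ (-γ / 2) * u (Psi w) ^ α := by positivity
      simp only [Pi.zero_apply, ENNReal.ofReal_eq_zero] at hw
      linarith
    rw [ae_iff] at h2
    simpa using h2
  have hu0 : ∀ z : Zn n, 0 ≤ u (Psi (z, 0)) := fun z => u0 _ (Psi_mem _)
  constructor
  · exact pos_of_mul_pos_left (key 0) (hu0 0)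
  · intro z
    exact lt_of_le_of_ne (hu0 z) (fun h => by have := key z; rw [← h] at this; simp at this)

lemma bubble_form (hp : 1 ≤ p) (ha : 1 ≤ a) (hγ : 0 < (n : ℝ) + 2 * a - 2 * p)
    (hα : α = ((n : ℝ) + 2 * a + 2 * p) / ((n : ℝ) + 2 * a - 2 * p))
    (hu : ContDiffOn ℝ (2 * p) u (SS n))
    (heq : ∀ z : EuclideanSpace ℝ (Fin n) × ℝ, 0 < z.2 → negAIter n a p u z = u z ^ α)
    (c : ℝ) (hc : 0 < c) (upos : ∀ z : Zn n, 0 < u (Psi (z, 0)))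
    (rep : ∀ z : Zn n, ENNReal.ofReal (c * u (Psi (z, 0))) =
      ∫⁻ w, ENNReal.ofReal (QQ z w ^ (-((n : ℝ) + 2 * a - 2 * p) / 2) * u (Psi w) ^ α)
        ∂(mu n (2 * a - 2))) :
    ∃ (x₀ : EuclideanSpace ℝ (Fin n)) (d A : ℝ), 0 < d ∧ 0 < A ∧
      ∀ (x : EuclideanSpace ℝ (Fin n)) (y : ℝ), 0 ≤ y →
        u (x, y) = A * (d + ‖x - x₀‖ ^ 2 + 4 * y) ^ (-((n : ℝ) + 2 * a - 2 * p) / 2) := by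
  have := Vn_nontriv n
  set γ := (n : ℝ) + 2 * a - 2 * p with hγd
  have hud : DifferentiableOn ℝ u (SS n) := hu.differentiableOn (by
    norm_cast; omega)
  have fdiff := fV_diff hud
  have hd := lz_dich (V := Vn n) (f := fun z : Vn n => u (Psi ((z : Zn n), 0))) hγ fdiff.continuous
    (fun z => upos z) (by
      intro z₀
      have hz₀ := (Vn_mem _).1 z₀.2
      rcases (mkMS hp ha hγ hα u hu.continuousOn upos c hc rep z₀ hz₀).main with h | h
      · left
        obtain ⟨l, hl, h⟩ := h
        refine ⟨l, hl, fun z hz => ?_⟩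
        have h1 := h ((z : Zn n), 0) (by
          rw [prW_Vn _ z.2]; exact fun h => hz (Subtype.ext h))
        rw [prW_Vn _ z.2] at h1
        unfold kelv at h1 ⊢
        beta_reduce at h1 ⊢
        rw [kinv_coe]
        exact h1
      · right
        intro l hl z hz hlt
        have h1 := h l hl z (fun h => hz (Subtype.ext h)) hlt
        unfold kelv at h1 ⊢
        beta_reduce at h1 ⊢
        rw [kinv_coe]
        exact h1)
  rcases hd with hd | hd
  · obtain ⟨xb, d, A, hd0, hA, hf⟩ := bubble_of_kelvin
      (fun z : Vn n => u (Psi ((z : Zn n), 0))) γ hγ fdiff (fun z => upos z) hd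
    have hform : ∀ x s, u (x, s ^ 2 / 4)
        = A * (d + ‖embZ x s - (xb : Zn n)‖ ^ 2) ^ (-γ / 2) := by
      intro x s
      have := hf ⟨embZ x s, embZ_mem x s⟩
      simp only [Psi_embZ] at this
      exact this
    obtain ⟨x₀, s₀, hx₀⟩ : ∃ x₀ s₀, (xb : Zn n) = embZ x₀ s₀ := ⟨_, _, Vn_eq_embZ _ xb.2⟩
    have hs : s₀ = 0 := by
      have h1 := hform x₀ s₀
      have h2 := hform x₀ (-s₀)
      rw [neg_sq, h1, hx₀, embZ_norm, embZ_norm] at h2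
      simp only [sub_self, norm_zero] at h2
      have h3 := mul_left_cancel₀ hA.ne' h2
      by_contra hne
      have : 0 < s₀ ^ 2 := by positivity
      have h4 := Real.rpow_lt_rpow_of_neg (x := d + (0 ^ 2 + 0 ^ 2)) (y := d + (0 ^ 2 + (-s₀ - s₀) ^ 2))
        (z := -γ / 2) (by positivity) (by nlinarith) (by linarith)
      linarith
    refine ⟨x₀, d, A, hd0, hA, fun x y hy => ?_⟩
    have h1 := hform x (2 * √y)
    rw [mul_pow, Real.sq_sqrt hy, hx₀, embZ_norm, hs, sub_zero, mul_pow, Real.sq_sqrt hy] at h1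
    have e1 : (2 : ℝ) ^ 2 * y / 4 = y := by ring
    rw [e1] at h1
    rw [h1]
    congr 2; ring
  · exfalso
    have hconst : ∀ z : EuclideanSpace ℝ (Fin n) × ℝ, 0 < z.2 → u z = u (Psi ((0 : Zn n), 0)) := by
      rintro ⟨x, y⟩ hy
      have := hd ⟨embZ x (2 * √y), embZ_mem _ _⟩ 0
      simp only [Psi_surj x y (le_of_lt hy)] at this
      exact this
    obtain ⟨k, rfl⟩ : ∃ k, p = k + 1 := ⟨p - 1, by omega⟩
    have h1 := heq (0, 1) (by simp)
    rw [negAIter_const a _ k hconst _ (by simp), hconst (0, 1) (by simp)] at h1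
    have h2 := upos 0
    have : 0 < u (Psi ((0 : Zn n), 0)) ^ α := by positivity
    linarith

end assembly

/-- The universal integral appearing in the normalizing constant. -/
noncomputable def Iuniv (n : ℕ) (b γ M : ℝ) : ENNReal :=
  ∫⁻ q, ENNReal.ofReal (q ^ (-γ / 2) * (1 + q) ^ (-M / 2)) ∂(nu n b)

lemma nu_ae_nonneg {n : ℕ} {b : ℝ} : ∀ᵐ q ∂(nu n b), 0 ≤ q := by
  rw [nu, ae_map_iff (QQ_meas 0).aemeasurable measurableSet_Ici]
  exact Eventually.of_forall fun w => QQ_nonneg 0 w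

lemma const_eq {n : ℕ} {b : ℝ} (hb : 0 ≤ b) (γ M α c A d : ℝ) (hγ : 0 < γ) (hα : α = M / γ)
    (hc : 0 < c) (hA : 0 < A) (hd : 0 < d)
    (h : ENNReal.ofReal (c * (A * d ^ (-γ / 2))) =
      ∫⁻ q, ENNReal.ofReal (q ^ (-γ / 2) * (A * (d + q) ^ (-γ / 2)) ^ α) ∂(nu n b)) :
    c = A ^ (α - 1) * d ^ (((n : ℝ) + 2 + b) / 2 - M / 2) * (Iuniv n b γ M).toReal := by
  set N := (n : ℝ) + 2 + b with hN
  have e1 : ∫⁻ q, ENNReal.ofReal (q ^ (-γ / 2) * (A * (d + q) ^ (-γ / 2)) ^ α) ∂(nu n b)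
      = ∫⁻ q, ENNReal.ofReal (A ^ α * d ^ (-γ / 2) * d ^ (-M / 2)) *
        ENNReal.ofReal (((√d ^ 2)⁻¹ * q) ^ (-γ / 2) * (1 + (√d ^ 2)⁻¹ * q) ^ (-M / 2))
          ∂(nu n b) := by
    apply lintegral_congr_ae
    filter_upwards [nu_ae_nonneg] with q hq
    rw [← ENNReal.ofReal_mul (by positivity), Real.sq_sqrt hd.le]
    congr 1
    have h1 : q ^ (-γ / 2) = d ^ (-γ / 2) * (d⁻¹ * q) ^ (-γ / 2) := by
      rw [← Real.mul_rpow hd.le (by positivity)]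
      congr 1
      field_simp
    have h2 : (d + q) ^ (-M / 2) = d ^ (-M / 2) * (1 + d⁻¹ * q) ^ (-M / 2) := by
      rw [← Real.mul_rpow hd.le (by positivity)]
      congr 1
      field_simp
    have h3 : (A * (d + q) ^ (-γ / 2)) ^ α = A ^ α * (d + q) ^ (-M / 2) := by
      rw [Real.mul_rpow hA.le (by positivity), ← Real.rpow_mul (by positivity)]
      congr 2
      rw [hα]
      field_simp
    rw [h3, h1, h2]
    ring
  have mG : Measurable fun q : ℝ => ENNReal.ofReal (q ^ (-γ / 2) * (1 + q) ^ (-M / 2)) :=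
    ((measurable_id.pow_const _).mul ((measurable_id.const_add 1).pow_const _)).ennreal_ofReal
  have mL : Measurable fun q : ℝ => (√d ^ 2)⁻¹ * q := by fun_prop
  have e2 : ∫⁻ q, ENNReal.ofReal (((√d ^ 2)⁻¹ * q) ^ (-γ / 2) *
      (1 + (√d ^ 2)⁻¹ * q) ^ (-M / 2)) ∂(nu n b)
      = ENNReal.ofReal (d ^ (N / 2)) * Iuniv n b γ M := by
    have e3 := lintegral_map (μ := nu n b) mG mL
    rw [← e3, nu_scal hb _ (Real.sqrt_pos.2 hd), lintegral_smul_measure, Iuniv, smul_eq_mul]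
    congr 2
    rw [Real.sqrt_eq_rpow, ← Real.rpow_mul hd.le]
    congr 1
    rw [hN]; ring
  rw [e1, lintegral_const_mul' _ _ ENNReal.ofReal_ne_top, e2] at h
  have h4 := congrArg ENNReal.toReal h
  rw [ENNReal.toReal_mul, ENNReal.toReal_mul, ENNReal.toReal_ofReal (by positivity),
    ENNReal.toReal_ofReal (by positivity), ENNReal.toReal_ofReal (by positivity)] at h4
  have h5 : A ^ α = A ^ (α - 1) * A := by
    rw [Real.rpow_sub_one hA.ne']; field_simp
  have h6 : d ^ (N / 2 - M / 2) = d ^ (-M / 2) * d ^ (N / 2) := by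
    rw [← Real.rpow_add hd]; congr 1; ring
  have h7 : 0 < d ^ (-γ / 2) := by positivity
  rw [h5] at h4
  rw [h6]
  have h8 : (A * d ^ (-γ / 2)) * c = (A * d ^ (-γ / 2)) *
      (A ^ (α - 1) * (d ^ (-M / 2) * d ^ (N / 2)) * (Iuniv n b γ M).toReal) := by
    linarith [h4]
  exact mul_left_cancel₀ (by positivity) h8

theorem stmt_1 (n p : ℕ) (hn : 1 ≤ n) (hp : 1 ≤ p) (a : ℝ) (ha : 1 ≤ a)
    (hpa : 2 * (p : ℝ) < n + 2 * a) :
    ∃ c₀ : ℝ, 0 < c₀ ∧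
      ∀ u : EuclideanSpace ℝ (Fin n) × ℝ → ℝ,
        ContDiffOn ℝ (2 * p) u {z : EuclideanSpace ℝ (Fin n) × ℝ | 0 ≤ z.2} →
        (∀ z : EuclideanSpace ℝ (Fin n) × ℝ, 0 ≤ z.2 → 0 ≤ u z) →
        (∀ z : EuclideanSpace ℝ (Fin n) × ℝ, 0 < z.2 →
          negAIter n a p u z =
            u z ^ (((n : ℝ) + 2 * a + 2 * p) / ((n : ℝ) + 2 * a - 2 * p))) →
        (∃ z : EuclideanSpace ℝ (Fin n) × ℝ, 0 ≤ z.2 ∧ u z ≠ 0) →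
        ∃ (x₀ : EuclideanSpace ℝ (Fin n)) (t : ℝ), 0 < t ∧
          ∀ (x : EuclideanSpace ℝ (Fin n)) (y : ℝ), 0 ≤ y →
            u (x, y) =
              c₀ * (t / (t ^ 2 + 4 * y + ‖x - x₀‖ ^ 2)) ^
                (((n : ℝ) + 2 * a - 2 * p) / 2) := by
  have hγ : 0 < (n : ℝ) + 2 * a - 2 * p := by linarith
  have hb : 0 ≤ 2 * a - 2 := by linarith
  have hp' : (0 : ℝ) < p := by exact_mod_cast hp
  set γ := (n : ℝ) + 2 * a - 2 * p with hγd
  set M := (n : ℝ) + 2 * a + 2 * p with hM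
  set c := ∫ x, gf ((n : ℝ) + 2 * a) γ p x ∂(nu n (2 * a - 2)) with hc
  set I := (Iuniv n (2 * a - 2) γ M).toReal with hI
  have hα1 : 1 < M / γ := by rw [one_lt_div hγ]; linarith
  refine ⟨if 0 < c / I then (c / I) ^ (γ / (4 * p)) else 1, by split_ifs <;> positivity, ?_⟩
  intro u hu u0 heq une
  have rep : ∀ z : Zn n, ENNReal.ofReal (c * u (Psi (z, 0))) =
      ∫⁻ w, ENNReal.ofReal (QQ z w ^ (-γ / 2) * u (Psi w) ^ (M / γ)) ∂(mu n (2 * a - 2)) :=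
    fun z => ((mkRP hp ha hγ hα1 u hu u0 heq z).repr).symm
  obtain ⟨c0, upos⟩ := pos_of_rep ha γ c hu.continuousOn u0 une rep
  obtain ⟨x₀, d, A, hd, hA, hform⟩ := bubble_form hp ha hγ rfl hu heq c c0 upos rep
  have hPsi : ∀ w, u (Psi w) = A * (d + QQ (embZ x₀ 0) w) ^ (-γ / 2) := by
    intro w
    have h1 := hform (Psi w).1 (Psi w).2 (Psi_mem w)
    have h2 : QQ (embZ x₀ 0) w = ‖(Psi w).1 - x₀‖ ^ 2 + 4 * (Psi w).2 := by
      unfold QQ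
      rw [norm_sub_rev, EuclideanSpace.norm_sq_eq, EuclideanSpace.norm_sq_eq]
      simp [embZ, Psi]
      ring
    rw [h2, ← add_assoc]
    exact h1
  have h3 := rep (embZ x₀ 0)
  simp only [hPsi, QQ_self, add_zero] at h3
  have mG : Measurable fun q : ℝ => ENNReal.ofReal
      (q ^ (-γ / 2) * (A * (d + q) ^ (-γ / 2)) ^ (M / γ)) :=
    ((measurable_id.pow_const _).mul ((((measurable_id.const_add d).pow_const _).const_mul
      A).pow_const _)).ennreal_ofReal
  have h4 := lintegral_map (μ := mu n (2 * a - 2)) mG (QQ_meas (embZ x₀ 0))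
  rw [map_QQ] at h4
  rw [← h4] at h3
  have h5 := const_eq hb γ M (M / γ) c A d hγ rfl c0 hA hd h3
  rw [← hI] at h5
  have hI0 : 0 < I := by
    rcases (ENNReal.toReal_nonneg : 0 ≤ I).lt_or_eq with h | h
    · exact h
    · rw [show I = 0 from h.symm, mul_zero] at h5; exact absurd h5 c0.ne'
  have h6 : c / I = A ^ (4 * p / γ) * d ^ (-(p : ℝ)) := by
    rw [div_eq_iff hI0.ne', h5]
    have k1 : M / γ - 1 = 4 * p / γ := by
      rw [div_sub_one hγ.ne']; congr 1; rw [hM, hγd]; ring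
    have k2 : ((n : ℝ) + 2 + (2 * a - 2)) / 2 - M / 2 = -(p : ℝ) := by rw [hM]; ring
    rw [k1, k2]
  have h7 : (c / I) ^ (γ / (4 * p)) = A * d ^ (-γ / 4) := by
    rw [h6, Real.mul_rpow (by positivity) (by positivity), ← Real.rpow_mul hA.le,
      ← Real.rpow_mul hd.le]
    have k1 : 4 * p / γ * (γ / (4 * p)) = 1 := by field_simp
    have k2 : -(p : ℝ) * (γ / (4 * p)) = -γ / 4 := by field_simp
    rw [k1, k2, Real.rpow_one]
  refine ⟨x₀, √d, Real.sqrt_pos.2 hd, fun x y hy => ?_⟩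
  rw [if_pos (by positivity), h7, hform x y hy, Real.sq_sqrt hd.le,
    Real.div_rpow (by positivity) (by positivity), Real.sqrt_eq_rpow, ← Real.rpow_mul hd.le]
  have k3 : d ^ (-γ / 4) * d ^ (1 / 2 * (γ / 2)) = 1 := by
    rw [← Real.rpow_add hd]
    convert Real.rpow_zero d using 2
    ring
  have k4 : (d + ‖x - x₀‖ ^ 2 + 4 * y) ^ (-γ / 2) = ((d + 4 * y + ‖x - x₀‖ ^ 2) ^ (γ / 2))⁻¹ := by
    rw [← Real.rpow_neg (by positivity)]
    congr 1 <;> ring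
  rw [k4]
  linear_combination (-A * ((d + 4 * y + ‖x - x₀‖ ^ 2) ^ (γ / 2))⁻¹) * k3
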